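/- Let G be a finite group, s a positive integer, and π = π(s) the set of primes dividing s. Then [vcs(G) = {s} and G has a nilpotent Hall π-subgroup] if and only if G = NH, where N is a normal Hall π-subgroup of G and H is an abelian π-complement of G, and one of the following occurs: (a) s is a prime power, H centralizes N (so that G = N × H internally), and cs(N) = {1, s}; (b) G/Z(G) is a Frobenius group with kernel NZ(G)/Z(G) of order s and complement HZ(G)/Z(G), and N contains no vanishing elements of G. -/

import Mathlib

open scoped Classical

noncomputable section

/-- `g` is a vanishing element of `G`: some irreducible complex character of `G`
takes the value `0` at `g`. -/
def IsVanishing (G : Type) [Group G] (g : G) : Prop :=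
  ∃ V : FDRep ℂ G, CategoryTheory.Simple V ∧ V.character g = 0

/-- The conjugacy class size of `g`, i.e. `|G : C_G(g)|`. -/
def classSize {G : Type*} [Group G] (g : G) : ℕ := (Subgroup.centralizer {g}).index

/-- The set of conjugacy class sizes of vanishing elements of `G`. -/
def vcs (G : Type) [Group G] : Set ℕ :=
  {n | ∃ g : G, IsVanishing G g ∧ classSize g = n}

/-- The set of conjugacy class sizes of `G`. -/
def cs (G : Type*) [Group G] : Set ℕ := {n | ∃ g : G, classSize g = n}

/-- `H` is a Hall `π`-subgroup of `G`. -/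
def IsHallSubgroup {G : Type*} [Group G] (π : Set ℕ) (H : Subgroup G) : Prop :=
  (∀ p : ℕ, p.Prime → p ∣ Nat.card H → p ∈ π) ∧
  (∀ p : ℕ, p.Prime → p ∣ H.index → p ∉ π)

/-- The set of prime divisors of `n`. -/
def primesOf (n : ℕ) : Set ℕ := {p | p.Prime ∧ p ∣ n}

/-- The `π`-part `n_π` of `n`: the largest divisor of `n` all of whose prime
factors lie in `π`. -/
noncomputable def piPart (π : Set ℕ) (n : ℕ) : ℕ :=
  ∏ p ∈ n.primeFactors, p ^ (if p ∈ π then n.factorization p else 0)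

/-- The subgroup `H` is abelian. -/
def IsAbelianSubgroup {G : Type*} [Group G] (H : Subgroup G) : Prop :=
  ∀ a ∈ H, ∀ b ∈ H, a * b = b * a

/-- `X` is a Frobenius group with kernel `K`: `K` is a nontrivial proper normal
subgroup and the centralizer of every nontrivial element of `K` lies in `K`. -/
def IsFrobeniusWithKernel {X : Type*} [Group X] (K : Subgroup X) : Prop :=
  K ≠ ⊥ ∧ K ≠ ⊤ ∧ K.Normal ∧ ∀ k ∈ K, k ≠ 1 → Subgroup.centralizer {k} ≤ K

/-- `X` is a Frobenius group with kernel `K` and complement `C`. -/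
def IsFrobenius {X : Type*} [Group X] (K C : Subgroup X) : Prop :=
  IsFrobeniusWithKernel K ∧ K ⊔ C = ⊤ ∧ K ⊓ C = ⊥

/-- `G` is supersolvable: there is a chain of subgroups from `⊥` to `⊤`, each
normal in `G`, with all successive quotients cyclic (equivalently, each term is
generated by the previous one together with a single element). -/
def IsSupersolvable (G : Type*) [Group G] : Prop :=
  ∃ (n : ℕ) (c : Fin (n + 1) → Subgroup G),
    c 0 = ⊥ ∧ c (Fin.last n) = ⊤ ∧
    (∀ i : Fin n, c i.castSucc ≤ c i.succ) ∧
    (∀ i : Fin (n + 1), (c i).Normal) ∧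
    (∀ i : Fin n, ∃ g : G, c i.castSucc ⊔ Subgroup.zpowers g = c i.succ)

/-- The Fitting subgroup of `G`: the subgroup generated by all nilpotent normal
subgroups of `G`. -/
def Fitting (G : Type*) [Group G] : Subgroup G :=
  ⨆ H ∈ {H : Subgroup G | H.Normal ∧ Group.IsNilpotent ↥H}, H

/-- `O_p(G)`: the subgroup generated by all normal `p`-subgroups of `G`
(the largest normal `p`-subgroup). -/
def pCore' (p : ℕ) (G : Type*) [Group G] : Subgroup G :=
  ⨆ K ∈ {K : Subgroup G | K.Normal ∧ IsPGroup p ↥K}, K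

theorem isVanishing_iff_exists_representation {G : Type} [Group G] [Finite G] (g : G) :
    IsVanishing G g ↔ ∃ (V : Type) (_ : AddCommGroup V) (_ : Module ℂ V)
      (_ : FiniteDimensional ℂ V) (ρ : Representation ℂ G V),
      Module.finrank ℂ (Representation.IntertwiningMap ρ ρ) = 1 ∧ ρ.character g = 0 := by
  have := Fintype.ofFinite G
  have : NeZero (Nat.card G : ℂ) := ⟨by simp⟩
  have := invertibleOfNonzero (NeZero.ne (Nat.card G : ℂ))
  have key : ∀ (V : Type) [AddCommGroup V] [Module ℂ V] [FiniteDimensional ℂ V]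
      (ρ : Representation ℂ G V),
      Module.finrank ℂ (Representation.IntertwiningMap ρ ρ) = 1 ↔
        ∑ g : G, ρ.character g * ρ.character g⁻¹ = Nat.card G := by
    intro V _ _ _ ρ
    have h := Representation.card_inv_mul_sum_char_mul_char_eq_finrank ρ ρ
    rw [inv_mul_eq_iff_eq_mul₀ (NeZero.ne _)] at h
    rw [h]
    constructor
    · intro h1
      simp [h1]
    · intro h1
      have h2 := mul_eq_left₀ (NeZero.ne (Nat.card G : ℂ)) |>.mp h1
      exact_mod_cast h2
  constructor
  · rintro ⟨V, hV, h0⟩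
    refine ⟨V, inferInstance, inferInstance, inferInstance, V.ρ, (key _ _).2 ?_, h0⟩
    exact (FDRep.simple_iff_char_is_norm_one V).1 hV
  · rintro ⟨V, _, _, _, ρ, h1, h0⟩
    refine ⟨FDRep.of ρ, (FDRep.simple_iff_char_is_norm_one _).2 ((key _ _).1 h1), h0⟩

theorem IsVanishing.of_isIrreducible {G : Type} [Group G] [Finite G] {V : Type} [AddCommGroup V]
    [Module ℂ V] [FiniteDimensional ℂ V] (ρ : Representation ℂ G V) [ρ.IsIrreducible] {g : G}
    (h : ρ.character g = 0) : IsVanishing G g :=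
  (isVanishing_iff_exists_representation g).2 ⟨V, _, _, inferInstance, ρ, by simp, h⟩

theorem IsVanishing.conj {G : Type} [Group G] {g h : G} (hg : IsVanishing G g)
    (hgh : IsConj g h) : IsVanishing G h := by
  obtain ⟨V, hV, h0⟩ := hg
  obtain ⟨c, rfl⟩ := isConj_iff.1 hgh
  exact ⟨V, hV, by rw [FDRep.char_conj, h0]⟩

theorem IsVanishing.of_surjective {G Q : Type} [Group G] [Group Q] [Finite G]
    (f : G →* Q) (hf : Function.Surjective f) {g : G} (hg : IsVanishing Q (f g)) :
    IsVanishing G g := by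
  have : Finite Q := Finite.of_surjective f hf
  obtain ⟨V, _, _, _, ρ, h1, h0⟩ := (isVanishing_iff_exists_representation _).1 hg
  refine (isVanishing_iff_exists_representation _).2 ⟨V, _, _, inferInstance, ρ.comp f, ?_, h0⟩
  rw [← h1]
  refine LinearEquiv.finrank_eq
    { toFun := fun T => ⟨T.toLinearMap, fun q => ?_⟩
      invFun := fun T => ⟨T.toLinearMap, fun g => T.isIntertwining' (f g)⟩
      map_add' := fun _ _ => rfl
      map_smul' := fun _ _ => rfl
      left_inv := fun _ => rfl
      right_inv := fun _ => rfl }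
  obtain ⟨x, rfl⟩ := hf q
  exact T.isIntertwining' x

/-- Schur's lemma: an endomorphism commuting with an irreducible action is a scalar. -/
theorem eq_smul_id_of_commute {G V : Type*} [Group G] [AddCommGroup V]
    [Module ℂ V] [FiniteDimensional ℂ V] (ρ : Representation ℂ G V)
    (h1 : Module.finrank ℂ (Representation.IntertwiningMap ρ ρ) = 1) (T : V →ₗ[ℂ] V)
    (hT : ∀ g, T ∘ₗ ρ g = ρ g ∘ₗ T) : ∃ c : ℂ, T = c • LinearMap.id := by
  by_cases hV : Subsingleton V
  · exact ⟨0, by ext x; exact Subsingleton.elim _ _⟩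
  rw [not_subsingleton_iff_nontrivial] at hV
  obtain ⟨v, hv⟩ := exists_ne (0 : V)
  have hid : Representation.IntertwiningMap.id ρ ≠ 0 := by
    intro h
    exact hv (congrArg (fun f => f v) h)
  obtain ⟨c, hc⟩ := (finrank_eq_one_iff_of_nonzero' _ hid).1 h1 ⟨T, hT⟩
  exact ⟨c, by ext x; exact (congrArg (fun f => f x) hc).symm⟩

theorem IsVanishing.mul_of_isConj {G : Type} [Group G] [Finite G] {g z : G}
    (hg : IsVanishing G g) (h : ∀ x, IsConj (g * (x * z * x⁻¹)) (g * z)) :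
    IsVanishing G (g * z) := by
  have := Fintype.ofFinite G
  obtain ⟨V, _, _, _, ρ, h1, h0⟩ := (isVanishing_iff_exists_representation _).1 hg
  refine (isVanishing_iff_exists_representation _).2 ⟨V, _, _, inferInstance, ρ, h1, ?_⟩
  obtain ⟨c, hc⟩ := eq_smul_id_of_commute ρ h1 (∑ x : G, ρ (x * z * x⁻¹)) (by
    intro g
    change (∑ x : G, ρ (x * z * x⁻¹)) * ρ g = ρ g * ∑ x : G, ρ (x * z * x⁻¹)
    rw [Finset.sum_mul, Finset.mul_sum]
    simp_rw [← map_mul]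
    refine (Fintype.sum_equiv (Equiv.mulLeft g) _ _ fun x => ?_).symm
    simp [mul_assoc])
  have h2 : ∑ x : G, ρ.character (g * (x * z * x⁻¹)) = 0 := by
    have : ∑ x : G, ρ.character (g * (x * z * x⁻¹)) =
        LinearMap.trace ℂ V (ρ g * ∑ x : G, ρ (x * z * x⁻¹)) := by
      simp only [Representation.character, map_mul, Finset.mul_sum, map_sum]
    rw [this, hc]
    have h3 : LinearMap.trace ℂ V (ρ g) = 0 := h0
    change LinearMap.trace ℂ V (ρ g ∘ₗ _) = 0
    rw [LinearMap.comp_smul, LinearMap.comp_id, map_smul, h3, smul_zero]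
  have h3 : ∀ x, ρ.character (g * (x * z * x⁻¹)) = ρ.character (g * z) := fun x => by
    obtain ⟨y, hy⟩ := isConj_iff.1 (h x)
    rw [← hy, Representation.char_conj]
  simp_rw [h3] at h2
  simpa using h2

theorem not_isVanishing_one (G : Type) [Group G] [Finite G] : ¬ IsVanishing G 1 := by
  intro h
  obtain ⟨V, _, _, _, ρ, h1, h0⟩ := (isVanishing_iff_exists_representation _).1 h
  rw [Representation.char_one] at h0
  have h2 : Module.finrank ℂ V = 0 := by exact_mod_cast h0
  have := Module.finrank_zero_iff.1 h2
  have : Subsingleton (Representation.IntertwiningMap ρ ρ) :=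
    ⟨fun f g => by ext x; exact Subsingleton.elim _ _⟩
  rw [Module.finrank_zero_of_subsingleton] at h1
  exact zero_ne_one h1

theorem IsVanishing.mul_of_mem_center {G : Type} [Group G] [Finite G] {g z : G}
    (hg : IsVanishing G g) (hz : z ∈ Subgroup.center G) : IsVanishing G (g * z) := by
  refine hg.mul_of_isConj fun x => ?_
  rw [Subgroup.mem_center_iff.1 hz x, mul_inv_cancel_right]

theorem IsVanishing.notMem_center {G : Type} [Group G] [Finite G] {g : G}
    (hg : IsVanishing G g) : g ∉ Subgroup.center G := fun h =>
  not_isVanishing_one G (by simpa using hg.mul_of_mem_center (inv_mem h))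

theorem Representation.exists_isIrreducible_apply_ne_one {G : Type} [Group G] [Finite G] {g : G}
    {V : Type} [AddCommGroup V] [Module ℂ V] [FiniteDimensional ℂ V] (ρ : Representation ℂ G V)
    (hρ : ρ g ≠ 1) :
    ∃ (V : Type) (_ : AddCommGroup V) (_ : Module ℂ V) (_ : FiniteDimensional ℂ V)
      (ρ : Representation ℂ G V), ρ.IsIrreducible ∧ ρ g ≠ 1 := by
  induction hn : Module.finrank ℂ V using Nat.strong_induction_on generalizing V with
  | _ n ih =>
  have : NeZero (Nat.card G : ℂ) := ⟨by simpa [Nat.card_eq_zero] using ‹Finite G›⟩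
  by_cases hi : ρ.IsIrreducible
  · exact ⟨V, _, _, inferInstance, ρ, hi, hρ⟩
  have hnt : Nontrivial (Subrepresentation ρ) := by
    refine ⟨⊥, ⊤, fun h => hρ ?_⟩
    ext x
    have hx : x ∈ (⊤ : Subrepresentation ρ).toSubmodule := Submodule.mem_top
    rw [← h] at hx
    have hx0 : x = 0 := hx
    simp [hx0]
  have : ∃ W : Subrepresentation ρ, W ≠ ⊥ ∧ W ≠ ⊤ := by
    by_contra! hcon
    exact hi { eq_bot_or_eq_top := fun W => or_iff_not_imp_left.2 (hcon W) }
  obtain ⟨W, hW⟩ := this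
  obtain ⟨W', hW'⟩ := exists_isCompl W
  have hW'2 : W' ≠ ⊤ := fun h => hW.1 (by simpa [h] using hW'.disjoint)
  have key : ∀ U : Subrepresentation ρ, U ≠ ⊤ → (∀ x ∈ U.toSubmodule, ρ g x = x) ∨
      ∃ (V : Type) (_ : AddCommGroup V) (_ : Module ℂ V) (_ : FiniteDimensional ℂ V)
      (ρ : Representation ℂ G V), ρ.IsIrreducible ∧ ρ g ≠ 1 := by
    intro U hU
    rw [or_iff_not_imp_left]
    intro hx
    refine ih (Module.finrank ℂ U.toSubmodule) ?_ U.toRepresentation (fun h => hx ?_) rfl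
    · rw [← hn]
      exact Submodule.finrank_lt fun h => hU (Subrepresentation.toSubmodule_injective h)
    · intro x hx
      exact congrArg Subtype.val (LinearMap.congr_fun h ⟨x, hx⟩)
  rcases key W hW.2 with h1 | h1
  · rcases key W' hW'2 with h2 | h2
    · refine absurd ?_ hρ
      ext x
      have hx : x ∈ (W ⊔ W').toSubmodule := by rw [hW'.sup_eq_top]; exact Submodule.mem_top
      obtain ⟨y, hy, z, hz, rfl⟩ := Submodule.mem_sup.1 hx
      simp [h1 y hy, h2 z hz]
    · exact h2
  · exact h1

theorem exists_isIrreducible_apply_ne_one {G : Type} [Group G] [Finite G] {g : G} (hg : g ≠ 1) :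
    ∃ (V : Type) (_ : AddCommGroup V) (_ : Module ℂ V) (_ : FiniteDimensional ℂ V)
      (ρ : Representation ℂ G V), ρ.IsIrreducible ∧ ρ g ≠ 1 := by
  have hfin : FiniteDimensional ℂ (G → ℂ) := inferInstance
  let ρ : Representation ℂ G (G → ℂ) :=
    { toFun := fun x => LinearMap.funLeft ℂ ℂ (fun y => y * x)
      map_one' := by ext; simp [LinearMap.funLeft]
      map_mul' := fun a b => by ext; simp [LinearMap.funLeft, mul_assoc] }
  refine ρ.exists_isIrreducible_apply_ne_one (g := g) fun h => hg ?_
  have := congrFun (LinearMap.congr_fun h (Pi.single 1 1)) 1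
  by_contra hne
  simp [ρ, LinearMap.funLeft, hne] at this

theorem isVanishing_of_isConj_mul {G : Type} [Group G] [Finite G] {g : G} (K : Subgroup G)
    [K.Normal] (hK : K ≠ ⊥) (h : ∀ k ∈ K, IsConj g (g * k)) : IsVanishing G g := by
  have := Fintype.ofFinite G
  obtain ⟨⟨k₀, hk₀⟩, hne⟩ := Subgroup.ne_bot_iff_exists_ne_one.1 hK
  obtain ⟨V, _, _, _, ρ, hi, hρ⟩ :=
    exists_isIrreducible_apply_ne_one (g := k₀) (fun h => hne (Subtype.ext h))
  refine IsVanishing.of_isIrreducible ρ ?_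
  let F : Subrepresentation ρ :=
    { toSubmodule :=
        { carrier := {v | ∀ k ∈ K, ρ k v = v}
          add_mem' := fun ha hb k hk => by simp [ha k hk, hb k hk]
          zero_mem' := fun k hk => by simp
          smul_mem' := fun c v hv k hk => by simp [hv k hk] }
      apply_mem_toSubmodule := fun x v hv k hk => by
        have h1 := hv (x⁻¹ * k * x) (by
          simpa using Subgroup.Normal.conj_mem inferInstance k hk x⁻¹)
        conv_rhs => rw [← h1]
        rw [← Module.End.mul_apply, ← Module.End.mul_apply, ← map_mul, ← map_mul]
        congr 2
        group }
  have hF : F = ⊥ := by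
    rcases eq_bot_or_eq_top F with h | h
    · exact h
    · refine absurd ?_ hρ
      ext v
      have hv : v ∈ F.toSubmodule := by rw [h]; exact Submodule.mem_top
      exact hv k₀ hk₀
  have hsum : ∑ k : K, ρ k = 0 := by
    ext v
    have hv : (∑ k : K, ρ k) v ∈ F.toSubmodule := by
      intro k hk
      rw [LinearMap.sum_apply, map_sum]
      refine Fintype.sum_equiv (Equiv.mulLeft (⟨k, hk⟩ : K)) _ _ fun x => ?_
      simp
    rw [hF] at hv
    exact hv
  have h2 : ∑ k : K, ρ.character (g * k) = 0 := by
    have : ∑ k : K, ρ.character (g * k) = LinearMap.trace ℂ V (ρ g * ∑ k : K, ρ k) := by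
      simp only [Representation.character, map_mul, Finset.mul_sum, map_sum]
    rw [this, hsum, mul_zero, map_zero]
  have h3 : ∀ k : K, ρ.character (g * k) = ρ.character g := fun k => by
    obtain ⟨y, hy⟩ := isConj_iff.1 (h k k.2)
    rw [← hy, Representation.char_conj]
  simp_rw [h3] at h2
  simpa using h2

/-- The traces of the powers of an operator of finite order are the values of one integer
polynomial at the powers of a root of unity. -/
theorem exists_polynomial_trace_pow {V : Type*} [AddCommGroup V] [Module ℂ V]
    [FiniteDimensional ℂ V] (T : Module.End ℂ V) {N : ℕ} [NeZero N] (hT : T ^ N = 1) {ζ : ℂ}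
    (hζ : IsPrimitiveRoot ζ N) :
    ∃ f : Polynomial ℤ, ∀ k : ℕ,
      LinearMap.trace ℂ V (T ^ k) = Polynomial.aeval (ζ ^ k) f := by
  have hN : (N : ℂ) ≠ 0 := NeZero.ne _
  have hm : ∀ i : ℕ, ∃ m : ℕ, (N : ℂ)⁻¹ * ∑ j ∈ Finset.range N,
      ((ζ ^ i)⁻¹) ^ j * LinearMap.trace ℂ V (T ^ j) = m := by
    intro i
    set u : Module.End ℂ V := (ζ ^ i)⁻¹ • T with hu
    have hu1 : u ^ N = 1 := by
      rw [hu, smul_pow, hT, inv_pow, ← pow_mul, mul_comm, pow_mul, hζ.pow_eq_one]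
      simp
    set S : Module.End ℂ V := ∑ j ∈ Finset.range N, u ^ j with hS
    have h1 : S * u = S := by
      have := geom_sum_mul u N
      rw [hu1, sub_self, mul_sub, mul_one, sub_eq_zero] at this
      exact this
    have h2 : ∀ j, S * u ^ j = S := by
      intro j
      induction j with
      | zero => simp
      | succ j ih => rw [pow_succ, ← mul_assoc, ih, h1]
    set p : Module.End ℂ V := (N : ℂ)⁻¹ • S with hp
    have hpp : IsIdempotentElem p := by
      have : S * S = (N : ℂ) • S := by
        conv_lhs => rw [hS, ← hS]; rhs; rw [hS]
        rw [Finset.mul_sum, Finset.sum_congr rfl fun j _ => h2 j]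
        simp [Nat.cast_smul_eq_nsmul]
      rw [IsIdempotentElem, hp, smul_mul_smul_comm, this, smul_smul]
      congr 1
      field_simp
    refine ⟨Module.finrank ℂ (LinearMap.range p), ?_⟩
    have h3 := (LinearMap.IsIdempotentElem.isProj_range p hpp).trace
    rw [← h3, hp, hS, map_smul, map_sum, smul_eq_mul]
    congr 1
    refine Finset.sum_congr rfl fun j _ => ?_
    rw [hu, smul_pow, map_smul, smul_eq_mul]
  choose m hm using hm
  refine ⟨∑ i ∈ Finset.range N, (m i : Polynomial ℤ) * Polynomial.X ^ i, ?_⟩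
  have main : ∀ k < N, LinearMap.trace ℂ V (T ^ k) =
      ∑ i ∈ Finset.range N, (m i : ℂ) * (ζ ^ k) ^ i := by
    intro k hk
    have : ∀ j ∈ Finset.range N, ∑ i ∈ Finset.range N, ((ζ ^ i)⁻¹) ^ j * (ζ ^ k) ^ i =
        if j = k then (N : ℂ) else 0 := by
      intro j hj
      have hz0 : ζ ≠ 0 := hζ.ne_zero (NeZero.ne N)
      have h1 : ∀ i, ((ζ ^ i)⁻¹) ^ j * (ζ ^ k) ^ i = ((ζ ^ j)⁻¹ * ζ ^ k) ^ i := by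
        intro i
        rw [mul_pow, inv_pow, inv_pow, pow_right_comm]
      simp_rw [h1]
      split_ifs with hjk
      · subst hjk
        rw [inv_mul_cancel₀ (pow_ne_zero _ hz0)]
        simp
      · have hw : (ζ ^ j)⁻¹ * ζ ^ k ≠ 1 := by
          intro h
          rw [inv_mul_eq_one₀ (pow_ne_zero _ hz0)] at h
          exact hjk (hζ.pow_inj (Finset.mem_range.1 hj) hk h)
        rw [geom_sum_eq hw, mul_pow, inv_pow, ← pow_mul, ← pow_mul, mul_comm j, mul_comm k,
          pow_mul, pow_mul, hζ.pow_eq_one]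
        simp
    simp_rw [← hm, mul_assoc, ← Finset.mul_sum, Finset.sum_mul]
    rw [Finset.sum_comm]
    have h2 : ∀ j ∈ Finset.range N, ∑ i ∈ Finset.range N,
        ((ζ ^ i)⁻¹) ^ j * LinearMap.trace ℂ V (T ^ j) * (ζ ^ k) ^ i =
        if j = k then (N : ℂ) * LinearMap.trace ℂ V (T ^ j) else 0 := by
      intro j hj
      simp_rw [mul_right_comm, ← Finset.sum_mul]
      rw [this j hj]
      split_ifs <;> simp
    rw [Finset.sum_congr rfl h2, Finset.sum_ite_eq' , if_pos (Finset.mem_range.2 hk)]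
    field_simp
  intro k
  have hkN : k % N < N := Nat.mod_lt _ (Nat.pos_of_ne_zero (NeZero.ne N))
  rw [pow_eq_pow_mod k hT, main _ hkN, pow_eq_pow_mod k hζ.pow_eq_one]
  simp

theorem card_le_sum_normSq_aeval {N : ℕ} [NeZero N] (f : Polynomial ℤ)
    (hf : ∀ μ ∈ primitiveRoots N ℂ, Polynomial.aeval μ f ≠ 0) :
    ((primitiveRoots N ℂ).card : ℝ) ≤
      ∑ μ ∈ primitiveRoots N ℂ, Complex.normSq (Polynomial.aeval μ f) := by
  have : NeZero (N : ℂ) := ⟨by exact_mod_cast NeZero.ne N⟩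
  have hint : ∃ r : ℤ, ∏ μ ∈ primitiveRoots N ℂ, Polynomial.aeval μ f = r := by
    refine ⟨Polynomial.resultant (Polynomial.cyclotomic N ℤ) f
      (Polynomial.cyclotomic N ℂ).natDegree f.natDegree, ?_⟩
    have h1 := Polynomial.resultant_map_map (Polynomial.cyclotomic N ℤ) f
      (Polynomial.cyclotomic N ℂ).natDegree f.natDegree (Int.castRingHom ℂ)
    rw [Polynomial.map_cyclotomic, Polynomial.resultant_eq_prod_eval _ _ _
      Polynomial.natDegree_map_le (IsAlgClosed.splits _),
      (Polynomial.cyclotomic.monic N ℂ).leadingCoeff, one_pow, one_mul,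
      Polynomial.cyclotomic.roots_eq_primitiveRoots_val] at h1
    rw [eq_intCast] at h1
    rw [← h1]
    refine Finset.prod_congr rfl fun μ _ => ?_
    rw [Polynomial.aeval_def, Polynomial.eval_map]
    rfl
  obtain ⟨r, hr⟩ := hint
  have hr0 : r ≠ 0 := by
    rintro rfl
    rw [Int.cast_zero, Finset.prod_eq_zero_iff] at hr
    obtain ⟨μ, hμ, h0⟩ := hr
    exact hf μ hμ h0
  have hprod : 1 ≤ ∏ μ ∈ primitiveRoots N ℂ, Complex.normSq (Polynomial.aeval μ f) := by
    rw [← map_prod, hr, Complex.normSq_intCast]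
    have : 1 ≤ r * r := by nlinarith [sq_pos_of_ne_zero hr0, sq r]
    exact_mod_cast this
  have hpos : ∀ μ ∈ primitiveRoots N ℂ, 0 < Complex.normSq (Polynomial.aeval μ f) :=
    fun μ hμ => Complex.normSq_pos.2 (hf μ hμ)
  have hlog := Real.log_nonneg hprod
  rw [Real.log_prod (fun μ hμ => (hpos μ hμ).ne')] at hlog
  have := Finset.sum_le_sum fun μ hμ => Real.log_le_sub_one_of_pos (hpos μ hμ)
  rw [Finset.sum_sub_distrib] at this
  simp only [Finset.sum_const, nsmul_eq_mul, mul_one] at this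
  linarith

theorem mul_comm_of_forall_not_isVanishing {G : Type} [Group G] [Finite G]
    (h : ∀ g : G, ¬ IsVanishing G g) (a b : G) : a * b = b * a := by
  have := Fintype.ofFinite G
  by_contra hab
  have hc : a * b * (b * a)⁻¹ ≠ 1 := fun h => hab (mul_inv_eq_one.1 h)
  obtain ⟨V, _, _, _, ρ, hi, hρ⟩ := exists_isIrreducible_apply_ne_one hc
  have hχ : ∀ g, ρ.character g ≠ 0 := fun g h0 => h g (IsVanishing.of_isIrreducible ρ h0)
  have hd : 1 < Module.finrank ℂ V := by
    by_contra! hle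
    refine hρ ?_
    have h1 : ρ a * ρ b = ρ b * ρ a := by
      rcases Nat.le_one_iff_eq_zero_or_eq_one.1 hle with h0 | h1
      · have := Module.finrank_zero_iff.1 h0
        ext x
        exact Subsingleton.elim _ _
      · obtain ⟨v, hv, hv1⟩ := finrank_eq_one_iff'.1 h1
        obtain ⟨c, hc⟩ := hv1 (ρ a v)
        obtain ⟨d, hd⟩ := hv1 (ρ b v)
        ext x
        obtain ⟨e, rfl⟩ := hv1 x
        simp [← hc, ← hd, smul_smul, mul_comm]
    rw [map_mul, map_mul, h1, ← map_mul, ← map_mul, mul_inv_cancel, map_one]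
  set N := Nat.card G with hN
  have : NeZero N := ⟨Nat.card_pos.ne'⟩
  set ζ := Complex.exp (2 * Real.pi * Complex.I / N) with hζd
  have hζ : IsPrimitiveRoot ζ N := Complex.isPrimitiveRoot_exp N (NeZero.ne N)
  have hT : ∀ g, ρ g ^ N = 1 := fun g => by rw [← map_pow, pow_card_eq_one', map_one]
  choose f hf using fun g => exists_polynomial_trace_pow (ρ g) (hT g) hζ
  have hf' : ∀ g k, ρ.character (g ^ k) = Polynomial.aeval (ζ ^ k) (f g) := fun g k => by
    rw [← hf, Representation.character, map_pow]
  have hreal : ∀ g : G, ρ.character g * ρ.character g⁻¹ =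
      (Complex.normSq (ρ.character g) : ℂ) := by
    intro g
    have h1 : g⁻¹ = g ^ (N - 1) := by
      rw [inv_eq_iff_mul_eq_one, ← pow_succ', Nat.sub_add_cancel Nat.card_pos, pow_card_eq_one']
    have h2 : ρ.character g⁻¹ = starRingEnd ℂ (ρ.character g) := by
      have h3 : ζ ^ (N - 1) = starRingEnd ℂ ζ := by
        have h4 : ζ ^ (N - 1) = ζ⁻¹ := by
          refine eq_inv_of_mul_eq_one_left ?_
          rw [← pow_succ, Nat.sub_add_cancel Nat.card_pos, hζ.pow_eq_one]
        rw [h4, Complex.inv_def, Complex.normSq_eq_norm_sq, hζ.norm'_eq_one (NeZero.ne N)]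
        simp
      rw [h1, hf', h3]
      have h5 := hf' g 1
      rw [pow_one, pow_one] at h5
      rw [h5, Polynomial.aeval_def, Polynomial.aeval_def, Polynomial.hom_eval₂]
      congr 1
      ext
      simp
    rw [h2, Complex.mul_conj]
  have hsum : ∑ g : G, Complex.normSq (ρ.character g) = N := by
    have : NeZero (Nat.card G : ℂ) := ⟨by exact_mod_cast NeZero.ne N⟩
    have := invertibleOfNonzero (NeZero.ne (Nat.card G : ℂ))
    have h1 := Representation.card_inv_mul_sum_char_mul_char_eq_finrank ρ ρ
    rw [inv_mul_eq_iff_eq_mul₀ (NeZero.ne _)] at h1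
    simp_rw [hreal] at h1
    rw [Representation.IsIrreducible.finrank_intertwiningMap_self] at h1
    rw [Nat.cast_one, mul_one] at h1
    exact_mod_cast h1
  set P := primitiveRoots N ℂ with hP
  have hPc : 0 < P.card := Finset.card_pos.2
    ⟨ζ, (mem_primitiveRoots (Nat.pos_of_ne_zero (NeZero.ne N))).2 hζ⟩
  have hμ : ∀ μ ∈ P, ∃ k : ℕ, N.Coprime k ∧ ζ ^ k = μ := by
    intro μ hμ
    obtain ⟨k, -, hk, rfl⟩ := hζ.isPrimitiveRoot_iff.1
      ((mem_primitiveRoots (Nat.pos_of_ne_zero (NeZero.ne N))).1 hμ)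
    exact ⟨k, hk.symm, rfl⟩
  have hle : ∀ g, (P.card : ℝ) ≤ ∑ μ ∈ P, Complex.normSq (Polynomial.aeval μ (f g)) := by
    intro g
    refine card_le_sum_normSq_aeval _ fun μ hm => ?_
    obtain ⟨k, -, rfl⟩ := hμ μ hm
    rw [← hf']
    exact hχ _
  have htot : ∑ g : G, ∑ μ ∈ P, Complex.normSq (Polynomial.aeval μ (f g)) = P.card * N := by
    rw [Finset.sum_comm, ← nsmul_eq_mul, ← Finset.sum_const]
    refine Finset.sum_congr rfl fun μ hm => ?_
    obtain ⟨k, hk, rfl⟩ := hμ μ hm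
    rw [← hsum]
    refine Fintype.sum_equiv (powCoprime hk) _ _ fun g => ?_
    rw [← hf', powCoprime_apply]
  have hlt : ∑ g : G, (P.card : ℝ) <
      ∑ g : G, ∑ μ ∈ P, Complex.normSq (Polynomial.aeval μ (f g)) := by
    refine Finset.sum_lt_sum (fun g _ => hle g) ⟨1, Finset.mem_univ _, ?_⟩
    rw [← nsmul_one, ← Finset.sum_const]
    refine Finset.sum_lt_sum_of_nonempty (Finset.card_pos.1 hPc) fun μ hm => ?_
    obtain ⟨k, hk, rfl⟩ := hμ μ hm
    rw [← hf', one_pow, Representation.char_one, Complex.normSq_natCast]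
    exact_mod_cast (by nlinarith)
  rw [htot, Finset.sum_const, nsmul_eq_mul, Finset.card_univ, Fintype.card_eq_nat_card] at hlt
  linarith [mul_comm (P.card : ℝ) (N : ℝ)]

theorem coprime_of_primes_mem {π : Set ℕ} {m n : ℕ} (hm : ∀ p : ℕ, p.Prime → p ∣ m → p ∈ π)
    (hn : ∀ p : ℕ, p.Prime → p ∣ n → p ∉ π) : m.Coprime n :=
  Nat.coprime_of_dvd fun p hp h1 h2 => hn p hp h2 (hm p hp h1)

section ClassSize

variable {G : Type*} [Group G]

theorem classSize_eq_card_conj (g : G) : classSize g = Nat.card {x // IsConj g x} := by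
  rw [classSize]
  have h1 := MulAction.index_stabilizer (ConjAct G) g
  rw [ConjAct.orbit_eq_carrier_conjClasses, ConjAct.stabilizer_eq_centralizer] at h1
  have h2 : ((Subgroup.centralizer {g}).index) = (Subgroup.centralizer {ConjAct.toConjAct g}).index :=
    rfl
  rw [h2, h1, ← Nat.card_coe_set_eq]
  refine Nat.card_congr (Equiv.setCongr ?_)
  ext x
  rw [ConjClasses.mem_carrier_iff_mk_eq, ConjClasses.mk_eq_mk_iff_isConj, isConj_comm]
  rfl

theorem classSize_eq_of_isConj {g h : G} (hgh : IsConj g h) : classSize g = classSize h := by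
  rw [classSize_eq_card_conj, classSize_eq_card_conj]
  refine Nat.card_congr (Equiv.setCongr ?_)
  ext x
  exact ⟨fun h => hgh.symm.trans h, fun h => hgh.trans h⟩

theorem classSize_map_dvd {Q : Type*} [Group Q] {f : G →* Q} (hf : Function.Surjective f) (g : G) :
    classSize (f g) ∣ classSize g := by
  refine (Subgroup.index_dvd_of_le ?_).trans
    (Subgroup.index_map_dvd (Subgroup.centralizer {g}) hf)
  rintro _ ⟨x, hx, rfl⟩
  rw [SetLike.mem_coe, Subgroup.mem_centralizer_singleton_iff] at hx
  rw [Subgroup.mem_centralizer_singleton_iff, ← map_mul, hx, map_mul]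

theorem classSize_pos [Finite G] (g : G) : 0 < classSize g :=
  Nat.pos_of_ne_zero Subgroup.index_ne_zero_of_finite

theorem classSize_eq_one_iff (g : G) : classSize g = 1 ↔ g ∈ Subgroup.center G := by
  rw [classSize, Subgroup.index_eq_one, Subgroup.eq_top_iff', Subgroup.mem_center_iff]
  exact forall_congr' fun x => Subgroup.mem_centralizer_singleton_iff

theorem Subgroup.mul_mem_of_relIndex_eq_index [Finite G] {H K : Subgroup G}
    (h : H.relIndex K = H.index) (g : G) : ∃ k ∈ K, ∃ x ∈ H, g = k * x := by
  let f : K ⧸ H.subgroupOf K → G ⧸ H := Quotient.map' (fun k => (k : G)) (by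
    intro a b hab
    rw [QuotientGroup.leftRel_apply] at hab ⊢
    exact hab)
  have hf : Function.Injective f := by
    rintro ⟨a⟩ ⟨b⟩ hab
    refine Quotient.sound' ?_
    have := Quotient.exact' hab
    rw [QuotientGroup.leftRel_apply] at this ⊢
    exact this
  have hb : Function.Bijective f := hf.bijective_of_nat_card_le h.ge
  obtain ⟨⟨k⟩, hk⟩ := hb.2 (QuotientGroup.mk g)
  have := Quotient.exact' hk
  rw [QuotientGroup.leftRel_apply] at this
  exact ⟨k, k.2, _, this, by simp⟩

theorem Subgroup.relIndex_eq_index_of_coprime [Finite G] {H K : Subgroup G}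
    (h : H.index.Coprime K.index) : H.relIndex K = H.index := by
  have h1 : H.index * K.index ∣ (H ⊓ K).index :=
    h.mul_dvd_of_dvd_of_dvd (Subgroup.index_dvd_of_le inf_le_left)
      (Subgroup.index_dvd_of_le inf_le_right)
  have h2 := Nat.le_of_dvd (Nat.pos_of_ne_zero Subgroup.index_ne_zero_of_finite) h1
  have h3 := Subgroup.index_inf_le (H := H) (K := K)
  have h4 := Subgroup.relIndex_mul_index (inf_le_right : H ⊓ K ≤ K)
  rw [Subgroup.inf_relIndex_right] at h4
  have h5 : 0 < K.index := Nat.pos_of_ne_zero Subgroup.index_ne_zero_of_finite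
  exact Nat.eq_of_mul_eq_mul_right h5 (h4.trans (le_antisymm h3 h2))

theorem Subgroup.le_of_normal_of_isHall [Finite G] {π : Set ℕ} {M K : Subgroup G} [M.Normal]
    (hM : ∀ p : ℕ, p.Prime → p ∣ Nat.card M → p ∈ π) (hK : IsHallSubgroup π K) : M ≤ K := by
  have h1 : Nat.card (M ⊔ K : Subgroup G) ∣ Nat.card M * Nat.card K := by
    rw [← Subgroup.relIndex_bot_left, ← Subgroup.relIndex_mul_relIndex ⊥ M (M ⊔ K) bot_le le_sup_left,
      Subgroup.relIndex_bot_left, Subgroup.relIndex_sup_left]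
    exact mul_dvd_mul_left _ (Subgroup.relIndex_dvd_card M K)
  have h2 : K.relIndex (M ⊔ K) = 1 := by
    have h3 : K.relIndex (M ⊔ K) ∣ K.index := Subgroup.relIndex_dvd_index_of_le le_sup_right
    have h4 : K.relIndex (M ⊔ K) ∣ Nat.card M * Nat.card K :=
      (Subgroup.relIndex_dvd_card K (M ⊔ K)).trans h1
    refine Nat.eq_one_of_dvd_coprimes (coprime_of_primes_mem ?_ hK.2) h4 h3
    intro p hp hd
    exact (hp.dvd_mul.1 hd).elim (hM p hp) (hK.1 p hp)
  rw [Subgroup.relIndex_eq_one] at h2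
  exact le_sup_left.trans h2

theorem Subgroup.card_dvd_of_forall_mul_mem [Finite G] (T : Subgroup G) (C : Set G)
    (hC : ∀ x ∈ C, ∀ t ∈ T, x * t ∈ C) : Nat.card T ∣ Nat.card C := by
  have h1 : C = QuotientGroup.mk (s := T) ⁻¹' ((QuotientGroup.mk (s := T)) '' C) := by
    refine Set.Subset.antisymm (Set.subset_preimage_image _ _) ?_
    rintro x ⟨y, hy, hxy⟩
    have h2 := QuotientGroup.eq.1 hxy
    simpa using hC y hy _ h2
  rw [h1, Nat.card_congr (QuotientGroup.preimageMkEquivSubgroupProdSet T _), Nat.card_prod]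
  exact dvd_mul_right _ _

end ClassSize

theorem exists_normal_piSubgroup_mem {G : Type} [Group G] [Finite G] {π : Set ℕ} {K : Subgroup G}
    (hK : IsHallSubgroup π K)
    (hv : ∀ g : G, IsVanishing G g → ∀ p : ℕ, p.Prime → p ∣ classSize g → p ∈ π)
    (hex : ∃ g : G, IsVanishing G g) {z : G} (hz : z ∈ K) (hzc : ∀ k ∈ K, k * z = z * k) :
    ∃ M : Subgroup G, M.Normal ∧ z ∈ M ∧ ∀ p : ℕ, p.Prime → p ∣ Nat.card M → p ∈ π := by
  have hne : {g : G | IsVanishing G g}.Nonempty := hex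
  obtain ⟨g, hg, hmax⟩ := Set.exists_max_image {g : G | IsVanishing G g} classSize
    (Set.toFinite _) hne
  have hgK : ∀ x : G, ∃ c ∈ Subgroup.centralizer {g}, ∃ k ∈ K, x = c * k := fun x => by
    refine Subgroup.mul_mem_of_relIndex_eq_index (H := K) (K := Subgroup.centralizer {g}) ?_ x
    exact Subgroup.relIndex_eq_index_of_coprime
      (coprime_of_primes_mem (hv g hg) hK.2).symm
  have hconj : ∀ x, IsConj (g * (x * z * x⁻¹)) (g * z) := by
    intro x
    obtain ⟨c, hc, k, hk, rfl⟩ := hgK x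
    rw [Subgroup.mem_centralizer_singleton_iff] at hc
    rw [isConj_comm, isConj_iff]
    refine ⟨c, ?_⟩
    have h1 : k * z * k⁻¹ = z := by rw [hzc k hk, mul_inv_cancel_right]
    calc c * (g * z) * c⁻¹ = c * g * z * c⁻¹ := by group
      _ = g * c * z * c⁻¹ := by rw [hc]
      _ = g * (c * (k * z * k⁻¹) * c⁻¹) := by rw [h1]; group
      _ = _ := by group
  have hgz : IsVanishing G (g * z) := hg.mul_of_isConj hconj
  have hle := hmax _ hgz
  rw [classSize_eq_card_conj, classSize_eq_card_conj] at hle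
  set C : Set G := {y | IsConj g y} with hC
  set D : Set G := {y | IsConj (g * z) y} with hD
  have hCD : ∀ x, (fun y => y * (x * z * x⁻¹)) '' C = D := by
    intro x
    refine Set.eq_of_subset_of_ncard_le ?_ ?_ (Set.toFinite _)
    · rintro _ ⟨y, hy, rfl⟩
      obtain ⟨w, rfl⟩ := isConj_iff.1 hy
      refine (hconj (w⁻¹ * x)).symm.trans (isConj_iff.2 ⟨w, by group⟩)
    · rw [Set.ncard_image_of_injective _ (mul_left_injective _)]
      exact hle
  let T : Subgroup G :=
    { carrier := {t | ∀ y, y ∈ C ↔ y * t ∈ C}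
      mul_mem' := fun {a b} ha hb y => by rw [ha y, hb (y * a), mul_assoc]
      one_mem' := fun y => by simp
      inv_mem' := fun {a} ha y => by rw [ha (y * a⁻¹), inv_mul_cancel_right] }
  have hCc : ∀ w y, y ∈ C ↔ w * y * w⁻¹ ∈ C := fun w y =>
    ⟨fun h => IsConj.trans h (isConj_iff.2 ⟨w, rfl⟩),
      fun h => IsConj.trans h (isConj_iff.2 ⟨w⁻¹, by group⟩)⟩
  have hT : T.Normal := ⟨fun t ht w y => by
    rw [hCc w⁻¹ y, ht _, hCc w]
    have : w * (w⁻¹ * y * w⁻¹⁻¹ * t) * w⁻¹ = y * (w * t * w⁻¹) := by group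
    rw [this]⟩
  have hTz : ∀ x, x * z * x⁻¹ * z⁻¹ ∈ T := by
    intro x y
    have h1 : ∀ y, y ∈ C ↔ y * z ∈ D := fun y => by
      rw [← hCD 1]
      constructor
      · intro h
        exact ⟨y, h, by simp⟩
      · rintro ⟨y', h, h'⟩
        have : y' = y := by simpa using h'
        rwa [← this]
    have h2 : ∀ y, y ∈ C ↔ y * (x * z * x⁻¹) ∈ D := fun y => by
      rw [← hCD x]
      constructor
      · intro h
        exact ⟨y, h, rfl⟩
      · rintro ⟨y', h, h'⟩
        have : y' = y := mul_left_injective _ h'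
        rwa [← this]
    rw [h2, h1]
    have : y * (x * z * x⁻¹ * z⁻¹) * z = y * (x * z * x⁻¹) := by group
    rw [this]
  refine ⟨T ⊔ Subgroup.zpowers z, ⟨fun m hm x => ?_⟩,
    Subgroup.mem_sup_right (Subgroup.mem_zpowers z), fun p hp hd => ?_⟩
  · have hle : T ⊔ Subgroup.zpowers z ≤
        (T ⊔ Subgroup.zpowers z).comap (MulAut.conj x).toMonoidHom := by
      refine sup_le (fun t ht => Subgroup.mem_sup_left (hT.conj_mem t ht x)) ?_
      rw [Subgroup.zpowers_le]
      change x * z * x⁻¹ ∈ T ⊔ Subgroup.zpowers z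
      have : x * z * x⁻¹ = x * z * x⁻¹ * z⁻¹ * z := by group
      rw [this]
      exact mul_mem (Subgroup.mem_sup_left (hTz x))
        (Subgroup.mem_sup_right (Subgroup.mem_zpowers z))
    exact hle hm
  · have h1 : Nat.card (T ⊔ Subgroup.zpowers z : Subgroup G) ∣
        Nat.card T * Nat.card (Subgroup.zpowers z) := by
      rw [← Subgroup.relIndex_bot_left, ← Subgroup.relIndex_mul_relIndex ⊥ T _ bot_le le_sup_left,
        Subgroup.relIndex_bot_left, Subgroup.relIndex_sup_left]
      exact mul_dvd_mul_left _ (Subgroup.relIndex_dvd_card _ _)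
    rcases hp.dvd_mul.1 (hd.trans h1) with h2 | h2
    · refine hv g hg p hp (h2.trans ?_)
      rw [classSize_eq_card_conj]
      exact T.card_dvd_of_forall_mul_mem C fun x hx t ht => (ht x).1 hx
    · exact hK.1 p hp (h2.trans (Subgroup.card_dvd_of_le (by rwa [Subgroup.zpowers_le])))

theorem IsHallSubgroup.map {G Q : Type*} [Group G] [Finite G] [Group Q] {π : Set ℕ}
    {K : Subgroup G} (hK : IsHallSubgroup π K) {f : G →* Q} (hf : Function.Surjective f) :
    IsHallSubgroup π (K.map f) :=
  ⟨fun p hp hd => hK.1 p hp (hd.trans (Subgroup.card_map_dvd K f)),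
    fun p hp hd => hK.2 p hp (hd.trans (Subgroup.index_map_dvd K hf))⟩

theorem IsHallSubgroup.normal_of_isNilpotent {π : Set ℕ} {G : Type} [Group G] [Finite G]
    {K : Subgroup G} (hK : IsHallSubgroup π K) (hn : Group.IsNilpotent K)
    (hv : ∀ g : G, IsVanishing G g → ∀ p : ℕ, p.Prime → p ∣ classSize g → p ∈ π) :
    K.Normal := by
  induction hc : Nat.card G using Nat.strong_induction_on generalizing G with
  | _ n ih =>
  by_cases hex : ∃ g : G, IsVanishing G g
  swap
  · push Not at hex
    refine ⟨fun k hk x => ?_⟩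
    rwa [mul_comm_of_forall_not_isVanishing hex x k, mul_inv_cancel_right]
  by_cases hKb : K = ⊥
  · rw [hKb]; infer_instance
  have : Nontrivial K := (Subgroup.nontrivial_iff_ne_bot K).2 hKb
  obtain ⟨⟨z, hz⟩, hz1⟩ := Subgroup.ne_bot_iff_exists_ne_one.1
    (Group.IsNilpotent.center_ne_bot (G := K))
  obtain ⟨M, hM, hzM, hMπ⟩ := exists_normal_piSubgroup_mem hK hv hex z.2 fun k hk =>
    congrArg Subtype.val (Subgroup.mem_center_iff.1 hz ⟨k, hk⟩)
  have hMK := Subgroup.le_of_normal_of_isHall hMπ hK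
  have hsurj := QuotientGroup.mk'_surjective M
  have hMne : M ≠ ⊥ := by
    rintro rfl
    exact hz1 (Subtype.ext (Subtype.ext (Subgroup.mem_bot.1 hzM)))
  have hcard : Nat.card (G ⧸ M) < n := by
    rw [← hc, Subgroup.card_eq_card_quotient_mul_card_subgroup M]
    exact lt_mul_of_one_lt_right Nat.card_pos ((Subgroup.one_lt_card_iff_ne_bot M).2 hMne)
  have hnil : Group.IsNilpotent (K.map (QuotientGroup.mk' M)) :=
    Group.nilpotent_of_surjective ((QuotientGroup.mk' M).subgroupMap K)
      ((QuotientGroup.mk' M).subgroupMap_surjective K)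
  have := ih _ hcard (hK.map hsurj) hnil (by
    intro g hg p hp hd
    obtain ⟨x, rfl⟩ := hsurj g
    exact hv x (IsVanishing.of_surjective _ hsurj hg) p hp (hd.trans (classSize_map_dvd hsurj x)))
    rfl
  have h2 := this.comap (QuotientGroup.mk' M)
  rwa [QuotientGroup.comap_map_mk', sup_eq_right.2 hMK] at h2

theorem exists_abelian_complement {π : Set ℕ} {G : Type} [Group G] [Finite G]
    {N : Subgroup G} [N.Normal] (hN : IsHallSubgroup π N)
    (hv : ∀ g : G, IsVanishing G g → ∀ p : ℕ, p.Prime → p ∣ classSize g → p ∈ π) :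
    ∃ H : Subgroup G, IsHallSubgroup πᶜ H ∧ IsAbelianSubgroup H ∧ N ⊔ H = ⊤ ∧ N ⊓ H = ⊥ ∧
      ∀ a b : G, a * b * a⁻¹ * b⁻¹ ∈ N := by
  have hcop : (Nat.card N).Coprime N.index := coprime_of_primes_mem hN.1 hN.2
  obtain ⟨H, hH⟩ := Subgroup.exists_right_complement'_of_coprime hcop
  have hsurj := QuotientGroup.mk'_surjective N
  have hcomm : ∀ a b : G, a * b * a⁻¹ * b⁻¹ ∈ N := by
    have h1 : ∀ q : G ⧸ N, ¬ IsVanishing (G ⧸ N) q := by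
      intro q hq
      obtain ⟨x, rfl⟩ := hsurj q
      have h2 := hv x (IsVanishing.of_surjective _ hsurj hq)
      have h3 : classSize (QuotientGroup.mk' N x) ∣ N.index :=
        (Subgroup.index_dvd_card _).trans (by rw [Subgroup.index_eq_card])
      refine hq.notMem_center ((classSize_eq_one_iff _).1 ?_)
      exact Nat.eq_one_of_dvd_coprimes (coprime_of_primes_mem h2 hN.2)
        (classSize_map_dvd hsurj x) h3
    intro a b
    have h2 := mul_comm_of_forall_not_isVanishing h1 (QuotientGroup.mk' N a) (QuotientGroup.mk' N b)
    rw [← QuotientGroup.ker_mk' N, MonoidHom.mem_ker]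
    simp only [map_mul, map_inv]
    rw [h2]
    group
  refine ⟨H, ⟨fun p hp hd => ?_, fun p hp hd => ?_⟩, fun a ha b hb => ?_, hH.sup_eq_top,
    hH.disjoint.eq_bot, hcomm⟩
  · rw [← hH.symm.index_eq_card] at hd
    exact hN.2 p hp hd
  · rw [hH.index_eq_card] at hd
    exact fun h => h (hN.1 p hp hd)
  · have h1 : a * b * a⁻¹ * b⁻¹ ∈ N ⊓ H :=
      ⟨hcomm a b, H.mul_mem (H.mul_mem (H.mul_mem ha hb) (H.inv_mem ha)) (H.inv_mem hb)⟩
    rw [hH.disjoint.eq_bot, Subgroup.mem_bot] at h1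
    calc a * b = a * b * a⁻¹ * b⁻¹ * (b * a) := by group
      _ = b * a := by rw [h1, one_mul]

theorem isVanishing_of_commutators {G : Type} [Group G] [Finite G] (B : Subgroup G) (x : G)
    (h1 : ∀ b ∈ B, ∀ c ∈ B, c * (x⁻¹ * b * x * b⁻¹) = x⁻¹ * b * x * b⁻¹ * c)
    (h2 : ∀ g : G, ∀ b ∈ B, ∃ c ∈ B, g * (x⁻¹ * b * x * b⁻¹) * g⁻¹ = x⁻¹ * c * x * c⁻¹)
    (h3 : ∃ b ∈ B, b * x ≠ x * b) : IsVanishing G x := by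
  have hmul : ∀ b ∈ B, ∀ c ∈ B, x⁻¹ * (b * c) * x * (b * c)⁻¹ =
      x⁻¹ * b * x * b⁻¹ * (x⁻¹ * c * x * c⁻¹) := fun b hb c hc =>
    calc x⁻¹ * (b * c) * x * (b * c)⁻¹ =
        x⁻¹ * b * x * b⁻¹ * (b * (x⁻¹ * c * x * c⁻¹)) * b⁻¹ := by group
      _ = x⁻¹ * b * x * b⁻¹ * (x⁻¹ * c * x * c⁻¹) := by rw [h1 c hc b hb]; group
  let L : Subgroup G :=
    { carrier := {l | ∃ b ∈ B, x⁻¹ * b * x * b⁻¹ = l}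
      mul_mem' := by
        rintro _ _ ⟨b, hb, rfl⟩ ⟨c, hc, rfl⟩
        exact ⟨b * c, B.mul_mem hb hc, hmul b hb c hc⟩
      one_mem' := ⟨1, B.one_mem, by group⟩
      inv_mem' := by
        rintro _ ⟨b, hb, rfl⟩
        refine ⟨b⁻¹, B.inv_mem hb, eq_inv_of_mul_eq_one_left ?_⟩
        rw [← hmul _ (B.inv_mem hb) _ hb]
        group }
  have hL : L.Normal := ⟨by
    rintro _ ⟨b, hb, rfl⟩ g
    obtain ⟨c, hc, h⟩ := h2 g b hb
    exact ⟨c, hc, h.symm⟩⟩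
  refine isVanishing_of_isConj_mul L ?_ ?_
  · obtain ⟨b, hb, hne⟩ := h3
    refine (Subgroup.ne_bot_iff_exists_ne_one).2 ⟨⟨_, b, hb, rfl⟩, fun h => hne ?_⟩
    have h : x⁻¹ * b * x * b⁻¹ = 1 := congrArg Subtype.val h
    calc b * x = x * (x⁻¹ * b * x * b⁻¹) * b := by group
      _ = x * b := by rw [h, mul_one]
  · rintro _ ⟨b, hb, rfl⟩
    exact isConj_iff.2 ⟨b, by group⟩

theorem Subgroup.inf_centralizer_ne_bot {G : Type*} [Group G] {N : Subgroup G}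
    (hN : Group.IsNilpotent N) (hne : N ≠ ⊥) : N ⊓ Subgroup.centralizer N ≠ ⊥ := by
  have : Nontrivial N := (Subgroup.nontrivial_iff_ne_bot N).2 hne
  obtain ⟨⟨z, hz⟩, hz1⟩ := Subgroup.ne_bot_iff_exists_ne_one.1
    (Group.IsNilpotent.center_ne_bot (G := N))
  refine Subgroup.ne_bot_iff_exists_ne_one.2 ⟨⟨z, z.2, ?_⟩, fun h => hz1 ?_⟩
  · change (z : G) ∈ Subgroup.centralizer (N : Set G)
    rw [Subgroup.mem_centralizer_iff]
    exact fun n hn => congrArg Subtype.val (Subgroup.mem_center_iff.1 hz ⟨n, hn⟩)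
  · have h : (z : G) = 1 := congrArg Subtype.val h
    exact Subtype.ext (Subtype.ext h)

theorem Subgroup.card_quotient_lt {G : Type*} [Group G] [Finite G] {M : Subgroup G} (hM : M ≠ ⊥) :
    Nat.card (G ⧸ M) < Nat.card G := by
  rw [Subgroup.card_eq_card_quotient_mul_card_subgroup M]
  exact lt_mul_of_one_lt_right Nat.card_pos ((Subgroup.one_lt_card_iff_ne_bot M).2 hM)

theorem Subgroup.isNilpotent_map {G Q : Type*} [Group G] [Group Q] (f : G →* Q) {N : Subgroup G}
    (hN : Group.IsNilpotent N) : Group.IsNilpotent (N.map f) :=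
  Group.nilpotent_of_surjective (f.subgroupMap N) (f.subgroupMap_surjective N)

theorem eq_one_of_pow_eq_one_of_coprime {G : Type*} [Group G] {a : G} {m n : ℕ} (h : m.Coprime n)
    (hm : a ^ m = 1) (hn : a ^ n = 1) : a = 1 := by
  rw [← orderOf_eq_one_iff]
  exact Nat.eq_one_of_dvd_coprimes h (orderOf_dvd_of_pow_eq_one hm) (orderOf_dvd_of_pow_eq_one hn)

/-- In a coprime action, an element acting trivially on a commuting set of cosets acts trivially. -/
theorem commute_of_coprime {G : Type*} [Group G] {h n a : G} {m : ℕ}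
    (hc : (orderOf h).Coprime m) (hconj : n⁻¹ * h * n = h * a) (ha : Commute h a)
    (ham : a ^ m = 1) : Commute h n := by
  have h1 : (n⁻¹ * h * n) ^ orderOf h = 1 := by
    have := conj_pow (i := orderOf h) (a := n⁻¹) (b := h)
    rw [inv_inv] at this
    rw [this, pow_orderOf_eq_one]; group
  rw [hconj, ha.mul_pow, pow_orderOf_eq_one, one_mul] at h1
  rw [eq_one_of_pow_eq_one_of_coprime hc h1 ham, mul_one] at hconj
  calc h * n = n * (n⁻¹ * h * n) := by group
    _ = n * h := by rw [hconj]

theorem Subgroup.pow_card_eq_one {G : Type*} [Group G] {N : Subgroup G} {a : G} (ha : a ∈ N) :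
    a ^ Nat.card N = 1 :=
  congrArg Subtype.val (pow_card_eq_one' (x := (⟨a, ha⟩ : N)))

theorem isVanishing_mul_of_coprime {G : Type} [Group G] [Finite G] {N : Subgroup G} [N.Normal]
    (hN : Group.IsNilpotent N) (hcomm : ∀ a b : G, a * b * a⁻¹ * b⁻¹ ∈ N) {h m : G}
    (hco : (orderOf h).Coprime (Nat.card N)) (hh : ∃ n ∈ N, ¬ Commute h n) (hm : m ∈ N) :
    IsVanishing G (h * m) := by
  induction hc : Nat.card G using Nat.strong_induction_on generalizing G with
  | _ k ih =>
  set A := N ⊓ Subgroup.centralizer (N : Set G) with hA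
  have hAm : ∀ a, a ∈ A ↔ a ∈ N ∧ ∀ n ∈ N, n * a = a * n := fun a => by
    rw [hA, Subgroup.mem_inf, Subgroup.mem_centralizer_iff]; rfl
  have hAne : A ≠ ⊥ := by
    refine Subgroup.inf_centralizer_ne_bot hN ?_
    rintro rfl
    obtain ⟨n, hn, h1⟩ := hh
    rw [Subgroup.mem_bot.1 hn] at h1
    exact h1 (Commute.one_right h)
  by_cases hAh : ∀ a ∈ A, Commute h a
  · have hsurj := QuotientGroup.mk'_surjective A
    refine IsVanishing.of_surjective (QuotientGroup.mk' A) hsurj ?_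
    rw [map_mul]
    refine ih _ (hc ▸ Subgroup.card_quotient_lt hAne) (N := N.map (QuotientGroup.mk' A))
      (Subgroup.isNilpotent_map _ hN) ?_ ?_ ?_ (Subgroup.mem_map_of_mem _ hm) rfl
    · intro a b
      obtain ⟨a, rfl⟩ := hsurj a
      obtain ⟨b, rfl⟩ := hsurj b
      exact ⟨_, hcomm a b, by simp⟩
    · exact (hco.coprime_dvd_left (orderOf_map_dvd _ h)).coprime_dvd_right
        (Subgroup.card_map_dvd _ _)
    · by_contra hcon
      push Not at hcon
      obtain ⟨n, hn, h1⟩ := hh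
      refine h1 (commute_of_coprime (a := h⁻¹ * n⁻¹ * h * n) hco (by group) ?_ ?_)
      · refine hAh _ ?_
        have h2 := hcon _ (Subgroup.mem_map_of_mem _ hn)
        rw [← QuotientGroup.ker_mk' A, MonoidHom.mem_ker]
        simp only [map_mul, map_inv]
        rw [mul_assoc, h2.eq]
        group
      · refine Subgroup.pow_card_eq_one (N.mul_mem ?_ hn)
        have := (inferInstance : N.Normal).conj_mem _ (N.inv_mem hn) h⁻¹
        rwa [inv_inv] at this
  · push Not at hAh
    obtain ⟨a, ha, hha⟩ := hAh
    have hAn : A.Normal := inferInstance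
    have hx : ∀ b ∈ A, (h * m)⁻¹ * b * (h * m) ∈ A := fun b hb => by
      have := hAn.conj_mem b hb (h * m)⁻¹
      rwa [inv_inv] at this
    refine isVanishing_of_commutators A (h * m) ?_ ?_ ⟨a, ha, ?_⟩
    · intro b hb c hc
      have h2 := A.mul_mem (hx b hb) (A.inv_mem hb)
      exact ((hAm _).1 h2).2 c ((hAm _).1 hc).1
    · intro g b hb
      have hb' := hAn.conj_mem b hb g
      refine ⟨_, hb', ?_⟩
      set x := h * m
      have h3 := hcomm g x⁻¹
      set c := g * b * g⁻¹
      have h4 : g * (x⁻¹ * b * x * b⁻¹) * g⁻¹ =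
        (g * x⁻¹ * g⁻¹ * x⁻¹⁻¹) * (x⁻¹ * c * x) * (g * x⁻¹ * g⁻¹ * x⁻¹⁻¹)⁻¹ * c⁻¹ := by
        simp only [c]; group
      rw [h4, ((hAm _).1 (hx c hb')).2 _ h3]
      group
    · intro h5
      refine hha ?_
      have h6 := ((hAm _).1 ha).2 m hm
      have : a * h * m = h * a * m := by
        rw [mul_assoc, h5, mul_assoc, mul_assoc, h6]
      exact (mul_right_cancel this).symm

theorem isVanishing_of_forall_conj {G : Type} [Group G] [Finite G] {N : Subgroup G} [N.Normal]
    (hN : Group.IsNilpotent N) {d : G} (hd : d ∈ N) (hdc : ∃ n ∈ N, n * d ≠ d * n)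
    (hconj : ∀ y : G, ∃ n ∈ N, y * d * y⁻¹ = n * d * n⁻¹) : IsVanishing G d := by
  induction hc : Nat.card G using Nat.strong_induction_on generalizing G with
  | _ k ih =>
  set A := N ⊓ Subgroup.centralizer (N : Set G) with hA
  have hAm : ∀ a, a ∈ A ↔ a ∈ N ∧ ∀ n ∈ N, n * a = a * n := fun a => by
    rw [hA, Subgroup.mem_inf, Subgroup.mem_centralizer_iff]; rfl
  have hAne : A ≠ ⊥ := by
    refine Subgroup.inf_centralizer_ne_bot hN ?_
    rintro rfl
    obtain ⟨n, hn, h1⟩ := hdc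
    rw [Subgroup.mem_bot.1 hn] at h1
    simp at h1
  by_cases hAd : ∀ n ∈ N, d⁻¹ * n * d * n⁻¹ ∈ A
  · refine isVanishing_of_commutators N d ?_ ?_ hdc
    · exact fun b hb c hc => ((hAm _).1 (hAd b hb)).2 c hc
    · intro g b hb
      obtain ⟨n, hn, h1⟩ := hconj g
      have hb' := (inferInstance : N.Normal).conj_mem b hb g
      have hb'' : n⁻¹ * (g * b * g⁻¹) * n ∈ N := N.mul_mem (N.mul_mem (N.inv_mem hn) hb') hn
      refine ⟨_, hb'', ?_⟩
      set c := g * b * g⁻¹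
      have h2 : g * (d⁻¹ * b * d * b⁻¹) * g⁻¹ =
        (g * d * g⁻¹)⁻¹ * c * (g * d * g⁻¹) * c⁻¹ := by simp only [c]; group
      rw [h2, h1]
      have h3 := ((hAm _).1 (hAd _ hb'')).2 n hn
      calc (n * d * n⁻¹)⁻¹ * c * (n * d * n⁻¹) * c⁻¹
          = n * (d⁻¹ * (n⁻¹ * c * n) * d * (n⁻¹ * c * n)⁻¹) * n⁻¹ := by group
        _ = _ := by rw [h3]; group
  · push Not at hAd
    obtain ⟨n, hn, h1⟩ := hAd
    have hsurj := QuotientGroup.mk'_surjective A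
    refine IsVanishing.of_surjective (QuotientGroup.mk' A) hsurj ?_
    refine ih _ (hc ▸ Subgroup.card_quotient_lt hAne) (N := N.map (QuotientGroup.mk' A))
      (Subgroup.isNilpotent_map _ hN) (Subgroup.mem_map_of_mem _ hd)
      ⟨_, Subgroup.mem_map_of_mem _ hn, fun h2 => h1 ?_⟩ ?_ rfl
    · rw [← QuotientGroup.ker_mk' A, MonoidHom.mem_ker]
      simp only [map_mul, map_inv]
      rw [mul_assoc _ _ (QuotientGroup.mk' A d), h2]
      group
    · intro y
      obtain ⟨y, rfl⟩ := hsurj y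
      obtain ⟨m, hm, h3⟩ := hconj y
      exact ⟨_, Subgroup.mem_map_of_mem _ hm, by rw [← map_inv, ← map_inv, ← map_mul, ← map_mul,
        h3, map_mul, map_mul]⟩

theorem Subgroup.relIndex_eq_index_of_sup_eq_top {G : Type*} [Group G] [Finite G]
    {C N : Subgroup G} [N.Normal] (h : N ⊔ C = ⊤) : C.relIndex N = C.index := by
  have h1 : N.index = N.relIndex C := by
    rw [← Subgroup.relIndex_sup_left, h, Subgroup.relIndex_top_right]
  have h2 := Subgroup.relIndex_mul_index (inf_le_left : N ⊓ C ≤ N)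
  have h3 := Subgroup.relIndex_mul_index (inf_le_right : N ⊓ C ≤ C)
  rw [Subgroup.inf_relIndex_left] at h2
  rw [Subgroup.inf_relIndex_right, ← h1, mul_comm] at h3
  exact Nat.eq_of_mul_eq_mul_right (Nat.pos_of_ne_zero Subgroup.index_ne_zero_of_finite)
    (h2.trans h3.symm)

theorem classSize_subgroup_eq_relIndex {G : Type*} [Group G] {N : Subgroup G} (d : N) :
    classSize d = (Subgroup.centralizer {(d : G)}).relIndex N := by
  rw [classSize, Subgroup.relIndex]
  congr 1
  ext x
  rw [Subgroup.mem_subgroupOf, Subgroup.mem_centralizer_singleton_iff,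
    Subgroup.mem_centralizer_singleton_iff]
  exact Subtype.ext_iff

theorem exists_isPrimePow_classSize {N : Type*} [Group N] [Finite N] (hN : Group.IsNilpotent N)
    (hc : Subgroup.center N ≠ ⊤) : ∃ x : N, IsPrimePow (classSize x) := by
  have hnorm : ∀ (p : ℕ) (_ : Fact p.Prime) (P : Sylow p N), (P : Subgroup N).Normal :=
    ((Group.isNilpotent_of_finite_tfae (G := N)).out 0 3).1 hN
  have h1 : ∃ (p : ℕ) (_ : Fact p.Prime) (P : Sylow p N), ¬ (P : Subgroup N) ≤ Subgroup.center N := by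
    by_contra! hcon
    refine hc (Subgroup.eq_top_of_card_eq _ (Nat.dvd_antisymm (Subgroup.card_subgroup_dvd_card _)
      ((Nat.dvd_iff_prime_pow_dvd_dvd _ _).2 fun p k hp hd => ?_)))
    have hF : Fact p.Prime := ⟨hp⟩
    let P : Sylow p N := default
    exact (P.pow_dvd_card_of_pow_dvd_card hd).trans (Subgroup.card_dvd_of_le (hcon p hF P))
  obtain ⟨p, hp, P, hP⟩ := h1
  obtain ⟨x, hx, hxc⟩ := SetLike.not_le_iff_exists.1 hP
  refine ⟨x, ?_⟩
  have h2 : ∀ {q : ℕ}, q.Prime → q ∣ classSize x → q = p := by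
    intro q hq hd
    by_contra hne
    have hF : Fact q.Prime := ⟨hq⟩
    let Q : Sylow q N := default
    have h3 : (Q : Subgroup N) ≤ Subgroup.centralizer {x} := fun y hy => by
      rw [Subgroup.mem_centralizer_singleton_iff]
      exact Subgroup.commute_of_normal_of_disjoint _ _ (hnorm q hF Q) (hnorm p hp P)
        (IsPGroup.disjoint_of_ne q p hne _ _ Q.2 P.2) y x hy hx
    exact Q.not_dvd_index (hd.trans (Subgroup.index_dvd_of_le h3))
  have h4 := Nat.eq_prime_pow_of_unique_prime_dvd (classSize_pos x).ne' h2
  rw [isPrimePow_nat_iff]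
  refine ⟨p, _, hp.out, Nat.pos_of_ne_zero fun h0 => ?_, h4.symm⟩
  rw [h0, pow_zero, classSize_eq_one_iff] at h4
  exact hxc h4

theorem Subgroup.mem_center_of_commute_of_sup_eq_top {G : Type*} [Group G] {N H : Subgroup G}
    [N.Normal] (htop : N ⊔ H = ⊤) {x : G} (h1 : ∀ n ∈ N, Commute n x) (h2 : ∀ h ∈ H, Commute h x) :
    x ∈ Subgroup.center G := by
  rw [Subgroup.mem_center_iff]
  intro g
  obtain ⟨n, hn, h, hh, rfl⟩ := Subgroup.mem_sup_of_normal_left.1 (htop ▸ Subgroup.mem_top g)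
  exact ((h1 n hn).mul_left (h2 h hh)).eq

theorem isVanishing_of_centralizing_complement {G : Type} [Group G] [Finite G] {N H : Subgroup G}
    [N.Normal] (hN : Group.IsNilpotent N) (htop : N ⊔ H = ⊤)
    (hHN : ∀ h ∈ H, ∀ n ∈ N, Commute h n) {d : G} (hd : d ∈ N) (hdc : ∃ n ∈ N, n * d ≠ d * n) :
    IsVanishing G d := by
  refine isVanishing_of_forall_conj hN hd hdc fun y => ?_
  obtain ⟨n, hn, h, hh, rfl⟩ := Subgroup.mem_sup_of_normal_left.1 (htop ▸ Subgroup.mem_top y)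
  refine ⟨n, hn, ?_⟩
  calc n * h * d * (n * h)⁻¹ = n * (h * d) * h⁻¹ * n⁻¹ := by group
    _ = _ := by rw [(hHN h hh d hd).eq]; group

theorem classSize_subgroup_of_centralizing_complement {G : Type*} [Group G] [Finite G]
    {N H : Subgroup G} [N.Normal] (htop : N ⊔ H = ⊤)
    (hHN : ∀ h ∈ H, ∀ n ∈ N, Commute h n) (d : N) : classSize d = classSize (d : G) := by
  rw [classSize_subgroup_eq_relIndex, classSize]
  refine Subgroup.relIndex_eq_index_of_sup_eq_top (top_le_iff.1 (htop ▸ sup_le_sup_left ?_ _))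
  intro h hh
  rw [Subgroup.mem_centralizer_singleton_iff]
  exact hHN h hh d d.2

theorem isPrimePow_and_cs_of_centralizing_complement {G : Type} [Group G] [Finite G] {s : ℕ}
    {N H : Subgroup G} [N.Normal] (hvcs : vcs G = {s}) (hN : Group.IsNilpotent N)
    (hab : IsAbelianSubgroup H) (htop : N ⊔ H = ⊤) (hHN : ∀ h ∈ H, ∀ n ∈ N, Commute h n) :
    IsPrimePow s ∧ cs N = {1, s} := by
  have hvs : ∀ g, IsVanishing G g → classSize g = s := fun g hg => by
    have : classSize g ∈ vcs G := ⟨g, hg, rfl⟩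
    rwa [hvcs] at this
  have hcl : ∀ d : N, classSize d = 1 ∨ classSize d = s := fun d => by
    by_cases hd : d ∈ Subgroup.center N
    · exact Or.inl ((classSize_eq_one_iff d).2 hd)
    · right
      rw [Subgroup.mem_center_iff] at hd
      push Not at hd
      obtain ⟨n, hn⟩ := hd
      rw [classSize_subgroup_of_centralizing_complement htop hHN]
      exact hvs _ (isVanishing_of_centralizing_complement hN htop hHN d.2
        ⟨n, n.2, fun h => hn (Subtype.ext h)⟩)
  have hc : Subgroup.center N ≠ ⊤ := by
    intro hc
    have hs : s ∈ vcs G := by rw [hvcs]; rfl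
    obtain ⟨g, hg, -⟩ := hs
    refine hg.notMem_center ?_
    obtain ⟨n, hn, h, hh, rfl⟩ := Subgroup.mem_sup_of_normal_left.1 (htop ▸ Subgroup.mem_top g)
    have hNc : ∀ m ∈ N, Commute m n := fun m hm => by
      have h3 : (⟨n, hn⟩ : N) ∈ Subgroup.center N := hc ▸ Subgroup.mem_top _
      exact congrArg Subtype.val (Subgroup.mem_center_iff.1 h3 ⟨m, hm⟩)
    refine mul_mem (Subgroup.mem_center_of_commute_of_sup_eq_top htop hNc fun k hk => hHN k hk n hn)
      (Subgroup.mem_center_of_commute_of_sup_eq_top htop (fun m hm => (hHN h hh m hm).symm)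
        fun k hk => hab k hk h hh)
  obtain ⟨x, hx⟩ := exists_isPrimePow_classSize hN hc
  have hxs : classSize x = s := (hcl x).resolve_left fun h => not_isPrimePow_one (h ▸ hx)
  refine ⟨hxs ▸ hx, Set.Subset.antisymm ?_ ?_⟩
  · rintro _ ⟨d, rfl⟩
    exact hcl d
  · rintro _ (rfl | rfl)
    · exact ⟨1, (classSize_eq_one_iff _).2 (one_mem _)⟩
    · exact ⟨x, hxs⟩

theorem commute_of_commute_mul_of_coprime {G : Type*} [Group G] {g h d : G} {m : ℕ}
    (hc : (orderOf h).Coprime m) (hd : d ^ m = 1) (hhd : Commute h d) (hg : Commute g (h * d)) :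
    Commute g h := by
  obtain ⟨k, hk⟩ := exists_pow_eq_self_of_coprime hc.symm
  have h1 := hg.pow_right m
  rw [hhd.mul_pow, hd, mul_one] at h1
  have h2 := h1.pow_right k
  rwa [hk] at h2

theorem Subgroup.eq_of_le_of_index_eq {G : Type*} [Group G] [Finite G] {H K : Subgroup G}
    (h : H ≤ K) (hi : H.index = K.index) : H = K := by
  have h1 := Subgroup.relIndex_mul_index h
  rw [hi] at h1
  have h2 : H.relIndex K = 1 := Nat.eq_of_mul_eq_mul_right
    (Nat.pos_of_ne_zero (Subgroup.index_ne_zero_of_finite (H := K))) (h1.trans (one_mul _).symm)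
  exact le_antisymm h (Subgroup.relIndex_eq_one.1 h2)

section FrobeniusCase

variable {G : Type} [Group G] [Finite G] {s : ℕ} {N H : Subgroup G} [N.Normal]

theorem centralizer_le_of_commute (hvs : ∀ g, IsVanishing G g → classSize g = s)
    (hN : Group.IsNilpotent N) (hcomm : ∀ a b : G, a * b * a⁻¹ * b⁻¹ ∈ N) {h d : G}
    (hco : (orderOf h).Coprime (Nat.card N)) (hh : ∃ n ∈ N, ¬ Commute h n) (hd : d ∈ N)
    (hhd : Commute h d) : Subgroup.centralizer {h} ≤ Subgroup.centralizer {d} := by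
  have h1 := hvs _ (isVanishing_mul_of_coprime hN hcomm hco hh hd)
  have h2 := hvs _ (isVanishing_mul_of_coprime hN hcomm hco hh N.one_mem)
  rw [mul_one] at h2
  have h3 : Subgroup.centralizer {h * d} ≤ Subgroup.centralizer {h} := fun g hg => by
    rw [Subgroup.mem_centralizer_singleton_iff] at hg ⊢
    exact commute_of_commute_mul_of_coprime hco (Subgroup.pow_card_eq_one hd) hhd hg
  have h4 := Subgroup.eq_of_le_of_index_eq h3 (h1.trans h2.symm)
  intro g hg
  have h5 := h4.symm ▸ hg
  rw [Subgroup.mem_centralizer_singleton_iff] at hg h5 ⊢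
  have h6 : h * (g * d) = h * (d * g) := by
    rw [← mul_assoc, ← hg, mul_assoc, h5, mul_assoc]
  exact mul_left_cancel h6

theorem mem_center_of_commute (hvs : ∀ g, IsVanishing G g → classSize g = s)
    (hN : Group.IsNilpotent N) (hcomm : ∀ a b : G, a * b * a⁻¹ * b⁻¹ ∈ N) (htop : N ⊔ H = ⊤)
    (hab : IsAbelianSubgroup H) {h d : G} (hhH : h ∈ H)
    (hco : (orderOf h).Coprime (Nat.card N)) (hh : ∃ n ∈ N, ¬ Commute h n) (hd : d ∈ N)
    (hhd : Commute h d) : d ∈ Subgroup.center G := by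
  have hle := centralizer_le_of_commute hvs hN hcomm hco hh hd hhd
  have hHd : ∀ k ∈ H, Commute k d := fun k hk => by
    refine Subgroup.mem_centralizer_singleton_iff.1 (hle ?_)
    rw [Subgroup.mem_centralizer_singleton_iff]
    exact hab k hk h hhH
  refine Subgroup.mem_center_of_commute_of_sup_eq_top htop ?_ hHd
  by_contra! hcon
  have hvd : IsVanishing G d := by
    refine isVanishing_of_forall_conj hN hd hcon fun y => ?_
    obtain ⟨n, hn, k, hk, rfl⟩ := Subgroup.mem_sup_of_normal_left.1 (htop ▸ Subgroup.mem_top y)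
    refine ⟨n, hn, ?_⟩
    calc n * k * d * (n * k)⁻¹ = n * (k * d) * k⁻¹ * n⁻¹ := by group
      _ = _ := by rw [(hHd k hk).eq]; group
  have hvh := isVanishing_mul_of_coprime hN hcomm hco hh N.one_mem
  rw [mul_one] at hvh
  have heq := Subgroup.eq_of_le_of_index_eq hle ((hvs _ hvh).trans (hvs _ hvd).symm)
  set D := (Subgroup.centralizer {h}).subgroupOf N with hD
  have hDm : ∀ x : N, x ∈ D ↔ Commute (x : G) h := fun x => by
    rw [hD, Subgroup.mem_subgroupOf, Subgroup.mem_centralizer_singleton_iff]; rfl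
  have hlt : D < ⊤ := by
    rw [lt_top_iff_ne_top]
    intro h1
    obtain ⟨n, hn, h2⟩ := hh
    exact h2 ((hDm ⟨n, hn⟩).1 (h1 ▸ Subgroup.mem_top _)).symm
  obtain ⟨x, hx, hxD⟩ := SetLike.exists_of_lt (Group.normalizerCondition_of_isNilpotent D hlt)
  refine hxD ((hDm x).2 (Commute.symm ?_))
  have hdD : (⟨d, hd⟩ : N) ∈ D := (hDm _).2 hhd.symm
  have h1 : Commute ((x : G) * d * (x : G)⁻¹) h :=
    (hDm _).1 ((Subgroup.mem_normalizer_iff.1 hx _).1 hdD)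
  have hcN : h⁻¹ * (x : G)⁻¹ * h * x ∈ N := by
    refine N.mul_mem ?_ x.2
    have := (inferInstance : N.Normal).conj_mem _ (N.inv_mem x.2) h⁻¹
    rwa [inv_inv] at this
  have h2 : Commute (h⁻¹ * (x : G)⁻¹ * h * x) d := by
    have h4 : Commute ((x : G)⁻¹ * h * x) d :=
      calc (x : G)⁻¹ * h * x * d = (x : G)⁻¹ * (h * (x * d * (x : G)⁻¹)) * x := by group
        _ = (x : G)⁻¹ * (x * d * (x : G)⁻¹ * h) * x := by rw [h1.eq]
        _ = _ := by group
    have h5 := hhd.inv_left.mul_left h4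
    rwa [← mul_assoc, ← mul_assoc] at h5
  have h3 : Commute (h⁻¹ * (x : G)⁻¹ * h * x) h := by
    have h4 : h⁻¹ * (x : G)⁻¹ * h * x ∈ Subgroup.centralizer {d} :=
      Subgroup.mem_centralizer_singleton_iff.2 h2
    rw [← heq] at h4
    exact Subgroup.mem_centralizer_singleton_iff.1 h4
  exact commute_of_coprime (m := Nat.card N) hco (by group) h3.symm (Subgroup.pow_card_eq_one hcN)

theorem relIndex_centralizer_of_isVanishing (hvs : ∀ g, IsVanishing G g → classSize g = s)
    (hNH : IsHallSubgroup (primesOf s) N) (g : G) (hg : IsVanishing G g) :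
    (Subgroup.centralizer {g}).relIndex N = s := by
  rw [Subgroup.relIndex_eq_index_of_sup_eq_top, ← classSize, hvs g hg]
  rw [← Subgroup.index_eq_one]
  have h1 : (N ⊔ Subgroup.centralizer {g}).index ∣ s :=
    hvs g hg ▸ Subgroup.index_dvd_of_le le_sup_right
  have h2 : (N ⊔ Subgroup.centralizer {g}).index ∣ N.index :=
    Subgroup.index_dvd_of_le le_sup_left
  have h3 : s.Coprime N.index :=
    coprime_of_primes_mem (π := primesOf s) (fun p hp hd => ⟨hp, hd⟩) hNH.2
  exact Nat.eq_one_of_dvd_coprimes h3 h1 h2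

theorem mem_center_of_commute_isVanishing (hvs : ∀ g, IsVanishing G g → classSize g = s)
    (hNH : IsHallSubgroup (primesOf s) N)
    (hN : Group.IsNilpotent N) (hcomm : ∀ a b : G, a * b * a⁻¹ * b⁻¹ ∈ N) (htop : N ⊔ H = ⊤)
    (hab : IsAbelianSubgroup H) {h : G} (hhH : h ∈ H)
    (hco : (orderOf h).Coprime (Nat.card N)) (hh : ∃ n ∈ N, ¬ Commute h n) {y d : G}
    (hy : IsVanishing G y) (hd : d ∈ N) (hyd : Commute y d) : d ∈ Subgroup.center G := by
  have hrel := relIndex_centralizer_of_isVanishing hvs hNH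
  have hvh := isVanishing_mul_of_coprime hN hcomm hco hh N.one_mem
  rw [mul_one] at hvh
  have h1 : (Subgroup.centralizer {h}).subgroupOf N ≤ (Subgroup.centralizer {y}).subgroupOf N := by
    intro x hx
    rw [Subgroup.mem_subgroupOf, Subgroup.mem_centralizer_singleton_iff] at hx ⊢
    have := mem_center_of_commute hvs hN hcomm htop hab hhH hco hh x.2 hx.symm
    exact (Subgroup.mem_center_iff.1 this y).symm
  have h2 := Subgroup.eq_of_le_of_index_eq h1 ((hrel h hvh).trans (hrel y hy).symm)
  have h3 : (⟨d, hd⟩ : N) ∈ (Subgroup.centralizer {y}).subgroupOf N :=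
    Subgroup.mem_subgroupOf.2 (Subgroup.mem_centralizer_singleton_iff.2 hyd.symm)
  rw [← h2, Subgroup.mem_subgroupOf, Subgroup.mem_centralizer_singleton_iff] at h3
  exact mem_center_of_commute hvs hN hcomm htop hab hhH hco hh hd h3.symm

theorem isFrobenius_of_vcs (hvcs : vcs G = {s}) (hNH : IsHallSubgroup (primesOf s) N)
    (hHH : IsHallSubgroup (primesOf s)ᶜ H)
    (hN : Group.IsNilpotent N) (hcomm : ∀ a b : G, a * b * a⁻¹ * b⁻¹ ∈ N) (htop : N ⊔ H = ⊤)
    (hab : IsAbelianSubgroup H) (hNC : ∃ h ∈ H, ∃ n ∈ N, ¬ Commute h n) :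
    IsFrobenius (N.map (QuotientGroup.mk' (Subgroup.center G)))
      (H.map (QuotientGroup.mk' (Subgroup.center G))) ∧
    Nat.card (N.map (QuotientGroup.mk' (Subgroup.center G))) = s ∧
    ∀ x ∈ N, ¬ IsVanishing G x := by
  have hvs : ∀ g, IsVanishing G g → classSize g = s := fun g hg => by
    have : classSize g ∈ vcs G := ⟨g, hg, rfl⟩
    rwa [hvcs] at this
  have hcop : (Nat.card H).Coprime (Nat.card N) :=
    (coprime_of_primes_mem hNH.1 hHH.1).symm
  have hco : ∀ h ∈ H, (orderOf h).Coprime (Nat.card N) := fun h hh =>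
    hcop.coprime_dvd_left (Subgroup.orderOf_dvd_natCard _ hh)
  obtain ⟨h, hh, hhn⟩ := hNC
  have key : ∀ {y d : G}, IsVanishing G y → d ∈ N → Commute y d → d ∈ Subgroup.center G :=
    fun hy hd hyd => mem_center_of_commute_isVanishing hvs hNH hN hcomm htop hab hh (hco h hh) hhn
      hy hd hyd
  have hvh := isVanishing_mul_of_coprime hN hcomm (hco h hh) hhn N.one_mem
  rw [mul_one] at hvh
  set π := QuotientGroup.mk' (Subgroup.center G) with hπ
  have hker : ∀ x, π x = 1 ↔ x ∈ Subgroup.center G := fun x => by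
    rw [← MonoidHom.mem_ker, hπ, QuotientGroup.ker_mk']
  have hsurj : Function.Surjective π := QuotientGroup.mk'_surjective _
  have hnorm : (N.map π).Normal := Subgroup.Normal.map inferInstance π hsurj
  have hinf : N.map π ⊓ H.map π = ⊥ := by
    rw [← Subgroup.card_eq_one]
    exact Nat.eq_one_of_dvd_coprimes hcop
      ((Subgroup.card_dvd_of_le inf_le_right).trans (Subgroup.card_map_dvd H π))
      ((Subgroup.card_dvd_of_le inf_le_left).trans (Subgroup.card_map_dvd N π))
  refine ⟨⟨⟨?_, ?_, hnorm, ?_⟩, ?_, hinf⟩, ?_, ?_⟩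
  · intro h1
    obtain ⟨n, hn, h2⟩ := hhn
    have h3 : π n ∈ N.map π := Subgroup.mem_map_of_mem _ hn
    rw [h1, Subgroup.mem_bot, hker] at h3
    exact h2 (Subgroup.mem_center_iff.1 h3 h)
  · intro h1
    rw [h1, top_inf_eq] at hinf
    have h3 : π h ∈ H.map π := Subgroup.mem_map_of_mem _ hh
    rw [hinf, Subgroup.mem_bot, hker] at h3
    exact hvh.notMem_center h3
  · rintro _ ⟨n, hn, rfl⟩ hn1 g hg
    rw [Subgroup.mem_centralizer_singleton_iff] at hg
    obtain ⟨g, rfl⟩ := hsurj g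
    obtain ⟨m, hm, k, hk, rfl⟩ := Subgroup.mem_sup_of_normal_left.1 (htop ▸ Subgroup.mem_top g)
    by_cases hkN : ∀ n ∈ N, Commute k n
    · have : k ∈ Subgroup.center G := Subgroup.mem_center_of_commute_of_sup_eq_top htop
        (fun n hn => (hkN n hn).symm) fun l hl => hab l hl k hk
      rw [map_mul, (hker k).2 this, mul_one]
      exact Subgroup.mem_map_of_mem _ hm
    · exfalso
      push Not at hkN
      set g := m * k
      set z := g⁻¹ * n⁻¹ * g * n with hz
      have hzN : z ∈ N := by
        refine N.mul_mem ?_ hn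
        have := (inferInstance : N.Normal).conj_mem _ (N.inv_mem hn) g⁻¹
        rwa [inv_inv] at this
      have hzc : z ∈ Subgroup.center G := by
        rw [← hker, hz]
        simp only [map_mul, map_inv] at hg ⊢
        rw [mul_assoc, hg]
        group
      have h1 : Commute (g ^ Nat.card N) n := by
        have h2 : n⁻¹ * g * n = g * z := by rw [hz]; group
        have h3 := conj_pow (i := Nat.card N) (a := n⁻¹) (b := g)
        rw [inv_inv, h2, Commute.mul_pow (Subgroup.mem_center_iff.1 hzc g),
          Subgroup.pow_card_eq_one hzN, mul_one] at h3
        calc g ^ Nat.card N * n = n * (n⁻¹ * g ^ Nat.card N * n) := by group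
          _ = _ := by rw [← h3]
      obtain ⟨m', hm', h4⟩ : ∃ m' ∈ N, g ^ Nat.card N = k ^ Nat.card N * m' := by
        refine ⟨(k ^ Nat.card N)⁻¹ * g ^ Nat.card N, ?_, by group⟩
        rw [← QuotientGroup.ker_mk' N, MonoidHom.mem_ker]
        have : QuotientGroup.mk' N m = 1 := by
          rwa [← MonoidHom.mem_ker, QuotientGroup.ker_mk']
        simp only [g, map_mul, map_inv, map_pow, this, one_mul, inv_mul_cancel]
      have hvy : IsVanishing G (g ^ Nat.card N) := by
        rw [h4]
        refine isVanishing_mul_of_coprime hN hcomm (hco _ (H.pow_mem hk _)) ?_ hm'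
        obtain ⟨n', hn', h5⟩ := hkN
        refine ⟨n', hn', fun h6 => h5 ?_⟩
        obtain ⟨l, hl⟩ := exists_pow_eq_self_of_coprime (hco k hk).symm
        have := h6.pow_left l
        rwa [hl] at this
      exact hn1 ((hker n).2 (key hvy hn h1))
  · rw [← Subgroup.map_sup, htop, Subgroup.map_top_of_surjective _ hsurj]
  · rw [← Subgroup.relIndex_ker, hπ, QuotientGroup.ker_mk',
      ← relIndex_centralizer_of_isVanishing hvs hNH h hvh, ← Subgroup.inf_relIndex_right,
      ← Subgroup.inf_relIndex_right (Subgroup.centralizer {h})]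
    congr 1
    ext x
    rw [Subgroup.mem_inf, Subgroup.mem_inf, Subgroup.mem_centralizer_singleton_iff]
    exact and_congr_left fun hx =>
      ⟨fun h1 => (Subgroup.mem_center_iff.1 h1 h).symm, fun h1 => key hvh hx h1.symm⟩
  · exact fun x hx hv => hv.notMem_center (key hv hx (Commute.refl x))

end FrobeniusCase

theorem classSize_mul_of_mem_center {G : Type*} [Group G] (g : G) {z : G}
    (hz : z ∈ Subgroup.center G) : classSize (g * z) = classSize g := by
  rw [classSize, classSize]
  congr 1
  ext x
  rw [Subgroup.mem_centralizer_singleton_iff, Subgroup.mem_centralizer_singleton_iff, ← mul_assoc,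
    mul_assoc g z x, ← Subgroup.mem_center_iff.1 hz x, ← mul_assoc, mul_left_inj]

theorem isNilpotent_and_vcs_of_centralizing_complement {G : Type} [Group G] [Finite G] {s : ℕ}
    {N H : Subgroup G} [N.Normal] (hNH : IsHallSubgroup (primesOf s) N)
    (hab : IsAbelianSubgroup H) (htop : N ⊔ H = ⊤) (hs : IsPrimePow s)
    (hHN : ∀ h ∈ H, ∀ n ∈ N, Commute h n) (hcs : cs N = {1, s}) :
    Group.IsNilpotent N ∧ vcs G = {s} := by
  obtain ⟨p, k, hp, hk, rfl⟩ := (isPrimePow_nat_iff s).1 hs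
  have hF : Fact p.Prime := ⟨hp⟩
  have hNp : IsPGroup p N := IsPGroup.of_card (Nat.eq_prime_pow_of_unique_prime_dvd
    Nat.card_pos.ne' fun {q} hq hd =>
      (Nat.prime_dvd_prime_iff_eq hq hp).1 (hq.dvd_of_dvd_pow (hNH.1 q hq hd).2))
  have hN : Group.IsNilpotent N := hNp.isNilpotent
  refine ⟨hN, Set.Subset.antisymm ?_ ?_⟩
  · rintro _ ⟨g, hg, rfl⟩
    obtain ⟨n, hn, h, hh, rfl⟩ := Subgroup.mem_sup_of_normal_left.1 (htop ▸ Subgroup.mem_top g)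
    have hc := Subgroup.mem_center_of_commute_of_sup_eq_top htop
      (fun m hm => (hHN h hh m hm).symm) fun k hk => hab k hk h hh
    have h1 : classSize (n * h) ≠ 1 := fun h1 => hg.notMem_center ((classSize_eq_one_iff _).1 h1)
    rw [classSize_mul_of_mem_center _ hc] at h1 ⊢
    have h2 : classSize (⟨n, hn⟩ : N) ∈ cs N := ⟨_, rfl⟩
    rw [classSize_subgroup_of_centralizing_complement htop hHN, hcs] at h2
    exact h2.resolve_left h1
  · rintro _ rfl
    obtain ⟨n, hn⟩ : p ^ k ∈ cs N := hcs ▸ Set.mem_insert_of_mem _ rfl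
    have hnc : n ∉ Subgroup.center N := fun h => by
      rw [(classSize_eq_one_iff n).2 h] at hn
      exact hs.ne_one hn.symm
    rw [Subgroup.mem_center_iff] at hnc
    push Not at hnc
    obtain ⟨m, hm⟩ := hnc
    exact ⟨n, isVanishing_of_centralizing_complement hN htop hHN n.2
      ⟨m, m.2, fun h => hm (Subtype.ext h)⟩,
      (classSize_subgroup_of_centralizing_complement htop hHN n).symm.trans hn⟩

/-- In a Frobenius group, all elements in a nontrivial coset of the kernel which centralizes the
quotient are conjugate. -/
theorem isConj_mul_of_isFrobeniusWithKernel {X : Type*} [Group X] [Finite X] {K : Subgroup X}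
    (hK : IsFrobeniusWithKernel K) {k : X} (hk : k ∉ K) {y : X} (hy : y ∈ K) :
    IsConj k (k * y) := by
  obtain ⟨-, -, hn, hcent⟩ := hK
  let f : K → K := fun x => ⟨k⁻¹ * x * k * (x : X)⁻¹, by
    have := K.mul_mem (hn.conj_mem x x.2 k⁻¹) (K.inv_mem x.2)
    rwa [inv_inv] at this⟩
  have hf : Function.Injective f := by
    intro a b hab
    have h1 : k⁻¹ * a * k * (a : X)⁻¹ = k⁻¹ * b * k * (b : X)⁻¹ := congrArg Subtype.val hab
    have h2 : k * ((b : X)⁻¹ * a) = (b : X)⁻¹ * a * k := by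
      calc k * ((b : X)⁻¹ * a) = (b : X)⁻¹ * (b * k * (b : X)⁻¹ * k⁻¹) * k * a := by group
        _ = (b : X)⁻¹ * (k * (k⁻¹ * b * k * (b : X)⁻¹) * k⁻¹) * k * a := by group
        _ = (b : X)⁻¹ * (k * (k⁻¹ * a * k * (a : X)⁻¹) * k⁻¹) * k * a := by rw [h1]
        _ = _ := by group
    by_contra hne
    refine hk (hcent _ (K.mul_mem (K.inv_mem b.2) a.2) (fun h => hne ?_)
      (Subgroup.mem_centralizer_singleton_iff.2 h2))
    exact Subtype.ext (inv_mul_eq_one.1 h).symm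
  obtain ⟨x, hx⟩ := Finite.injective_iff_surjective.1 hf ⟨y, hy⟩
  have hx : k⁻¹ * x * k * (x : X)⁻¹ = y := congrArg Subtype.val hx
  exact isConj_iff.2 ⟨x, by rw [← hx]; group⟩

theorem vcs_of_isFrobenius {G : Type} [Group G] [Finite G] {s : ℕ}
    {N H : Subgroup G} [N.Normal] (hab : IsAbelianSubgroup H) (htop : N ⊔ H = ⊤)
    (hF : IsFrobenius (N.map (QuotientGroup.mk' (Subgroup.center G)))
      (H.map (QuotientGroup.mk' (Subgroup.center G))))
    (hcard : Nat.card (N.map (QuotientGroup.mk' (Subgroup.center G))) = s)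
    (hv : ∀ x ∈ N, ¬ IsVanishing G x) : vcs G = {s} := by
  set π := QuotientGroup.mk' (Subgroup.center G) with hπ
  have hker : ∀ x, π x = 1 ↔ x ∈ Subgroup.center G := fun x => by
    rw [← MonoidHom.mem_ker, hπ, QuotientGroup.ker_mk']
  have hsurj : Function.Surjective π := QuotientGroup.mk'_surjective _
  obtain ⟨hK, hsup, hinf⟩ := hF
  have hnotK : ∀ k ∈ H, π k ≠ 1 → π k ∉ N.map π := fun k hk h1 h2 => by
    have : π k ∈ N.map π ⊓ H.map π := ⟨h2, Subgroup.mem_map_of_mem _ hk⟩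
    rw [hinf, Subgroup.mem_bot] at this
    exact h1 this
  have hsize : ∀ k ∈ H, π k ≠ 1 → classSize k = s := fun k hk hk1 => by
    have h1 : classSize k ∣ s := by
      rw [← hcard, ← Subgroup.relIndex_ker, hπ, QuotientGroup.ker_mk', classSize,
        ← Subgroup.relIndex_eq_index_of_sup_eq_top (N := N)]
      · exact Subgroup.relIndex_dvd_of_le_left N (Subgroup.center_le_centralizer _)
      · refine top_le_iff.1 (htop ▸ sup_le_sup_left (fun h hh => ?_) _)
        rw [Subgroup.mem_centralizer_singleton_iff]
        exact hab h hh k hk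
    have h2 := classSize_map_dvd hsurj k
    have h3 : s ≤ classSize (π k) := by
      rw [← hcard, classSize_eq_card_conj]
      refine Nat.card_le_card_of_injective (fun y : N.map π =>
        (⟨π k * y, isConj_mul_of_isFrobeniusWithKernel hK (hnotK k hk hk1) y.2⟩ :
          {x // IsConj (π k) x})) fun a b h => ?_
      have : π k * a = π k * b := congrArg Subtype.val h
      exact Subtype.ext (mul_left_cancel this)
    have hs : 0 < s := hcard ▸ Nat.card_pos
    exact le_antisymm (Nat.le_of_dvd hs h1) (h3.trans (Nat.le_of_dvd (classSize_pos k) h2))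
  refine Set.Subset.antisymm ?_ ?_
  · rintro _ ⟨g, hg, rfl⟩
    obtain ⟨n, hn, k, hk, rfl⟩ := Subgroup.mem_sup_of_normal_left.1 (htop ▸ Subgroup.mem_top g)
    have hk1 : π k ≠ 1 := by
      intro h1
      rw [hker] at h1
      have := hg.mul_of_mem_center (inv_mem h1)
      rw [mul_inv_cancel_right] at this
      exact hv n hn this
    have h2 : IsConj (π k) (π k * π (k⁻¹ * n * k)) :=
      isConj_mul_of_isFrobeniusWithKernel hK (hnotK k hk hk1) (Subgroup.mem_map_of_mem _ (by
        have := (inferInstance : N.Normal).conj_mem n hn k⁻¹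
        rwa [inv_inv] at this))
    rw [← map_mul] at h2
    obtain ⟨w, hw⟩ := isConj_iff.1 h2
    obtain ⟨w, rfl⟩ := hsurj w
    rw [← map_inv, ← map_mul, ← map_mul] at hw
    have h3 : k * (k⁻¹ * n * k) = n * k := by group
    rw [h3] at hw
    have h4 : (n * k)⁻¹ * (w * k * w⁻¹) ∈ Subgroup.center G := by
      rw [← hker, map_mul, hw, map_inv, inv_mul_cancel]
    rw [Set.mem_singleton_iff, ← hsize k hk hk1, ← classSize_mul_of_mem_center (n * k) h4,
      mul_inv_cancel_left]
    exact (classSize_eq_of_isConj (isConj_iff.2 ⟨w, rfl⟩)).symm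
  · rintro _ rfl
    obtain ⟨k, hk, hk1⟩ : ∃ k ∈ H, π k ≠ 1 := by
      by_contra! hcon
      refine hK.2.1 ?_
      rw [← hsup, eq_comm, sup_eq_left]
      rintro _ ⟨k, hk, rfl⟩
      rw [hcon k hk]
      exact one_mem _
    have := hK.2.2.1
    exact ⟨k, IsVanishing.of_surjective π hsurj (isVanishing_of_isConj_mul (N.map π) hK.1
      fun y hy => isConj_mul_of_isFrobeniusWithKernel hK (hnotK k hk hk1) hy), hsize k hk hk1⟩

/-- The order of `x` is prime to `p`. -/
def IsPRegular {G : Type*} [Group G] (p : ℕ) (x : G) : Prop := p.Coprime (orderOf x)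

/-- The elements of `S` of order prime to `p` are closed under multiplication; for finite groups
this says that `S` has a normal `p`-complement. -/
def IsPNilpotent {G : Type*} [Group G] (p : ℕ) (S : Subgroup G) : Prop :=
  ∀ x ∈ S, ∀ y ∈ S, IsPRegular p x → IsPRegular p y → IsPRegular p (x * y)

section PRegular

variable {G : Type*} [Group G] {p : ℕ} {x y : G}

theorem isPRegular_of_pow_eq_one {m : ℕ} (h : p.Coprime m) (hx : x ^ m = 1) : IsPRegular p x :=
  h.coprime_dvd_right (orderOf_dvd_of_pow_eq_one hx)

theorem isPRegular_one : IsPRegular p (1 : G) :=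
  isPRegular_of_pow_eq_one (Nat.coprime_one_right p) (one_pow 1)

theorem IsPRegular.inv (h : IsPRegular p x) : IsPRegular p x⁻¹ := by
  rwa [IsPRegular, orderOf_inv]

theorem IsPRegular.pow (h : IsPRegular p x) (k : ℕ) : IsPRegular p (x ^ k) :=
  isPRegular_of_pow_eq_one h (by rw [← pow_mul, mul_comm, pow_mul, pow_orderOf_eq_one, one_pow])

theorem IsPRegular.map {Q : Type*} [Group Q] (h : IsPRegular p x) (f : G →* Q) :
    IsPRegular p (f x) :=
  isPRegular_of_pow_eq_one h (by rw [← map_pow, pow_orderOf_eq_one, map_one])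

theorem IsPRegular.conj (h : IsPRegular p x) (g : G) : IsPRegular p (g * x * g⁻¹) :=
  h.map (MulAut.conj g).toMonoidHom

theorem IsPRegular.of_map_injective {Q : Type*} [Group Q] {f : G →* Q}
    (hf : Function.Injective f) (h : IsPRegular p (f x)) : IsPRegular p x := by
  rwa [IsPRegular, orderOf_injective f hf] at h

theorem IsPRegular.mul_of_commute (hx : IsPRegular p x) (hy : IsPRegular p y)
    (hxy : Commute x y) : IsPRegular p (x * y) := by
  refine isPRegular_of_pow_eq_one (Nat.Coprime.mul_right hx hy) ?_
  rw [hxy.mul_pow, pow_mul, pow_orderOf_eq_one, one_pow, mul_comm (orderOf x), pow_mul,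
    pow_orderOf_eq_one, one_pow, one_mul]

theorem IsPRegular.of_pow {n : ℕ} (hn : p.Coprime n) (h : IsPRegular p (x ^ n)) :
    IsPRegular p x :=
  isPRegular_of_pow_eq_one (hn.mul_right h) (by rw [pow_mul, pow_orderOf_eq_one])

theorem isPRegular_of_mem [Fact p.Prime] {M : Subgroup G} (hM : ¬ p ∣ Nat.card M)
    (hx : x ∈ M) : IsPRegular p x :=
  isPRegular_of_pow_eq_one (((Fact.out : p.Prime).coprime_iff_not_dvd).2 hM)
    (Subgroup.pow_card_eq_one hx)

theorem IsPRegular.eq_one_of_mem {D : Subgroup G} (hD : IsPGroup p D) (hx : x ∈ D)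
    (h : IsPRegular p x) : x = 1 := by
  obtain ⟨k, hk⟩ := hD ⟨x, hx⟩
  have hk : x ^ p ^ k = 1 := congrArg Subtype.val hk
  exact eq_one_of_pow_eq_one_of_coprime (Nat.Coprime.pow_left k h) hk (pow_orderOf_eq_one x)

theorem IsPRegular.exists_pow_pow_eq (h : IsPRegular p x) (a : ℕ) : ∃ l, (x ^ p ^ a) ^ l = x :=
  exists_pow_eq_self_of_coprime (Nat.Coprime.pow_left a h)

theorem exists_isPRegular_pow_prime_pow [Finite G] [Fact p.Prime] (x : G) :
    ∃ a : ℕ, IsPRegular p (x ^ p ^ a) := by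
  obtain ⟨a, m, hm, h⟩ := Nat.exists_eq_pow_mul_and_not_dvd (orderOf_pos x).ne' p
    (Fact.out : p.Prime).ne_one
  refine ⟨a, isPRegular_of_pow_eq_one (((Fact.out : p.Prime).coprime_iff_not_dvd).2 hm) ?_⟩
  rw [← pow_mul, ← h, pow_orderOf_eq_one]

theorem exists_isPRegular_pow_map_eq [Finite G] [Fact p.Prime] {Q : Type*} [Group Q] (f : G →* Q)
    (h : IsPRegular p (f x)) : ∃ k : ℕ, IsPRegular p (x ^ k) ∧ f (x ^ k) = f x := by
  obtain ⟨a, ha⟩ := exists_isPRegular_pow_prime_pow (p := p) x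
  obtain ⟨l, hl⟩ := h.exists_pow_pow_eq a
  exact ⟨p ^ a * l, by rw [pow_mul]; exact ha.pow l, by rw [map_pow, pow_mul, hl]⟩

theorem IsPNilpotent.mono {S T : Subgroup G} (hT : IsPNilpotent p T) (h : S ≤ T) :
    IsPNilpotent p S :=
  fun x hx y hy => hT x (h hx) y (h hy)

theorem IsPNilpotent.map [Finite G] [Fact p.Prime] {Q : Type*} [Group Q] {S : Subgroup G}
    (hS : IsPNilpotent p S) (f : G →* Q) : IsPNilpotent p (S.map f) := by
  rintro _ ⟨x, hx, rfl⟩ _ ⟨y, hy, rfl⟩ h1 h2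
  obtain ⟨k, hk, hk'⟩ := exists_isPRegular_pow_map_eq f h1
  obtain ⟨l, hl, hl'⟩ := exists_isPRegular_pow_map_eq f h2
  rw [← hk', ← hl', ← map_mul]
  exact (hS _ (S.pow_mem hx k) _ (S.pow_mem hy l) hk hl).map f

theorem IsPNilpotent.of_map_injective {Q : Type*} [Group Q] {S : Subgroup G} {f : G →* Q}
    (hf : Function.Injective f) (h : IsPNilpotent p (S.map f)) : IsPNilpotent p S :=
  fun x hx y hy h1 h2 => IsPRegular.of_map_injective hf (by
    rw [map_mul]
    exact h _ (Subgroup.mem_map_of_mem f hx) _ (Subgroup.mem_map_of_mem f hy) (h1.map f) (h2.map f))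

theorem IsPNilpotent.of_subtype [Finite G] [Fact p.Prime] {S : Subgroup G}
    (h : IsPNilpotent p (⊤ : Subgroup S)) : IsPNilpotent p S := by
  have := h.map S.subtype
  rwa [← MonoidHom.range_eq_map, Subgroup.range_subtype] at this

theorem IsPNilpotent.subgroupOf {S T : Subgroup G} (h : IsPNilpotent p S) :
    IsPNilpotent p (S.subgroupOf T) :=
  IsPNilpotent.of_map_injective (f := T.subtype) T.subtype_injective
    (h.mono (Subgroup.map_comap_le _ _))

/-- The normal `p`-complement. -/
def IsPNilpotent.complement {S : Subgroup G} (h : IsPNilpotent p S) : Subgroup G where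
  carrier := {x | x ∈ S ∧ IsPRegular p x}
  mul_mem' hx hy := ⟨S.mul_mem hx.1 hy.1, h _ hx.1 _ hy.1 hx.2 hy.2⟩
  one_mem' := ⟨S.one_mem, isPRegular_one⟩
  inv_mem' hx := ⟨S.inv_mem hx.1, hx.2.inv⟩

theorem not_dvd_card_of_forall_isPRegular [Finite G] [hp : Fact p.Prime] {M : Subgroup G}
    (hM : ∀ x ∈ M, IsPRegular p x) : ¬ p ∣ Nat.card M := fun hd => by
  obtain ⟨x, hx⟩ := exists_prime_orderOf_dvd_card' p hd
  have h1 := hM x x.2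
  rw [IsPRegular, Subgroup.orderOf_coe, hx, Nat.coprime_self] at h1
  exact hp.out.ne_one h1

theorem IsPNilpotent.commute {S D : Subgroup G} (h : IsPNilpotent p S) (hD : IsPGroup p D)
    (hDS : D ≤ S) (hn : ∀ s ∈ S, ∀ d ∈ D, s * d * s⁻¹ ∈ D) (hx : x ∈ S)
    (hxr : IsPRegular p x) {d : G} (hd : d ∈ D) : Commute x d := by
  have h1 : x * d * x⁻¹ * d⁻¹ ∈ D := D.mul_mem (hn x hx d hd) (D.inv_mem hd)
  have h2 : IsPRegular p (x * (d * x⁻¹ * d⁻¹)) :=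
    h x hx _ (S.mul_mem (S.mul_mem (hDS hd) (S.inv_mem hx)) (S.inv_mem (hDS hd))) hxr
      (hxr.inv.conj d)
  have h3 : x * (d * x⁻¹ * d⁻¹) = x * d * x⁻¹ * d⁻¹ := by group
  rw [h3] at h2
  have h4 := h2.eq_one_of_mem hD h1
  calc x * d = x * d * x⁻¹ * d⁻¹ * d * x := by group
    _ = d * x := by rw [h4, one_mul]

theorem isPRegular_mul_of_index_center [Finite G] [hp : Fact p.Prime]
    (h : ¬ p ∣ (Subgroup.center G).index) (hx : IsPRegular p x) (hy : IsPRegular p y) :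
    IsPRegular p (x * y) := by
  have hn : p.Coprime (Subgroup.center G).index := (hp.out.coprime_iff_not_dvd).2 h
  refine IsPRegular.of_pow hn ?_
  have hpow : ∀ g : G, g ^ (Subgroup.center G).index =
      (MonoidHom.transferCenterPow G g : G) := fun g => (MonoidHom.transferCenterPow_apply g).symm
  rw [hpow, map_mul, Subgroup.coe_mul, ← hpow, ← hpow]
  refine (hx.pow _).mul_of_commute (hy.pow _) ?_
  rw [hpow y]
  exact Subgroup.mem_center_iff.1 (MonoidHom.transferCenterPow G y).2 _

/-- If `S` is `p`-nilpotent modulo a normal subgroup centralized by all elements of `S` of order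
prime to `p`, then `S` is `p`-nilpotent. -/
theorem IsPNilpotent.of_map [Finite G] [hp : Fact p.Prime] {Q : Type*} [Group Q] {S : Subgroup G}
    (f : G →* Q) (h : IsPNilpotent p (S.map f))
    (hc : ∀ x ∈ S, IsPRegular p x → ∀ u ∈ f.ker, Commute x u) : IsPNilpotent p S := by
  have hmem : ∀ z ∈ S, IsPRegular p z →
      z ∈ Subgroup.centralizer (f.ker : Set G) ⊓ h.complement.comap f := fun z hz hzr =>
    ⟨Subgroup.mem_centralizer_iff.2 fun u hu => (hc z hz hzr u hu).symm,
      ⟨Subgroup.mem_map_of_mem f hz, hzr.map f⟩⟩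
  intro x hx y hy hxr hyr
  set E := Subgroup.centralizer (f.ker : Set G) ⊓ h.complement.comap f with hE
  let φ : E →* Q := f.comp E.subtype
  have h1 : ¬ p ∣ (Subgroup.center E).index := fun hd => by
    have h2 : φ.ker ≤ Subgroup.center E := fun u hu => by
      rw [Subgroup.mem_center_iff]
      intro e
      have hu : (u : G) ∈ f.ker := hu
      exact Subtype.ext (Subgroup.mem_centralizer_iff.1 e.2.1 u hu).symm
    have h3 := hd.trans (Subgroup.index_dvd_of_le h2)
    rw [Subgroup.index_ker] at h3
    have h5 : Finite (S.map f) := (Set.toFinite (S : Set G)).image f |>.to_subtype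
    have h6 : Finite φ.range := Set.finite_range φ |>.to_subtype
    obtain ⟨⟨_, e, rfl⟩, h4⟩ := exists_prime_orderOf_dvd_card' p h3
    rw [← Subgroup.orderOf_coe] at h4
    have h7 : IsPRegular p (φ e) := e.2.2.2
    rw [IsPRegular, h4, Nat.coprime_self] at h7
    exact hp.out.ne_one h7
  have h2 := isPRegular_mul_of_index_center h1
    (IsPRegular.of_map_injective (f := E.subtype) (x := (⟨x, hmem x hx hxr⟩ : E))
      E.subtype_injective hxr)
    (IsPRegular.of_map_injective (f := E.subtype) (x := (⟨y, hmem y hy hyr⟩ : E))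
      E.subtype_injective hyr)
  exact h2.map E.subtype

theorem isPNilpotent_top_of_isNilpotent (p : ℕ) [hp : Fact p.Prime] (G : Type*) [Group G] [Finite G]
    (h : Group.IsNilpotent G) : IsPNilpotent p (⊤ : Subgroup G) := by
  have key : ∀ (G : Type _) [Group G] [Group.IsNilpotent G],
      Finite G → IsPNilpotent p (⊤ : Subgroup G) := by
    intro G _ _
    refine Group.nilpotent_center_quotient_ind (P := fun G _ _ => Finite G →
      IsPNilpotent p (⊤ : Subgroup G)) G ?_ ?_
    · intro G _ _ _ x _ y _ _ _
      rw [Subsingleton.elim (x * y) 1]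
      exact isPRegular_one
    · intro G _ _ ih hG
      refine IsPNilpotent.of_map (QuotientGroup.mk' (Subgroup.center G)) ?_ ?_
      · exact (ih inferInstance).mono le_top
      · intro x _ _ u hu
        rw [QuotientGroup.ker_mk'] at hu
        exact Subgroup.mem_center_iff.1 hu x
  exact key G inferInstance

theorem isPNilpotent_of_isNilpotent [hp : Fact p.Prime] [Finite G] {S : Subgroup G}
    (h : Group.IsNilpotent S) : IsPNilpotent p S :=
  (isPNilpotent_top_of_isNilpotent p S h).of_subtype

end PRegular

section Frobenius

open scoped commutatorElement

variable {G : Type*} [Group G] {p : ℕ}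

theorem IsPGroup.lt_inf_normalizer [Finite G] [Fact p.Prime] {D P : Subgroup G}
    (hP : IsPGroup p P) (h : D < P) : D < P ⊓ Subgroup.normalizer (D : Set G) := by
  have hnil : Group.IsNilpotent P := hP.isNilpotent
  have h1 : D.subgroupOf P < ⊤ := by
    rw [lt_top_iff_ne_top, Ne, Subgroup.subgroupOf_eq_top]
    exact h.not_ge
  obtain ⟨_, x, hx, hxD⟩ := SetLike.lt_iff_le_and_exists.1
    (Group.normalizerCondition_of_isNilpotent _ h1)
  refine SetLike.lt_iff_le_and_exists.2 ⟨le_inf h.le Subgroup.le_normalizer, (x : G),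
    Subgroup.mem_inf.2 ⟨x.2, ?_⟩, hxD⟩
  rw [Subgroup.mem_normalizer_iff] at hx ⊢
  intro d
  constructor
  · intro hd
    exact (hx ⟨d, h.le hd⟩).1 hd
  · intro hd
    have h2 : d ∈ P := by
      have := P.mul_mem (P.mul_mem (P.inv_mem x.2) (h.le hd)) x.2
      have h3 : (x : G)⁻¹ * (x * d * (x : G)⁻¹) * x = d := by group
      rwa [h3] at this
    exact (hx ⟨d, h2⟩).2 hd

theorem IsPNilpotent.exists_isPRegular_mul_mem [Finite G] [hp : Fact p.Prime]
    (h : IsPNilpotent p (⊤ : Subgroup G)) (P : Sylow p G) (g : G) :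
    ∃ m, IsPRegular p m ∧ ∃ u ∈ P, g = m * u := by
  have hM : h.complement.Normal :=
    ⟨fun x hx g => ⟨Subgroup.mem_top _, hx.2.conj g⟩⟩
  have hq : IsPGroup p (G ⧸ h.complement) := by
    intro x
    obtain ⟨x, rfl⟩ := QuotientGroup.mk_surjective x
    obtain ⟨a, ha⟩ := exists_isPRegular_pow_prime_pow (p := p) x
    exact ⟨a, (QuotientGroup.eq_one_iff _).2 ⟨Subgroup.mem_top _, ha⟩⟩
  obtain ⟨n, hn⟩ := hq.exists_card_eq
  have h1 : (h.complement ⊔ P).index = 1 := by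
    refine Nat.eq_one_of_dvd_coprimes (Nat.Coprime.pow_left n
      ((hp.out.coprime_iff_not_dvd).2 P.not_dvd_index)) ?_
      (Subgroup.index_dvd_of_le (le_sup_right : (P : Subgroup G) ≤ h.complement ⊔ P))
    have := Subgroup.index_dvd_of_le (le_sup_left : h.complement ≤ h.complement ⊔ P)
    rwa [Subgroup.index_eq_card h.complement, hn] at this
  rw [Subgroup.index_eq_one] at h1
  obtain ⟨m, hm, u, hu, rfl⟩ :=
    Subgroup.mem_sup_of_normal_left.1 (h1.symm ▸ Subgroup.mem_top g : g ∈ h.complement ⊔ (P : Subgroup G))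
  exact ⟨m, hm.2, u, hu, rfl⟩

theorem IsPNilpotent.exists_isPRegular_smul_eq [Finite G] [hp : Fact p.Prime]
    (h : IsPNilpotent p (⊤ : Subgroup G)) (P Q : Sylow p G) :
    ∃ m : G, IsPRegular p m ∧ m • P = Q := by
  obtain ⟨g, rfl⟩ := MulAction.exists_smul_eq G P Q
  obtain ⟨m, hm, u, hu, rfl⟩ := h.exists_isPRegular_mul_mem P g
  refine ⟨m, hm, ?_⟩
  rw [mul_smul, Sylow.smul_eq_iff_mem_normalizer.2 (Subgroup.le_normalizer hu)]

theorem IsPNilpotent.commute_of_mem_normalizer [Finite G] [Fact p.Prime] {D : Subgroup G}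
    (hD : IsPGroup p D) (h : IsPNilpotent p (Subgroup.normalizer (D : Set G))) {x d : G}
    (hx : x ∈ Subgroup.normalizer (D : Set G)) (hxr : IsPRegular p x) (hd : d ∈ D) :
    Commute x d :=
  h.commute hD Subgroup.le_normalizer
    (fun _ hs d hd => (Subgroup.mem_normalizer_iff.1 hs d).1 hd) hx hxr hd

theorem IsPNilpotent.top_subtype {S : Subgroup G} (h : IsPNilpotent p S) :
    IsPNilpotent p (⊤ : Subgroup S) := by
  have := h.subgroupOf (T := S)
  rwa [Subgroup.subgroupOf_self] at this

theorem Sylow.mem_smul_iff {P : Sylow p G} {g x : G} : x ∈ g • P ↔ g⁻¹ * x * g ∈ P := by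
  change x ∈ ((g • P : Sylow p G) : Subgroup G) ↔ _
  rw [Sylow.coe_subgroup_smul, Subgroup.mem_pointwise_smul_iff_inv_smul_mem]
  simp [MulAut.smul_def]
  rfl

/-- Two Sylow subgroups are conjugate by an element centralizing their intersection, provided
that all `p`-local subgroups are `p`-nilpotent. -/
theorem exists_smul_eq_and_commute [Finite G] [hp : Fact p.Prime]
    (hloc : ∀ U : Subgroup G, U ≠ ⊥ → IsPGroup p U →
      IsPNilpotent p (Subgroup.normalizer (U : Set G))) (P Q : Sylow p G) :
    ∃ c : G, c • P = Q ∧ ∀ d ∈ (P : Subgroup G) ⊓ Q, Commute c d := by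
  induction hn : Nat.card G - Nat.card ((P : Subgroup G) ⊓ Q : Subgroup G) using Nat.strong_induction_on
    generalizing P Q with | _ n ih =>
  have hlt : ∀ A B : Subgroup G, A < B → Nat.card G - Nat.card B < Nat.card G - Nat.card A := by
    intro A B hAB
    have h1 : Nat.card A < Nat.card B := by
      rw [← SetLike.coe_ssubset_coe] at hAB
      exact Set.ncard_lt_ncard hAB
    have h2 := Subgroup.card_le_card_group B
    omega
  by_cases hPQ : P = Q
  · exact ⟨1, by rw [one_smul, hPQ], fun d _ => Commute.one_left d⟩
  obtain ⟨D, hD⟩ : ∃ D : Subgroup G, D = (P : Subgroup G) ⊓ Q := ⟨_, rfl⟩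
  rw [← hD] at hn ⊢
  by_cases hbot : D = ⊥
  · obtain ⟨g, hg⟩ := MulAction.exists_smul_eq G P Q
    refine ⟨g, hg, fun d hd => ?_⟩
    rw [hbot, Subgroup.mem_bot] at hd
    rw [hd]
    exact Commute.one_right g
  have hDp : IsPGroup p D := by
    rw [hD]
    exact P.2.to_le inf_le_left
  have hDP : D < P := by
    refine lt_of_le_of_ne (hD ▸ inf_le_left) fun h => hPQ ?_
    exact (Sylow.ext (P.3 Q.2 (h ▸ hD ▸ inf_le_right))).symm
  have hDQ : D < Q := by
    refine lt_of_le_of_ne (hD ▸ inf_le_right) fun h => hPQ ?_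
    exact Sylow.ext (Q.3 P.2 (h ▸ hD ▸ inf_le_left))
  have hN := hloc D hbot hDp
  obtain ⟨N, hNdef⟩ : ∃ N, N = Subgroup.normalizer (D : Set G) := ⟨_, rfl⟩
  have hP1 := P.2.lt_inf_normalizer hDP
  have hQ1 := Q.2.lt_inf_normalizer hDQ
  rw [← hNdef] at hP1 hQ1
  have hsub : ∀ S : Sylow p G, IsPGroup p (((S : Subgroup G) ⊓ N).subgroupOf N) := fun S =>
    (S.2.to_le inf_le_left).comap_of_injective _ N.subtype_injective
  obtain ⟨R1, hR1⟩ := (hsub P).exists_le_sylow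
  obtain ⟨R2, hR2⟩ := (hsub Q).exists_le_sylow
  obtain ⟨m, hm, rfl⟩ := (hNdef ▸ hN).top_subtype.exists_isPRegular_smul_eq R1 R2
  obtain ⟨R, hR⟩ := R1.exists_comap_subtype_eq
  have hPR : ((P : Subgroup G) ⊓ N) ≤ (P : Subgroup G) ⊓ R := by
    refine le_inf inf_le_left fun x hx => ?_
    have h1 : (⟨x, hx.2⟩ : N) ∈ (R1 : Subgroup N) := hR1 hx
    rw [← hR] at h1
    exact h1
  have hQR : ((Q : Subgroup G) ⊓ N) ≤ (((m : G) • R : Sylow p G) : Subgroup G) ⊓ Q := by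
    refine le_inf (fun x hx => ?_) inf_le_left
    have h1 : (⟨x, hx.2⟩ : N) ∈ m • R1 := hR2 hx
    rw [Sylow.mem_smul_iff] at h1
    have h1 : m⁻¹ * ⟨x, hx.2⟩ * m ∈ (R1 : Subgroup N) := h1
    rw [← hR] at h1
    exact Sylow.mem_smul_iff.2 h1
  obtain ⟨c1, hc1, hc1D⟩ := ih _ (hn ▸ hlt _ _ (hP1.trans_le hPR)) P R rfl
  obtain ⟨c2, hc2, hc2D⟩ := ih _ (hn ▸ hlt _ _ (hQ1.trans_le hQR)) ((m : G) • R) Q rfl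
  refine ⟨c2 * m * c1, by rw [mul_smul, mul_smul, hc1, hc2], fun d hd => ?_⟩
  refine ((hc2D d (hQR (hQ1.le hd))).mul_left ?_).mul_left (hc1D d (hPR (hP1.le hd)))
  exact hN.commute_of_mem_normalizer hDp (hNdef ▸ m.2) (hm.map N.subtype) hd

theorem exists_conj_eq_of_local [Finite G] [hp : Fact p.Prime]
    (hloc : ∀ U : Subgroup G, U ≠ ⊥ → IsPGroup p U →
      IsPNilpotent p (Subgroup.normalizer (U : Set G))) (P : Sylow p G)
    (hP : (P : Subgroup G) ≠ ⊥) {x g : G} (hx : x ∈ P) (hg : g * x * g⁻¹ ∈ P) :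
    ∃ u ∈ P, g * x * g⁻¹ = u * x * u⁻¹ := by
  obtain ⟨c, hc, hcD⟩ := exists_smul_eq_and_commute hloc P (g⁻¹ • P)
  have hcx : Commute c x := hcD x ⟨hx, Sylow.mem_smul_iff.2 (by rwa [inv_inv])⟩
  have hn : g * c ∈ Subgroup.normalizer (P : Set G) := by
    rw [← Sylow.smul_eq_iff_mem_normalizer, mul_smul, hc, smul_inv_smul]
  have hN := hloc P hP P.2
  obtain ⟨m, hm, u, hu, h⟩ := hN.top_subtype.exists_isPRegular_mul_mem
    (P.subtype Subgroup.le_normalizer) ⟨g * c, hn⟩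
  have hu' : (u : G) ∈ P := hu
  have h : g * c = m * u := congrArg Subtype.val h
  refine ⟨u, hu', ?_⟩
  have h1 : Commute (m : G) (u * x * (u : G)⁻¹) :=
    hN.commute_of_mem_normalizer P.2 m.2 (hm.map (Subgroup.subtype _))
      (P.mul_mem (P.mul_mem hu' hx) (P.inv_mem hu'))
  calc g * x * g⁻¹ = g * (x * c) * (g * c)⁻¹ := by group
    _ = g * c * x * (g * c)⁻¹ := by rw [← hcx.eq]; group
    _ = m * (u * x * (u : G)⁻¹) * (m : G)⁻¹ := by rw [h]; group
    _ = u * x * (u : G)⁻¹ := by rw [h1.eq]; group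

/-- Frobenius' criterion for `p`-nilpotency. -/
theorem isPNilpotent_of_local {G : Type} [Group G] [Finite G] [hp : Fact p.Prime]
    (hloc : ∀ U : Subgroup G, U ≠ ⊥ → IsPGroup p U →
      IsPNilpotent p (Subgroup.normalizer (U : Set G))) : IsPNilpotent p (⊤ : Subgroup G) := by
  induction hc : Nat.card G using Nat.strong_induction_on generalizing G with | _ n ih =>
  obtain ⟨P⟩ : Nonempty (Sylow p G) := inferInstance
  by_cases hP : (P : Subgroup G) = ⊥
  · intro x _ y _ _ _
    refine isPRegular_of_mem (p := p) (M := ⊤) (fun hd => ?_) (Subgroup.mem_top _)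
    rw [Subgroup.card_top] at hd
    exact P.ne_bot_of_dvd_card hd hP
  have hfoc : (P : Subgroup G).focalSubgroup ≤ ⁅(P : Subgroup G), (P : Subgroup G)⁆ := by
    rw [Subgroup.focalSubgroup_def, Subgroup.closure_le]
    rintro _ ⟨hg, x, hx, u, rfl⟩
    have h1 : u * x⁻¹ * u⁻¹ ∈ P := by
      have := P.mul_mem (P.inv_mem hx) hg
      rw [commutatorElement_def] at this
      have h2 : x⁻¹ * (x * u * x⁻¹ * u⁻¹) = u * x⁻¹ * u⁻¹ := by group
      rwa [h2] at this
    obtain ⟨v, hv, h2⟩ := exists_conj_eq_of_local hloc P hP (P.inv_mem hx) h1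
    have h3 : ⁅x, u⁆ = ⁅x, v⁆ := by
      rw [commutatorElement_def, commutatorElement_def]
      calc x * u * x⁻¹ * u⁻¹ = x * (u * x⁻¹ * u⁻¹) := by group
        _ = _ := by rw [h2]; group
    rw [h3]
    exact Subgroup.commutator_mem_commutator hx hv
  have hlt : (P : Subgroup G).focalSubgroup < P := by
    have hnt : Nontrivial (P : Subgroup G) := (Subgroup.nontrivial_iff_ne_bot _).2 hP
    have hnil : Group.IsNilpotent (P : Subgroup G) := P.2.isNilpotent
    have h1 := Group.IsSolvable.commutator_lt_top_of_nontrivial (P : Subgroup G)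
    refine hfoc.trans_lt ?_
    rw [← Subgroup.map_subtype_commutator]
    refine lt_of_le_of_ne (Subgroup.map_subtype_le _) fun h => h1.ne ?_
    refine Subgroup.map_injective (P : Subgroup G).subtype_injective ?_
    rw [h, ← MonoidHom.range_eq_map, Subgroup.range_subtype]
  obtain ⟨K, hK⟩ : ∃ K, K = (P : Subgroup G).transferFocal.ker := ⟨_, rfl⟩
  have hKtop : K ≠ ⊤ := fun h => by
    have := Subgroup.ker_transferFocal_inf_eq_focalSubgroup P
    rw [← hK, h, top_inf_eq] at this
    exact hlt.ne this.symm
  have hreg : ∀ x : G, IsPRegular p x → x ∈ K := by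
    intro x hx
    rw [hK, MonoidHom.mem_ker]
    have h1 : IsPGroup p (⊤ : Subgroup ((P : Subgroup G) ⧸ (P : Subgroup G).focalSubgroupOf)) :=
      (P.2.to_quotient _).to_subgroup _
    exact (hx.map _).eq_one_of_mem h1 (Subgroup.mem_top _)
  have hKlt : Nat.card K < n := by
    rw [← hc]
    exact lt_of_le_of_ne (Subgroup.card_le_card_group K) fun h =>
      hKtop (Subgroup.eq_top_of_card_eq _ h)
  have hKn : IsPNilpotent p (⊤ : Subgroup K) := by
    refine ih _ hKlt (fun U hU hUp => ?_) rfl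
    refine IsPNilpotent.of_map_injective (f := K.subtype) K.subtype_injective
      ((hloc (U.map K.subtype) ?_ (hUp.map _)).mono ?_)
    · rwa [Ne, Subgroup.map_eq_bot_iff_of_injective _ K.subtype_injective]
    · exact Subgroup.le_normalizer_map K.subtype
  intro x _ y _ hx hy
  exact hKn.of_subtype x (hreg x hx) y (hreg y hy) hx hy

end Frobenius

section Quadratic

theorem eq_zero_of_two_mul_eq_zero {R : Type*} [Ring R] {p : ℕ} [hp : Fact p.Prime] [CharP R p]
    (hp2 : p ≠ 2) {x : R} (h : x + x = 0) : x = 0 := by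
  obtain ⟨k, hk⟩ := hp.out.odd_of_ne_two hp2
  have h1 : (p : R) * x = 0 := by rw [CharP.cast_eq_zero, zero_mul]
  rw [hk] at h1
  push_cast at h1
  have h2 : (2 * (k : R) + 1) * x = (k : R) * (x + x) + x := by noncomm_ring
  rwa [h2, h, mul_zero, zero_add] at h1

/-- An automorphism acting quadratically, in odd characteristic, commutes with every commuting set
of operators of finite order prime to the characteristic that it normalizes. -/
theorem commute_of_quadratic {R : Type*} [Ring R] {p : ℕ} [hp : Fact p.Prime] [CharP R p]
    (hp2 : p ≠ 2) {a a' : R} (h1 : a * a' = 1) (hα : (a - 1) * (a - 1) = 0) (T : Submonoid R)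
    (hT : ∀ x ∈ T, ∀ y ∈ T, Commute x y) {m : ℕ} (hm : m ≠ 0) (hq : ∀ x ∈ T, x ^ p ^ m = x)
    (hc : ∀ x ∈ T, a * x * a' ∈ T) (hc' : ∀ x ∈ T, a' * x * a ∈ T) {w : R} (hw : w ∈ T) :
    Commute a w := by
  obtain ⟨α, rfl⟩ : ∃ α, a = 1 + α := ⟨a - 1, by abel⟩
  rw [add_sub_cancel_left] at hα
  have ha' : a' = 1 - α := by
    calc a' = (1 - α * α) * a' := by rw [hα, sub_zero, one_mul]
      _ = (1 - α) * ((1 + α) * a') := by noncomm_ring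
      _ = 1 - α := by rw [h1, mul_one]
  subst ha'
  have hq2 : 2 ≤ p ^ m := hp.out.two_le.trans (Nat.le_self_pow hm p)
  have hred : ∀ u : R, u ^ p ^ m = u → u * u = 0 → u = 0 := by
    intro u hu h
    rw [← hu]
    exact pow_eq_zero_of_le hq2 (by rw [pow_two, h])
  have key : ∀ w ∈ T, α * w * α = 0 := by
    intro w hw
    have hx := hc' w hw
    have hy := hc w hw
    have hxy := hT _ hx _ hy
    have hxw := hT _ hx _ hw
    have hyw := hT _ hy _ hw
    have hu : (1 - α) * w * (1 + α) + (1 + α) * w * (1 - α) - (w + w) =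
        -(α * w * α + α * w * α) := by noncomm_ring
    refine eq_zero_of_two_mul_eq_zero (p := p) hp2 (neg_eq_zero.1 (hu ▸ hred _ ?_ ?_))
    · have c1 := hxw.add_left hyw
      rw [sub_pow_char_pow_of_commute _ _ (c1.add_right c1), add_pow_char_pow_of_commute _ _ hxy,
        add_pow_char_pow_of_commute _ _ (Commute.refl w), hq _ hx, hq _ hy, hq _ hw]
    · rw [hu]
      have h2 : -(α * w * α + α * w * α) * -(α * w * α + α * w * α) =
          4 * (α * w * (α * α) * w * α) := by noncomm_ring
      rw [h2, hα]
      noncomm_ring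
  have hδ : (1 - α) * w * (1 + α) - w = w * α - α * w := by
    calc (1 - α) * w * (1 + α) - w = w * α - α * w - α * w * α := by noncomm_ring
      _ = _ := by rw [key w hw, sub_zero]
  have h0 : w * α - α * w = 0 := by
    refine hδ ▸ hred _ ?_ ?_
    · rw [sub_pow_char_pow_of_commute _ _ (hT _ (hc' w hw) _ hw), hq _ (hc' w hw), hq _ hw]
    · rw [hδ]
      have h2 : (w * α - α * w) * (w * α - α * w) =
          w * (α * w * α) - w * (α * α) * w - α * (w * w) * α + α * w * α * w := by noncomm_ring
      rw [h2, key w hw, key _ (T.mul_mem hw hw), hα]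
      noncomm_ring
  have h3 : w * α = α * w := sub_eq_zero.1 h0
  change (1 + α) * w = w * (1 + α)
  rw [add_mul, mul_add, h3, one_mul, mul_one]

end Quadratic

section Averaging

open Finset

/-- Suppose that an elementary abelian group `A` acts on a commutative group `M` of exponent prime
to `p`, and that all subgroups properly containing `B` have the same fixed points as `A`. If the
index of `B` exceeds `p`, then `B` has the same fixed points as `A`. -/
theorem fixed_of_forall_lt_fixed {A M : Type*} [CommGroup A] [CommGroup M] {p : ℕ}
    [hp : Fact p.Prime] (θ : A →* MulAut M) (hA : ∀ a : A, a ^ p = 1)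
    (hM : ∀ m : M, IsPRegular p m) (B : Subgroup A)
    (hB : ∀ B' : Subgroup A, B < B' → ∀ m, (∀ b ∈ B', θ b m = m) → ∀ a, θ a m = m)
    {a b : A} (hb : b ∉ B) (hab : ∀ i : ℕ, a * b ^ i ∉ B)
    {y : M} (hy : ∀ b ∈ B, θ b y = y) (c : A) : θ c y = y := by
  have hval : ∀ (x : A) (n : ℕ), x ^ ((n : ZMod p)).val = x ^ n := by
    intro x n
    rw [ZMod.val_natCast]
    conv_rhs => rw [← Nat.mod_add_div n p, pow_add, pow_mul x p, hA, one_pow, mul_one]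
  let F : Subgroup M :=
    { carrier := {m | ∀ c, θ c m = m}
      mul_mem' := fun hx hy c => by rw [map_mul, hx c, hy c]
      one_mem' := fun c => map_one _
      inv_mem' := fun hx c => by rw [map_inv, hx c] }
  have hθ : ∀ c d m, θ c (θ d m) = θ (c * d) m := fun c d m => by rw [map_mul]; rfl
  have hFθ : ∀ m ∈ F, ∀ d, θ d m ∈ F := fun m hm d c => by
    rw [hθ, mul_comm, ← hθ, hm]
  have hnorm : ∀ c ∉ B, ∏ j : ZMod p, θ (c ^ j.val) y ∈ F := by
    intro c hc
    let S : Subgroup A :=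
      { carrier := {d | θ d (∏ j : ZMod p, θ (c ^ j.val) y) = ∏ j : ZMod p, θ (c ^ j.val) y}
        mul_mem' := fun {d e} hd he => by
          have hd : θ d _ = _ := hd
          have he : θ e _ = _ := he
          change θ (d * e) _ = _
          rw [← hθ, he, hd]
        one_mem' := by
          change θ 1 _ = _
          rw [map_one]
          rfl
        inv_mem' := fun {d} hd => by
          have hd : θ d _ = _ := hd
          change θ d⁻¹ _ = _
          conv_lhs => rw [← hd]
          rw [hθ, inv_mul_cancel, map_one]
          rfl }
    have hBS : B ≤ S := fun d hd => by
      change θ d _ = _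
      rw [map_prod]
      refine prod_congr rfl fun j _ => ?_
      rw [hθ, mul_comm, ← hθ, hy d hd]
    have hcS : c ∈ S := by
      change θ c _ = _
      rw [map_prod]
      refine Fintype.prod_equiv (Equiv.addRight 1) _ _ fun j => ?_
      have h1 : j + 1 = ((j.val + 1 : ℕ) : ZMod p) := by
        push_cast
        rw [ZMod.natCast_zmod_val]
      change _ = θ (c ^ (j + 1).val) y
      rw [hθ, h1, hval, pow_succ']
    refine hB (B ⊔ Subgroup.zpowers c) ?_ _ fun b hb => ?_
    · refine lt_of_le_of_ne le_sup_left fun h => hc ?_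
      rw [h]
      exact (le_sup_right : Subgroup.zpowers c ≤ _) (Subgroup.mem_zpowers c)
    · exact (sup_le hBS ((Subgroup.zpowers_le).2 hcS)) hb
  have h1 : ∏ i : ZMod p, ∏ j : ZMod p, θ ((a * b ^ i.val) ^ j.val) y ∈ F :=
    F.prod_mem fun i _ => hnorm _ (hab _)
  rw [prod_comm, ← mul_prod_erase univ _ (mem_univ (0 : ZMod p))] at h1
  have h2 : ∏ i : ZMod p, θ ((a * b ^ i.val) ^ (0 : ZMod p).val) y = y ^ p := by
    simp [ZMod.card]
  have h3 : ∏ j ∈ univ.erase (0 : ZMod p), ∏ i : ZMod p, θ ((a * b ^ i.val) ^ j.val) y ∈ F := by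
    refine F.prod_mem fun j hj => ?_
    have hj : j ≠ 0 := (mem_erase.1 hj).1
    have h4 : ∏ i : ZMod p, θ ((a * b ^ i.val) ^ j.val) y =
        θ (a ^ j.val) (∏ i : ZMod p, θ (b ^ i.val) y) := by
      rw [map_prod]
      refine Fintype.prod_equiv (Equiv.mulRight₀ j hj) _ _ fun i => ?_
      have h5 : i * j = ((i.val * j.val : ℕ) : ZMod p) := by
        push_cast
        rw [ZMod.natCast_zmod_val, ZMod.natCast_zmod_val]
      change _ = θ (a ^ j.val) (θ (b ^ (i * j).val) y)
      rw [hθ, h5, hval, mul_pow, pow_mul]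
    rw [h4]
    exact hFθ _ (hnorm b hb) _
  rw [h2] at h1
  have h6 : y ^ p ∈ F := by
    have := F.mul_mem h1 (F.inv_mem h3)
    rwa [mul_inv_cancel_right] at this
  obtain ⟨l, hl⟩ := (hM y).exists_pow_pow_eq 1
  rw [pow_one] at hl
  rw [← hl]
  exact F.pow_mem h6 l c

end Averaging

section Replacement

variable {A M W : Type*} [CommGroup A] [CommGroup M] [AddCommGroup W] {p : ℕ}
  [hp : Fact p.Prime] [Module (ZMod p) W]

/-- The vectors fixed by `B`. -/
def fixedVectors (σ : A →* Module.End (ZMod p) W) (B : Subgroup A) : Submodule (ZMod p) W where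
  carrier := {w | ∀ b ∈ B, σ b w = w}
  add_mem' hx hy b hb := by rw [map_add, hx b hb, hy b hb]
  zero_mem' b _ := map_zero _
  smul_mem' c x hx b hb := by rw [map_smul, hx b hb]

theorem charP_moduleEnd (p : ℕ) [Fact p.Prime] (W : Type*) [AddCommGroup W] [Module (ZMod p) W]
    [Nontrivial W] : CharP (Module.End (ZMod p) W) p :=
  charP_of_injective_algebraMap
    (FaithfulSMul.algebraMap_injective (ZMod p) (Module.End (ZMod p) W)) p

theorem apply_mem_fixedVectors (σ : A →* Module.End (ZMod p) W) {B : Subgroup A} (a : A) {w : W}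
    (hw : w ∈ fixedVectors σ B) : σ a w ∈ fixedVectors σ B := fun b hb => by
  have h : σ b * σ a = σ a * σ b := by rw [← map_mul, ← map_mul, mul_comm]
  have h1 : σ b (σ a w) = σ a (σ b w) := LinearMap.congr_fun h w
  rw [h1, hw b hb]

theorem quadratic_of_card_fixedVectors [Finite W] (σ : A →* Module.End (ZMod p) W)
    (hA : ∀ a : A, a ^ p = 1) {B : Subgroup A}
    (hcard : Nat.card (fixedVectors σ B) ≤ p * Nat.card (fixedVectors σ ⊤)) (a : A) {w : W}
    (hw : w ∈ fixedVectors σ B) : (σ a - 1) ((σ a - 1) w) = 0 := by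
  rcases subsingleton_or_nontrivial W with hs | hs
  · exact Subsingleton.elim _ _
  have hch := charP_moduleEnd p W
  have hf : (σ a - 1) ^ p = 0 := by
    rw [sub_pow_char_of_commute _ (Commute.one_right _), ← map_pow, hA, map_one, one_pow,
      sub_self]
  obtain ⟨f, hfd⟩ : ∃ f, f = σ a - 1 := ⟨_, rfl⟩
  rw [← hfd] at hf ⊢
  have hfix : ∀ u ∈ fixedVectors σ ⊤, f u = 0 := by
    intro u hu
    rw [hfd, LinearMap.sub_apply, hu a (Subgroup.mem_top a), Module.End.one_apply, sub_self]
  by_cases hv : f w ∈ fixedVectors σ ⊤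
  · exact hfix _ hv
  have hfB : f w ∈ fixedVectors σ B := by
    rw [hfd, LinearMap.sub_apply]
    exact Submodule.sub_mem _ (apply_mem_fixedVectors σ a hw) hw
  have hle : fixedVectors σ ⊤ ≤ fixedVectors σ B := fun u hu b _ => hu b (Subgroup.mem_top b)
  have hlt : fixedVectors σ ⊤ < fixedVectors σ ⊤ ⊔ Submodule.span (ZMod p) {f w} :=
    lt_of_le_of_ne le_sup_left fun h => hv (h ▸ (le_sup_right :
      Submodule.span (ZMod p) {f w} ≤ _) (Submodule.mem_span_singleton_self _))
  have hfin : Module.Finite (ZMod p) W := Module.Finite.of_finite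
  have h1 := Submodule.finrank_lt_finrank_of_lt hlt
  have h2 : Module.finrank (ZMod p) (fixedVectors σ B) ≤
      Module.finrank (ZMod p) (fixedVectors σ ⊤) + 1 := by
    rw [Module.natCard_eq_pow_finrank (K := ZMod p), Module.natCard_eq_pow_finrank (K := ZMod p)
      (V := fixedVectors σ ⊤), Nat.card_zmod, ← pow_succ'] at hcard
    exact (Nat.pow_le_pow_iff_right hp.out.one_lt).1 hcard
  have h3 : fixedVectors σ ⊤ ⊔ Submodule.span (ZMod p) {f w} = fixedVectors σ B :=
    Submodule.eq_of_le_of_finrank_le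
      (sup_le hle ((Submodule.span_singleton_le_iff_mem _ _).2 hfB)) (by omega)
  rw [← h3] at hw
  obtain ⟨u, hu, x, hx, hux⟩ := Submodule.mem_sup.1 hw
  obtain ⟨k, rfl⟩ := Submodule.mem_span_singleton.1 hx
  have h4 : f w = k • f (f w) := by
    conv_lhs => rw [← hux]
    rw [map_add, hfix u hu, zero_add, map_smul]
  have h5 : ∀ n : ℕ, f w = k ^ n • (f ^ n) (f w) := by
    intro n
    induction n with
    | zero => simp
    | succ n ih =>
      conv_lhs => rw [ih, h4]
      rw [map_smul, smul_smul, pow_succ, pow_succ]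
      rfl
  have h6 := h5 p
  rw [hf, LinearMap.zero_apply, smul_zero] at h6
  rw [h6, map_zero]

/-- An operator of order prime to `p` commuting with a `p`-group `B` and trivial on the vectors
fixed by `B` is trivial. -/
theorem eq_one_of_trivial_on_fixedVectors [Finite A] [Finite W] (σ : A →* Module.End (ZMod p) W)
    {B : Subgroup A} (hB : IsPGroup p B) {z : Module.End (ZMod p) W} {n : ℕ} (hn : p.Coprime n)
    (hz : z ^ n = 1) (hc : ∀ b ∈ B, Commute (σ b) z) (hzw : ∀ w ∈ fixedVectors σ B, z w = w) :
    z = 1 := by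
  have hzero : ∀ w, z w - w ∈ fixedVectors σ B → z w - w = 0 := by
    intro w hw
    have h1 : ∀ k : ℕ, (z ^ k) w = w + (k : ZMod p) • (z w - w) := by
      intro k
      induction k with
      | zero => simp
      | succ k ih =>
        rw [pow_succ', Module.End.mul_apply, ih, map_add, map_smul, hzw _ hw]
        push_cast
        rw [add_smul, one_smul]
        abel
    have h2 := h1 n
    rw [hz, Module.End.one_apply, left_eq_add, smul_eq_zero] at h2
    refine h2.resolve_left fun h => ?_
    rw [ZMod.natCast_eq_zero_iff] at h
    exact ((hp.out.coprime_iff_not_dvd).1 hn) h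
  obtain ⟨X, hX⟩ : ∃ X, X = LinearMap.range (z - 1) := ⟨_, rfl⟩
  have hXmem : ∀ w, w ∈ X ↔ ∃ v, z v - v = w := fun w => by
    rw [hX, LinearMap.mem_range]
    rfl
  have hstab : ∀ b : B, ∀ x ∈ X, σ b x ∈ X := by
    intro b x hx
    obtain ⟨v, rfl⟩ := (hXmem _).1 hx
    have h1 : σ b (z v) = z (σ b v) := LinearMap.congr_fun (hc b b.2).eq v
    exact (hXmem _).2 ⟨σ b v, by rw [map_sub, h1]⟩
  by_contra hne
  have hbot : ¬ Subsingleton X := fun hs => hne <| LinearMap.ext fun w => by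
    have h1 := Subsingleton.elim (⟨z w - w, (hXmem _).2 ⟨w, rfl⟩⟩ : X) 0
    exact sub_eq_zero.1 (congrArg Subtype.val h1)
  rw [not_subsingleton_iff_nontrivial] at hbot
  let act : MulAction B X :=
    { smul := fun b x => ⟨σ b x, hstab b x x.2⟩
      one_smul := fun x => Subtype.ext (by
        change σ ((1 : B) : A) x = x
        rw [Subgroup.coe_one, map_one]
        rfl)
      mul_smul := fun b c x => Subtype.ext (by
        change σ ((b * c : B) : A) x = σ b (σ c x)
        rw [Subgroup.coe_mul, map_mul]
        rfl) }
  have hdvd : p ∣ Nat.card X := by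
    rw [Module.natCard_eq_pow_finrank (K := ZMod p), Nat.card_zmod]
    exact dvd_pow_self p Module.finrank_pos.ne'
  obtain ⟨x, hx, hx0⟩ := hB.exists_fixed_point_of_prime_dvd_card_of_fixed_point X hdvd
    (a := 0) (fun b => Subtype.ext (map_zero (σ b)))
  obtain ⟨v, hv⟩ := (hXmem _).1 x.2
  have h3 : (x : W) ∈ fixedVectors σ B := fun b hb =>
    congrArg Subtype.val (hx ⟨b, hb⟩)
  refine hx0 (Subtype.ext ?_)
  rw [← hv] at h3 ⊢
  exact (hzero v h3).symm

/-- Thompson replacement in the form of a fixed point theorem: an elementary abelian group `A`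
satisfying the counting inequality centralizes each commutative group of operators of order prime
to `p` that it normalizes. -/
theorem fixed_of_card_fixedVectors [Finite A] [Finite M] [Finite W] (hp2 : p ≠ 2)
    (hA : ∀ a : A, a ^ p = 1) (hM : ∀ m : M, IsPRegular p m)
    (σ : A →* Module.End (ZMod p) W) (τ : M →* Module.End (ZMod p) W)
    (hτ : Function.Injective τ) (θ : A →* MulAut M)
    (hθ : ∀ a m, σ a * τ m = τ (θ a m) * σ a)
    (hcount : ∀ B : Subgroup A, Nat.card B * Nat.card (fixedVectors σ B) ≤
      Nat.card A * Nat.card (fixedVectors σ ⊤)) (a : A) (m : M) : θ a m = m := by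
  by_contra hne
  obtain ⟨B, hB, hmax⟩ := (Set.toFinite {B : Subgroup A |
    ∃ y, (∀ b ∈ B, θ b y = y) ∧ ∃ a, θ a y ≠ y}).exists_maximal
    ⟨⊥, m, fun b hb => by rw [Subgroup.mem_bot.1 hb, map_one]; rfl, a, hne⟩
  obtain ⟨y, hyB, a, hay⟩ := hB
  refine hay ?_
  have hmax : ∀ B' : Subgroup A, B < B' → ∀ m, (∀ b ∈ B', θ b m = m) → ∀ a, θ a m = m := by
    intro B' hlt m hm a
    by_contra h
    exact hlt.not_ge (hmax ⟨m, hm, a, h⟩ hlt.le)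
  have hθθ : ∀ c d m, θ c (θ d m) = θ (c * d) m := fun c d m => by rw [map_mul]; rfl
  have hBp : IsPGroup p B := fun b => ⟨1, Subtype.ext (by rw [pow_one]; exact hA b)⟩
  have hindex : Nat.card A ≤ p * Nat.card B := by
    have h0 : ∃ b, b ∉ B := by
      by_contra! h
      exact hay (hyB a (h a))
    obtain ⟨b, hb⟩ := h0
    have h1 : B ⊔ Subgroup.zpowers b = ⊤ := by
      by_contra h
      obtain ⟨c, hc⟩ : ∃ c, c ∉ B ⊔ Subgroup.zpowers b := by
        by_contra! h'
        exact h ((Subgroup.eq_top_iff' _).2 h')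
      refine hay (fixed_of_forall_lt_fixed θ hA hM B hmax hb (a := c) (fun i hi => hc ?_) hyB a)
      have h2 : b ^ i ∈ B ⊔ Subgroup.zpowers b := Subgroup.pow_mem _
        ((le_sup_right : Subgroup.zpowers b ≤ _) (Subgroup.mem_zpowers b)) i
      have h3 := Subgroup.mul_mem _ ((le_sup_left : B ≤ B ⊔ Subgroup.zpowers b) hi)
        (Subgroup.inv_mem _ h2)
      rwa [mul_inv_cancel_right] at h3
    have h2 : B.index ≤ p := by
      rw [← Subgroup.relIndex_top_right, ← h1, Subgroup.relIndex_sup_left]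
      refine (Nat.le_of_dvd Nat.card_pos (Subgroup.relIndex_dvd_card _ _)).trans ?_
      rw [Nat.card_zpowers]
      exact Nat.le_of_dvd hp.out.pos (orderOf_dvd_of_pow_eq_one (hA b))
    rw [← B.card_mul_index, mul_comm]
    exact Nat.mul_le_mul_right _ h2
  have hcard : Nat.card (fixedVectors σ B) ≤ p * Nat.card (fixedVectors σ ⊤) := by
    have h1 := (hcount B).trans (Nat.mul_le_mul_right _ hindex)
    rw [mul_comm p, mul_assoc] at h1
    exact Nat.le_of_mul_le_mul_left h1 Nat.card_pos
  have hσσ : ∀ w, σ a (σ a⁻¹ w) = w := fun w => by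
    rw [← Module.End.mul_apply, ← map_mul, mul_inv_cancel, map_one, Module.End.one_apply]
  have hYW : ∀ y : M, (∀ b ∈ B, θ b y = y) → ∀ w ∈ fixedVectors σ B, τ y w ∈ fixedVectors σ B := by
    intro y hy w hw b hb
    have h1 : σ b (τ y w) = τ (θ b y) (σ b w) := LinearMap.congr_fun (hθ b y) w
    rw [h1, hy b hb, hw b hb]
  let T : Submonoid (Module.End (ZMod p) (fixedVectors σ B)) :=
    { carrier := {x | ∃ y : M, (∀ b ∈ B, θ b y = y) ∧ ∀ w, (x w : W) = τ y w}
      mul_mem' := by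
        rintro x x' ⟨y, hy, hxy⟩ ⟨y', hy', hxy'⟩
        refine ⟨y * y', fun b hb => by rw [map_mul, hy b hb, hy' b hb], fun w => ?_⟩
        rw [map_mul, Module.End.mul_apply, Module.End.mul_apply, hxy, hxy']
      one_mem' := ⟨1, fun b _ => map_one _, fun w => by rw [map_one]; rfl⟩ }
  have hconj : ∀ (c c' : A), c * c' = 1 → ∀ x ∈ T,
      (σ c).restrict (fun w hw => apply_mem_fixedVectors σ (B := B) c hw) * x *
        (σ c').restrict (fun w hw => apply_mem_fixedVectors σ (B := B) c' hw) ∈ T := by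
    rintro c c' hcc x ⟨y, hy, hxy⟩
    refine ⟨θ c y, fun b hb => ?_, fun w => ?_⟩
    · rw [hθθ, mul_comm, ← hθθ, hy b hb]
    · change σ c (x _ : W) = _
      rw [hxy]
      change σ c (τ y (σ c' w)) = _
      have h1 : σ c (τ y (σ c' w)) = τ (θ c y) (σ c (σ c' w)) :=
        LinearMap.congr_fun (hθ c y) _
      rw [h1, ← Module.End.mul_apply (σ c), ← map_mul, hcc, map_one, Module.End.one_apply]
  have hMcop : p.Coprime (Nat.card M) := (hp.out.coprime_iff_not_dvd).2 fun h => by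
    obtain ⟨x, hx⟩ := exists_prime_orderOf_dvd_card' p h
    have h1 := hM x
    rw [IsPRegular, hx, Nat.coprime_self] at h1
    exact hp.out.ne_one h1
  have hMpow : ∀ y : M, y ^ p ^ (Nat.card M).totient = y := fun y => by
    conv_rhs => rw [← pow_one y]
    rw [← pow_mod_natCard, Nat.ModEq.pow_totient hMcop, pow_mod_natCard]
  have hcomm : ∀ w ∈ fixedVectors σ B, σ a (τ y w) = τ y (σ a w) := by
    intro w hw
    rcases subsingleton_or_nontrivial (fixedVectors σ B) with hs | hs
    · have h1 : w = 0 := congrArg Subtype.val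
        (Subsingleton.elim (⟨w, hw⟩ : fixedVectors σ B) 0)
      rw [h1, map_zero, map_zero, map_zero]
    have hch := charP_moduleEnd p (fixedVectors σ B)
    have key := commute_of_quadratic (p := p) hp2
      (a := (σ a).restrict fun w hw => apply_mem_fixedVectors σ (B := B) a hw)
      (a' := (σ a⁻¹).restrict fun w hw => apply_mem_fixedVectors σ (B := B) a⁻¹ hw)
      (LinearMap.ext fun w => Subtype.ext (hσσ w))
      (LinearMap.ext fun w => Subtype.ext (quadratic_of_card_fixedVectors σ hA hcard a w.2)) T
      ?_ (Nat.totient_pos.2 (Nat.card_pos (α := M))).ne' ?_ (hconj a a⁻¹ (mul_inv_cancel a))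
      (hconj a⁻¹ a (inv_mul_cancel a))
      (w := (τ y).restrict (hYW y hyB)) ⟨y, hyB, fun w => rfl⟩
    · exact congrArg Subtype.val (LinearMap.congr_fun key.eq ⟨w, hw⟩)
    · rintro x ⟨y, hy, hxy⟩ x' ⟨y', hy', hxy'⟩
      refine LinearMap.ext fun w => Subtype.ext ?_
      change (x (x' w) : W) = x' (x w)
      rw [hxy, hxy', hxy', hxy, ← Module.End.mul_apply, ← map_mul, mul_comm, map_mul]
      rfl
    · rintro x ⟨y, hy, hxy⟩
      have h1 : ∀ (k : ℕ) w, ((x ^ k) w : W) = τ (y ^ k) w := by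
        intro k
        induction k with
        | zero => intro w; rw [pow_zero, pow_zero, map_one]; rfl
        | succ k ih =>
          intro w
          rw [pow_succ, pow_succ, map_mul, Module.End.mul_apply, Module.End.mul_apply, ih, hxy]
      exact LinearMap.ext fun w => Subtype.ext (by rw [h1, hMpow, hxy])
  have hz : y⁻¹ * θ a y = 1 := by
    refine hτ ?_
    rw [map_one]
    refine eq_one_of_trivial_on_fixedVectors σ hBp (hM (y⁻¹ * θ a y)) ?_ ?_ ?_
    · rw [← map_pow, pow_orderOf_eq_one, map_one]
    · intro b hb
      have h1 := hθ b (y⁻¹ * θ a y)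
      rwa [map_mul (θ b), map_inv, hyB b hb, hθθ, mul_comm b a, ← hθθ, hyB b hb] at h1
    · intro w hw
      have hw' := apply_mem_fixedVectors σ a⁻¹ hw
      have h1 : σ a (τ y (σ a⁻¹ w)) = τ (θ a y) (σ a (σ a⁻¹ w)) :=
        LinearMap.congr_fun (hθ a y) _
      rw [hcomm _ hw', hσσ] at h1
      rw [map_mul, Module.End.mul_apply, ← h1, ← Module.End.mul_apply, ← map_mul, inv_mul_cancel,
        map_one, Module.End.one_apply]
  exact (inv_mul_eq_one.1 hz).symm

end Replacement

section Linearization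

variable {G : Type*} [Group G] {p : ℕ}

/-- Automorphisms of an elementary abelian group as linear maps. -/
def mulAutToModuleEnd (p : ℕ) (V : Type*) [CommGroup V] [Module (ZMod p) (Additive V)] :
    MulAut V →* Module.End (ZMod p) (Additive V) where
  toFun f := f.toMonoidHom.toAdditive.toZModLinearMap p
  map_one' := LinearMap.ext fun _ => rfl
  map_mul' _ _ := LinearMap.ext fun _ => rfl

theorem mulAutToModuleEnd_injective (p : ℕ) (V : Type*) [CommGroup V]
    [Module (ZMod p) (Additive V)] : Function.Injective (mulAutToModuleEnd p V) :=
  fun _ _ h => MulEquiv.ext fun x => LinearMap.congr_fun h (Additive.ofMul x)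

open scoped IsMulCommutative in
theorem map_mul_comm_of_card [Finite G] [hp : Fact p.Prime] (hp2 : p ≠ 2)
    {V : Type*} [CommGroup V] [Finite V] [Module (ZMod p) (Additive V)] (f : G →* MulAut V)
    {E A : Subgroup G} [E.Normal]
    (hA : ∀ x ∈ A, ∀ y ∈ A, Commute x y) (hAp : ∀ x ∈ A, x ^ p = 1)
    (hE : ∀ x ∈ E, ∀ y ∈ E, f (x * y) = f (y * x))
    (hreg : ∀ y ∈ E, ∃ k : ℕ, IsPRegular p (y ^ k) ∧ f (y ^ k) = f y)
    (hcount : ∀ B ≤ A, Nat.card B * Nat.card {v : V // ∀ b ∈ B, f b v = v} ≤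
      Nat.card A * Nat.card {v : V // ∀ b ∈ A, f b v = v})
    {a y : G} (ha : a ∈ A) (hy : y ∈ E) : f (a * y) = f (y * a) := by
  have hAc : IsMulCommutative A := ⟨⟨fun x y => Subtype.ext (hA x x.2 y y.2)⟩⟩
  obtain ⟨lin, hlind⟩ : ∃ lin, lin = mulAutToModuleEnd p V := ⟨_, rfl⟩
  obtain ⟨M, hM⟩ : ∃ M, M = E.map f := ⟨_, rfl⟩
  have hMc : IsMulCommutative M := by
    refine ⟨⟨?_⟩⟩
    rintro ⟨_, hx'⟩ ⟨_, hy'⟩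
    obtain ⟨x, hx, rfl⟩ := hM ▸ hx'
    obtain ⟨y, hy, rfl⟩ := hM ▸ hy'
    refine Subtype.ext ?_
    change f x * f y = f y * f x
    rw [← map_mul, ← map_mul]
    exact hE x hx y hy
  have hMreg : ∀ m : M, IsPRegular p m := by
    rintro ⟨_, hm⟩
    obtain ⟨y, hy, rfl⟩ := hM ▸ hm
    obtain ⟨k, hk, hk'⟩ := hreg y hy
    refine IsPRegular.of_map_injective (f := M.subtype) M.subtype_injective ?_
    change IsPRegular p (f y)
    rw [← hk']
    exact hk.map f
  have hnorm : ∀ a : A, f a ∈ Subgroup.normalizer (M : Set (MulAut V)) := by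
    intro a
    have hconj : ∀ g : G, ∀ x ∈ M, f g * x * (f g)⁻¹ ∈ M := by
      intro g x hx
      obtain ⟨y, hy, rfl⟩ := hM ▸ hx
      rw [hM, ← map_inv, ← map_mul, ← map_mul]
      exact ⟨_, (inferInstance : E.Normal).conj_mem y hy g, rfl⟩
    rw [Subgroup.mem_normalizer_iff]
    refine fun x => ⟨hconj a x, fun hx => ?_⟩
    have := hconj (a : G)⁻¹ _ hx
    rw [map_inv, inv_inv] at this
    have h2 : (f a)⁻¹ * (f a * x * (f a)⁻¹) * f a = x := by group
    rwa [h2] at this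
  obtain ⟨σ, hσd⟩ : ∃ σ : A →* Module.End (ZMod p) (Additive V),
    ∀ a, σ a = lin (f a) := ⟨lin.comp (f.comp A.subtype), fun _ => rfl⟩
  obtain ⟨θ, hθ⟩ : ∃ θ : A →* MulAut M,
      ∀ (a : A) (m : M), ((θ a m : M) : MulAut V) = f a * m * (f a)⁻¹ :=
    ⟨M.normalizerMonoidHom.comp ((f.comp A.subtype).codRestrict _ hnorm), fun _ _ => rfl⟩
  have hcard : ∀ B : Subgroup A, Nat.card (fixedVectors σ B) =
      Nat.card {v : V // ∀ b ∈ B.map A.subtype, f b v = v} := by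
    intro B
    have hfix : ∀ (b : A) (w : Additive V), σ b w = w ↔
        f b (Additive.toMul w) = Additive.toMul w := fun b w => by
      rw [hσd, hlind]
      exact Iff.rfl
    refine Nat.card_congr (Additive.toMul.subtypeEquiv fun w => ⟨?_, ?_⟩)
    · rintro h _ ⟨b, hb, rfl⟩
      exact (hfix b w).1 (h b hb)
    · exact fun h b hb => (hfix b w).2 (h b ⟨b, hb, rfl⟩)
  have key := fixed_of_card_fixedVectors (p := p) hp2
    (fun a : A => Subtype.ext (hAp a a.2)) hMreg σ
    (lin.comp M.subtype) ((hlind ▸ mulAutToModuleEnd_injective p V).comp M.subtype_injective)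
    θ ?_ ?_ ⟨a, ha⟩ ⟨f y, hM ▸ ⟨y, hy, rfl⟩⟩
  · have h1 : f a * f y * (f a)⁻¹ = f y := by rw [← hθ ⟨a, ha⟩ ⟨f y, hM ▸ ⟨y, hy, rfl⟩⟩, key]
    rw [map_mul, map_mul]
    exact mul_inv_eq_iff_eq_mul.1 h1
  · intro a m
    change σ a * lin m = lin (θ a m : M) * σ a
    rw [hσd, ← map_mul, ← map_mul, hθ, inv_mul_cancel_right]
  · intro B
    rw [hcard, hcard, ← MonoidHom.range_eq_map, Subgroup.range_subtype,
      ← Subgroup.card_map_of_injective A.subtype_injective]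
    exact hcount _ (Subgroup.map_subtype_le _)

/-- If `A` is an elementary abelian group acting on an elementary abelian normal subgroup `V` and
satisfying the counting inequality, then `A` centralizes, modulo the centralizer of `V`, every
subgroup `E` normalized by `A` that is abelian of order prime to `p` modulo this centralizer. -/
theorem commute_commutator_of_card [Finite G] [hp : Fact p.Prime] (hp2 : p ≠ 2)
    {V E A : Subgroup G} [V.Normal] [E.Normal]
    (hV : ∀ x ∈ V, ∀ y ∈ V, Commute x y) (hVp : ∀ x ∈ V, x ^ p = 1)
    (hA : ∀ x ∈ A, ∀ y ∈ A, Commute x y) (hAp : ∀ x ∈ A, x ^ p = 1)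
    (hE : ∀ x ∈ E, ∀ y ∈ E, ∀ v ∈ V, x * y * v * (x * y)⁻¹ = y * x * v * (y * x)⁻¹)
    (hreg : ∀ y ∈ E, ∃ k : ℕ, IsPRegular p (y ^ k) ∧
      ∀ v ∈ V, y ^ k * v * (y ^ k)⁻¹ = y * v * y⁻¹)
    (hcount : ∀ B ≤ A, Nat.card B * Nat.card (V ⊓ Subgroup.centralizer (B : Set G) : Subgroup G) ≤
      Nat.card A * Nat.card (V ⊓ Subgroup.centralizer (A : Set G) : Subgroup G))
    {a y v : G} (ha : a ∈ A) (hy : y ∈ E) (hv : v ∈ V) :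
    a * y * v * (a * y)⁻¹ = y * a * v * (y * a)⁻¹ := by
  let _ : CommGroup V :=
    { (inferInstance : Group V) with
      mul_comm := fun x y => Subtype.ext (hV x x.2 y y.2) }
  let _ : Module (ZMod p) (Additive V) := AddCommGroup.zmodModule fun w =>
    Additive.toMul.injective (Subtype.ext (hVp _ (Additive.toMul w).2))
  obtain ⟨f, hf⟩ : ∃ f : G →* MulAut V, ∀ g v, ((f g v : V) : G) = g * v * g⁻¹ :=
    ⟨MulAut.conjNormal, fun _ _ => rfl⟩
  have hext : ∀ g h : G, f g = f h ↔ ∀ v ∈ V, g * v * g⁻¹ = h * v * h⁻¹ := by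
    refine fun g h => ⟨fun e v hv => ?_, fun e => MulEquiv.ext fun v => Subtype.ext ?_⟩
    · rw [← hf g ⟨v, hv⟩, e, hf]
    · rw [hf, hf, e v v.2]
  have hcard : ∀ B : Subgroup G, Nat.card {v : V // ∀ b ∈ B, f b v = v} =
      Nat.card (V ⊓ Subgroup.centralizer (B : Set G) : Subgroup G) := by
    intro B
    refine Nat.card_eq_of_bijective (fun v => ⟨(v : V), (v : V).2,
      Subgroup.mem_centralizer_iff.2 fun b hb => ?_⟩) ⟨?_, ?_⟩
    · have h1 := congrArg Subtype.val (v.2 b hb)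
      rw [hf] at h1
      exact mul_inv_eq_iff_eq_mul.1 h1
    · intro v w h
      exact Subtype.ext (Subtype.ext (Subtype.mk.inj h))
    · rintro ⟨w, hw, hwB⟩
      refine ⟨⟨⟨w, hw⟩, fun b hb => Subtype.ext ?_⟩, rfl⟩
      rw [hf]
      exact mul_inv_eq_iff_eq_mul.2 (Subgroup.mem_centralizer_iff.1 hwB b hb)
  refine (hext _ _).1 (map_mul_comm_of_card hp2 f hA hAp
    (fun x hx y hy => (hext _ _).2 (hE x hx y hy)) (fun y hy => ?_) (fun B hB => ?_) ha hy) v hv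
  · obtain ⟨k, hk, hk'⟩ := hreg y hy
    exact ⟨k, hk, (hext _ _).2 hk'⟩
  · rw [hcard, hcard]
    exact hcount B hB

end Linearization

section Critical

variable {G : Type*} [Group G] [Finite G] {p : ℕ} [hp : Fact p.Prime]

theorem isPGroup_map_of_forall_isPRegular {Q : Type*} [Group Q] (f : G →* Q) {S : Subgroup G}
    (h : ∀ x ∈ S, IsPRegular p x → f x = 1) : IsPGroup p (S.map f) := by
  rintro ⟨_, x, hx, rfl⟩
  obtain ⟨a, ha⟩ := exists_isPRegular_pow_prime_pow (p := p) x
  refine ⟨a, Subtype.ext ?_⟩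
  change f x ^ p ^ a = 1
  rw [← map_pow]
  exact h _ (S.pow_mem hx _) ha

/-- If the elements of order prime to `p` of `S` and of the normal subgroup `T` act trivially, then
so do those of `S ⊔ T`. -/
theorem IsPRegular.map_eq_one_of_mem_sup {Q : Type*} [Group Q] (f : G →* Q) {S T : Subgroup G}
    (hT : T.Normal) (hS' : ∀ x ∈ S, IsPRegular p x → f x = 1)
    (hT' : ∀ x ∈ T, IsPRegular p x → f x = 1) {x : G} (hx : x ∈ S ⊔ T) (hr : IsPRegular p x) :
    f x = 1 := by
  have h1 : IsPGroup p ((S.map f) ⊔ (T.map f) : Subgroup Q) := by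
    refine IsPGroup.to_sup_of_normal_right' (isPGroup_map_of_forall_isPRegular f hS')
      (isPGroup_map_of_forall_isPRegular f hT') ?_
    rintro _ ⟨g, hg, rfl⟩
    refine Subgroup.le_normalizer_map (H := T) f ?_
    rw [Subgroup.normalizer_eq_top]
    exact ⟨g, Subgroup.mem_top g, rfl⟩
  rw [← Subgroup.map_sup] at h1
  exact (hr.map f).eq_one_of_mem h1 ⟨x, hx, rfl⟩

theorem isPNilpotent_top_of_commute {U : Subgroup G} [U.Normal]
    (hq : IsPNilpotent p (⊤ : Subgroup (G ⧸ U)))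
    (h : ∀ x, IsPRegular p x → ∀ u ∈ U, Commute x u) : IsPNilpotent p (⊤ : Subgroup G) := by
  refine IsPNilpotent.of_map (QuotientGroup.mk' U) (hq.mono le_top) fun x _ hx u hu => ?_
  rw [QuotientGroup.ker_mk'] at hu
  exact h x hx u hu

theorem conjNormal_eq_one_iff {U : Subgroup G} [U.Normal] {x : G} :
    (MulAut.conjNormal x : MulAut U) = 1 ↔ ∀ u ∈ U, Commute x u := by
  refine ⟨fun h u hu => mul_inv_eq_iff_eq_mul.1 ?_, fun h => MulEquiv.ext fun u => Subtype.ext ?_⟩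
  · exact congrArg Subtype.val (MulEquiv.congr_fun h ⟨u, hu⟩)
  · exact mul_inv_eq_iff_eq_mul.2 (h u u.2)

/-- In a minimal counterexample, normal `p`-nilpotent subgroups have their Sylow subgroups
contained in `U`. -/
theorem le_of_isPGroup_of_normal_isPNilpotent {U E D : Subgroup G} [U.Normal] [hEn : E.Normal]
    (hU : IsPGroup p U) (hUE : U ≤ E) (hE : IsPNilpotent p E)
    (hq : IsPNilpotent p (⊤ : Subgroup (G ⧸ U))) (hG : ¬ IsPNilpotent p (⊤ : Subgroup G))
    (hmax : ∀ V : Subgroup G, IsPGroup p V → U < V →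
      (∃ P : Sylow p G, (P : Subgroup G) ≤ Subgroup.normalizer (V : Set G)) →
      IsPNilpotent p (Subgroup.normalizer (V : Set G)))
    (hD : IsPGroup p D) (hDE : D ≤ E) : D ≤ U := by
  obtain ⟨R, hR⟩ := (hD.comap_of_injective E.subtype E.subtype_injective).exists_le_sylow
  obtain ⟨P, hP⟩ := R.exists_comap_subtype_eq
  obtain ⟨D', hD'⟩ : ∃ D', D' = (R : Subgroup E).map E.subtype := ⟨_, rfl⟩
  have hD'P : D' = (P : Subgroup G) ⊓ E := by
    rw [hD', ← hP]
    ext x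
    exact ⟨fun ⟨y, hy, h⟩ => h ▸ ⟨hy, y.2⟩, fun h => ⟨⟨x, h.2⟩, h.1, rfl⟩⟩
  have hDD' : D ≤ D' := fun x hx => by
    rw [hD']
    exact ⟨⟨x, hDE hx⟩, hR (show (⟨x, hDE hx⟩ : E) ∈ D.comap E.subtype from hx), rfl⟩
  have hUP : U ≤ (P : Subgroup G) := hU.le_sylow_of_normal P
  have hUD' : U ≤ D' := hD'P ▸ le_inf hUP hUE
  rcases hUD'.eq_or_lt with heq | hlt
  · exact heq ▸ hDD'
  have hPN : (P : Subgroup G) ≤ Subgroup.normalizer (D' : Set G) := by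
    intro g hg
    have hconj : ∀ g ∈ (P : Subgroup G), ∀ x ∈ D', g * x * g⁻¹ ∈ D' := by
      intro g hg x hx
      rw [hD'P] at hx ⊢
      exact Subgroup.mem_inf.2 ⟨P.mul_mem (P.mul_mem hg hx.1) (P.inv_mem hg),
        hEn.conj_mem x hx.2 g⟩
    rw [Subgroup.mem_normalizer_iff]
    refine fun x => ⟨hconj g hg x, fun hx => ?_⟩
    have h1 := hconj _ (P.inv_mem hg) _ hx
    have h2 : g⁻¹ * (g * x * g⁻¹) * g⁻¹⁻¹ = x := by group
    rwa [h2] at h1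
  have hN := hmax D' (hD'P ▸ P.isPGroup'.to_le inf_le_left) hlt ⟨P, hPN⟩
  have hfr : Subgroup.normalizer (D' : Set G) ⊔ E = ⊤ := hD' ▸ R.normalizer_sup_eq_top
  have hUn : ∀ s u : G, u ∈ U → s * u * s⁻¹ ∈ U := fun s u hu =>
    (inferInstance : U.Normal).conj_mem u hu s
  refine absurd (isPNilpotent_top_of_commute hq fun x hx => conjNormal_eq_one_iff.1 ?_) hG
  refine hx.map_eq_one_of_mem_sup MulAut.conjNormal hEn (fun y hy hyr => ?_) (fun y hy hyr => ?_)
    (hfr ▸ Subgroup.mem_top x)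
  · exact conjNormal_eq_one_iff.2 fun u hu => hN.commute hU
      (hUD'.trans Subgroup.le_normalizer) (fun s _ => hUn s) hy hyr hu
  · exact conjNormal_eq_one_iff.2 fun u hu => hE.commute hU hUE (fun s _ => hUn s) hy hyr hu

end Critical

section CriticalStructure

variable {G : Type*} [Group G] [Finite G] {p : ℕ} [hp : Fact p.Prime]

theorem exists_sylow_le_of_not_dvd_index {H : Subgroup G} (h : ¬ p ∣ H.index) :
    ∃ P : Sylow p G, (P : Subgroup G) ≤ H := by
  have R : Sylow p H := default
  have h1 : ¬ p ∣ ((R : Subgroup H).map H.subtype).index := by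
    rw [Subgroup.index_map_subtype, hp.out.dvd_mul]
    exact not_or.2 ⟨R.not_dvd_index, h⟩
  exact ⟨(R.isPGroup'.map H.subtype).toSylow h1, Subgroup.map_subtype_le _⟩

theorem exists_sylow_not_le {T : Subgroup G} (h : T ≠ ⊤) :
    ∃ q : ℕ, ∃ _ : Fact q.Prime, ∀ Q : Sylow q G, ¬ (Q : Subgroup G) ≤ T := by
  rw [ne_eq, ← Subgroup.index_eq_one, Nat.eq_one_iff_not_exists_prime_dvd] at h
  push Not at h
  obtain ⟨q, hq, hd⟩ := h
  have hqf : Fact q.Prime := ⟨hq⟩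
  refine ⟨q, hqf, fun Q hle => ?_⟩
  exact Q.not_dvd_index (hd.trans (Subgroup.index_dvd_of_le hle))

theorem IsPNilpotent.complement_normal (h : IsPNilpotent p (⊤ : Subgroup G)) :
    h.complement.Normal :=
  ⟨fun _ hx g => ⟨Subgroup.mem_top _, hx.2.conj g⟩⟩

theorem commutator_lt_of_isPGroup {q : ℕ} [Fact q.Prime] {Q : Subgroup G} (hQ : IsPGroup q Q)
    (hne : Q ≠ ⊥) : ⁅Q, Q⁆ < Q := by
  have h1 : Group.IsNilpotent Q := hQ.isNilpotent
  have h2 : Nontrivial Q := (Subgroup.nontrivial_iff_ne_bot Q).2 hne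
  have h3 := Group.IsSolvable.commutator_lt_top_of_nontrivial Q
  refine lt_of_le_of_ne ?_ fun h => h3.ne ?_
  · rw [← Subgroup.map_subtype_commutator]
    exact Subgroup.map_subtype_le _
  · rw [← Subgroup.map_subtype_commutator] at h
    refine Subgroup.map_injective Q.subtype_injective (h.trans ?_)
    rw [← MonoidHom.range_eq_map, Subgroup.range_subtype]

set_option maxHeartbeats 400000 in
/-- The structure of a minimal counterexample: it is the product of a Sylow `p`-subgroup and a
normal subgroup that is, modulo `U`, of order prime to `p`, and abelian modulo the
centralizer. -/
theorem exists_normal_sup_sylow_eq_top {U : Subgroup G} [U.Normal] (hU : IsPGroup p U)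
    (hq : IsPNilpotent p (⊤ : Subgroup (G ⧸ U))) (hG : ¬ IsPNilpotent p (⊤ : Subgroup G))
    (hsub : ∀ (P : Sylow p G) (H : Subgroup G), (P : Subgroup G) ≤ H → H ≠ ⊤ →
      IsPNilpotent p H) :
    ∃ E : Subgroup G, E.Normal ∧ (∃ P : Sylow p G, E ⊔ P = ⊤) ∧
      (∀ y ∈ E, IsPRegular p (QuotientGroup.mk' U y)) ∧
      ∀ y ∈ E, ∀ z ∈ E, ∃ k : ℕ, QuotientGroup.mk' U ((y * z * y⁻¹ * z⁻¹) ^ k) =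
        QuotientGroup.mk' U (y * z * y⁻¹ * z⁻¹) ∧
        ∀ u ∈ U, Commute ((y * z * y⁻¹ * z⁻¹) ^ k) u := by
  obtain ⟨f, hf⟩ : ∃ f : G →* MulAut U, f = MulAut.conjNormal := ⟨_, rfl⟩
  have hf1 : ∀ x, f x = 1 ↔ ∀ u ∈ U, Commute x u := fun x => by
    rw [hf]
    exact conjNormal_eq_one_iff
  obtain ⟨x, hxr, hx⟩ : ∃ x, IsPRegular p x ∧ f x ≠ 1 := by
    by_contra! h
    exact hG (isPNilpotent_top_of_commute hq fun x hx => (hf1 x).1 (h x hx))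
  have hUn : ∀ s u : G, u ∈ U → s * u * s⁻¹ ∈ U := fun s u hu =>
    (inferInstance : U.Normal).conj_mem u hu s
  obtain ⟨π, hπ⟩ : ∃ π, π = QuotientGroup.mk' U := ⟨_, rfl⟩
  have hπs : Function.Surjective π := hπ ▸ QuotientGroup.mk'_surjective U
  have hπk : π.ker = U := hπ ▸ QuotientGroup.ker_mk' U
  rw [← hπ]
  have hMn : hq.complement.Normal := hq.complement_normal
  obtain ⟨M, hM⟩ : ∃ M, M = hq.complement := ⟨_, rfl⟩
  rw [← hM] at hMn
  have hMr : ∀ z, z ∈ M ↔ IsPRegular p z := fun z => by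
    rw [hM]
    exact ⟨fun h => h.2, fun h => ⟨Subgroup.mem_top _, h⟩⟩
  obtain ⟨q, hqp, Q, y, hyQ, hyr, hy⟩ : ∃ q : ℕ, ∃ _ : Fact q.Prime, ∃ Q : Sylow q M, ∃ y : G,
      π y ∈ (Q : Subgroup M).map M.subtype ∧ IsPRegular p y ∧ f y ≠ 1 := by
    by_contra! h
    have hT : (f.ker.map π).subgroupOf M = ⊤ := by
      by_contra hne
      obtain ⟨q, hqp, hQ⟩ := exists_sylow_not_le hne
      refine hQ default fun z hz => ?_
      obtain ⟨g, hg⟩ := hπs (z : G ⧸ U)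
      obtain ⟨k, hk, hk'⟩ := exists_isPRegular_pow_map_eq π (hg ▸ (hMr z).1 z.2)
      refine ⟨g ^ k, h q hqp default _ ⟨z, hz, ?_⟩ hk, hk'.trans hg⟩
      exact hg.symm.trans hk'.symm
    obtain ⟨c, hc, hcx⟩ : (⟨π x, (hMr _).2 (hxr.map π)⟩ : M) ∈ (f.ker.map π).subgroupOf M :=
      hT ▸ Subgroup.mem_top _
    have hu : c⁻¹ * x ∈ U := by
      rw [← hπk, MonoidHom.mem_ker, map_mul, map_inv, hcx]
      exact inv_mul_cancel _
    have h1 : f x = f (c⁻¹ * x) := by rw [map_mul, map_inv, (hc : f c = 1), inv_one, one_mul]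
    exact hx ((hxr.map f).eq_one_of_mem (hU.map f) (h1 ▸ ⟨_, hu, rfl⟩))
  obtain ⟨R, hR⟩ : ∃ R, R = (Q : Subgroup M).map M.subtype := ⟨_, rfl⟩
  rw [← hR] at hyQ
  have hRq : IsPGroup q R := hR ▸ Q.isPGroup'.map M.subtype
  have hRr : ∀ z ∈ R, IsPRegular p z := fun z hz =>
    (hMr z).1 (Subgroup.map_subtype_le _ (hR ▸ hz))
  have hfr : Subgroup.normalizer (R : Set (G ⧸ U)) ⊔ M = ⊤ := hR ▸ Q.normalizer_sup_eq_top
  obtain ⟨P', hP'⟩ : ∃ P' : Sylow p (G ⧸ U),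
      (P' : Subgroup (G ⧸ U)) ≤ Subgroup.normalizer (R : Set (G ⧸ U)) := by
    refine exists_sylow_le_of_not_dvd_index fun hd => ?_
    rw [← Subgroup.relIndex_eq_index_of_sup_eq_top (sup_comm _ M ▸ hfr)] at hd
    exact not_dvd_card_of_forall_isPRegular (fun z hz => (hMr z).1 hz)
      (hd.trans (Subgroup.relIndex_dvd_card _ _))
  obtain ⟨P, hP⟩ : ∃ P : Sylow p G, (P : Subgroup G) = (P' : Subgroup (G ⧸ U)).comap π :=
    ⟨P'.comapOfKerIsPGroup π (hπk.symm ▸ hU) (by rw [MonoidHom.range_eq_top.2 hπs]; exact le_top),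
      rfl⟩
  have hlocal : ∀ L : Subgroup (G ⧸ U), L ⊔ P' ≠ ⊤ → ∀ g, π g ∈ L → IsPRegular p g →
      ∀ u ∈ U, Commute g u := by
    intro L hL g hg hgr u hu
    have hUL : U ≤ (L ⊔ P' : Subgroup (G ⧸ U)).comap π := hπk.ge.trans (Subgroup.ker_le_comap π _)
    refine (hsub P ((L ⊔ P').comap π) ?_ ?_).commute hU hUL (fun s _ => hUn s) ?_ hgr hu
    · exact hP ▸ Subgroup.comap_mono le_sup_right
    · intro h
      refine hL (Subgroup.comap_injective hπs (h.trans (Subgroup.comap_top π).symm))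
    · exact Subgroup.mem_sup_left (T := (P' : Subgroup (G ⧸ U))) hg
  have htop : R ⊔ P' = ⊤ := by
    by_contra h
    exact hy ((hf1 y).2 (hlocal R h y hyQ hyr))
  have hRn : R.Normal := by
    rw [← Subgroup.normalizer_eq_top_iff, ← top_le_iff, ← htop]
    exact sup_le Subgroup.le_normalizer hP'
  have hRne : R ≠ ⊥ := by
    rintro rfl
    have h1 : y ∈ U := by
      rw [← hπk]
      exact Subgroup.mem_bot.1 hyQ
    rw [hyr.eq_one_of_mem hU h1, map_one] at hy
    exact hy rfl
  have hRR := commutator_lt_of_isPGroup hRq hRne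
  have hL : ⁅R, R⁆ ⊔ (P' : Subgroup (G ⧸ U)) ≠ ⊤ := by
    intro h
    refine hRR.not_ge fun z hz => ?_
    obtain ⟨a, ha, b, hb, hab⟩ := Subgroup.mem_sup_of_normal_left.1 (h ▸ Subgroup.mem_top z)
    have hbR : b ∈ R := by
      have h1 := R.mul_mem (R.inv_mem (hRR.le ha)) hz
      rwa [← hab, inv_mul_cancel_left] at h1
    rw [← hab, (hRr b hbR).eq_one_of_mem P'.isPGroup' hb, mul_one]
    exact ha
  refine ⟨R.comap π, hRn.comap π, ⟨P, ?_⟩, fun y hy => hRr _ hy, fun y hy z hz => ?_⟩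
  · rw [hP, Subgroup.comap_sup_eq π _ _ hπs, htop, Subgroup.comap_top]
  · have h1 : π (y * z * y⁻¹ * z⁻¹) ∈ ⁅R, R⁆ := by
      simp only [map_mul, map_inv]
      exact Subgroup.commutator_mem_commutator hy hz
    obtain ⟨k, hk, hk'⟩ := exists_isPRegular_pow_map_eq π (hRr _ (hRR.le h1))
    exact ⟨k, hk', hlocal _ hL _ (hk' ▸ h1) hk⟩

end CriticalStructure

section ElementaryAbelian

variable {G : Type*} [Group G] {p : ℕ}

/-- `A` is commutative of exponent dividing `p`. -/
def IsElementaryAbelian (p : ℕ) (A : Subgroup G) : Prop :=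
  (∀ x ∈ A, ∀ y ∈ A, Commute x y) ∧ ∀ x ∈ A, x ^ p = 1

theorem IsElementaryAbelian.mono {A B : Subgroup G} (hB : IsElementaryAbelian p B) (h : A ≤ B) :
    IsElementaryAbelian p A :=
  ⟨fun x hx y hy => hB.1 x (h hx) y (h hy), fun x hx => hB.2 x (h hx)⟩

theorem IsElementaryAbelian.map {Q : Type*} [Group Q] {A : Subgroup G}
    (h : IsElementaryAbelian p A) (f : G →* Q) : IsElementaryAbelian p (A.map f) := by
  refine ⟨?_, ?_⟩
  · rintro _ ⟨x, hx, rfl⟩ _ ⟨y, hy, rfl⟩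
    exact (h.1 x hx y hy).map f
  · rintro _ ⟨x, hx, rfl⟩
    rw [← map_pow, h.2 x hx, map_one]

theorem IsElementaryAbelian.comap {Q : Type*} [Group Q] {f : G →* Q} (hf : Function.Injective f)
    {A : Subgroup Q} (h : IsElementaryAbelian p A) : IsElementaryAbelian p (A.comap f) :=
  ⟨fun x hx y hy => hf (by rw [map_mul, map_mul]; exact h.1 _ hx _ hy),
    fun x hx => hf (by rw [map_pow, map_one]; exact h.2 _ hx)⟩

theorem IsElementaryAbelian.isPGroup {A : Subgroup G} (h : IsElementaryAbelian p A) :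
    IsPGroup p A :=
  fun x => ⟨1, Subtype.ext (by rw [pow_one]; exact h.2 x x.2)⟩

/-- The elements of order dividing `p` in the center of `U`. -/
def Subgroup.omegaCenter (p : ℕ) (U : Subgroup G) : Subgroup G where
  carrier := {x | x ∈ U ∧ (∀ u ∈ U, Commute x u) ∧ x ^ p = 1}
  mul_mem' := fun {x y} hx hy => ⟨U.mul_mem hx.1 hy.1,
    fun u hu => (hx.2.1 u hu).mul_left (hy.2.1 u hu),
    by rw [(hx.2.1 y hy.1).mul_pow, hx.2.2, hy.2.2, one_mul]⟩
  one_mem' := ⟨U.one_mem, fun u _ => Commute.one_left u, one_pow p⟩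
  inv_mem' := fun {x} hx => ⟨U.inv_mem hx.1, fun u hu => (hx.2.1 u hu).inv_left,
    by rw [inv_pow, hx.2.2, inv_one]⟩

theorem Subgroup.isElementaryAbelian_omegaCenter (U : Subgroup G) :
    IsElementaryAbelian p (U.omegaCenter p) :=
  ⟨fun _ hx _ hy => hx.2.1 _ hy.1, fun _ hx => hx.2.2⟩

theorem Subgroup.omegaCenter_le (U : Subgroup G) : U.omegaCenter p ≤ U := fun _ hx => hx.1

theorem Subgroup.apply_mem_omegaCenter {U : Subgroup G} (f : G ≃* G) (hf : ∀ u, f u ∈ U ↔ u ∈ U)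
    {x : G} (hx : x ∈ U.omegaCenter p) : f x ∈ U.omegaCenter p := by
  refine ⟨(hf x).2 hx.1, fun u hu => ?_, by rw [← map_pow, hx.2.2, map_one]⟩
  obtain ⟨v, rfl⟩ := f.surjective u
  exact (hx.2.1 v ((hf v).1 hu)).map f

instance Subgroup.omegaCenter_normal (U : Subgroup G) [hU : U.Normal] :
    (U.omegaCenter p).Normal := by
  refine ⟨fun x hx g => U.apply_mem_omegaCenter (MulAut.conj g) (fun u => ?_) hx⟩
  rw [MulAut.conj_apply]
  exact (hU.mem_comm_iff.trans (by rw [inv_mul_cancel_left]))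

theorem Subgroup.omegaCenter_ne_bot [Finite G] [Fact p.Prime] {U : Subgroup G}
    (h : p ∣ Nat.card (Subgroup.center U)) : U.omegaCenter p ≠ ⊥ := by
  obtain ⟨x, hx⟩ := exists_prime_orderOf_dvd_card' p h
  intro hbot
  have h1 : ((x : U) : G) ∈ U.omegaCenter p := by
    refine ⟨(x : U).2, fun u hu => ?_, ?_⟩
    · exact congrArg Subtype.val (Subgroup.mem_center_iff.1 x.2 ⟨u, hu⟩).symm
    · rw [← hx]
      exact congrArg (fun y : Subgroup.center U => ((y : U) : G)) (pow_orderOf_eq_one x)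
  rw [hbot, Subgroup.mem_bot] at h1
  have h2 : x = 1 := Subtype.ext (Subtype.ext h1)
  rw [h2, orderOf_one] at hx
  exact (Fact.out : p.Prime).ne_one hx.symm

theorem Subgroup.omegaCenter_ne_bot_of_isPGroup [Finite G] [hp : Fact p.Prime] {U : Subgroup G}
    (h : IsPGroup p U) (hne : U ≠ ⊥) : U.omegaCenter p ≠ ⊥ := by
  have h1 : Nontrivial U := (Subgroup.nontrivial_iff_ne_bot U).2 hne
  have h2 := h.center_nontrivial
  obtain ⟨n, hn0, hn⟩ := (h.to_subgroup (Subgroup.center U)).nontrivial_iff_card.1 h2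
  exact Subgroup.omegaCenter_ne_bot (hn ▸ dvd_pow_self p hn0.ne')

/-- The elementary abelian subgroups of maximal order. -/
def IsMaxElementaryAbelian (p : ℕ) (A : Subgroup G) : Prop :=
  IsElementaryAbelian p A ∧ ∀ B : Subgroup G, IsElementaryAbelian p B → Nat.card B ≤ Nat.card A

theorem IsMaxElementaryAbelian.map_equiv {A : Subgroup G} (h : IsMaxElementaryAbelian p A)
    (f : G ≃* G) : IsMaxElementaryAbelian p (A.map f.toMonoidHom) := by
  refine ⟨h.1.map _, fun B hB => ?_⟩
  rw [Subgroup.card_map_of_injective f.injective]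
  exact h.2 B hB

/-- The Thompson subgroup generated by the elementary abelian subgroups of maximal order. -/
def thompsonSubgroup (p : ℕ) (G : Type*) [Group G] : Subgroup G :=
  sSup {A | IsMaxElementaryAbelian p A}

theorem thompsonSubgroup_characteristic : (thompsonSubgroup p G).Characteristic := by
  refine Subgroup.characteristic_iff_map_le.2 fun f => ?_
  rw [Subgroup.map_le_iff_le_comap]
  refine sSup_le fun A hA => ?_
  rw [← Subgroup.map_le_iff_le_comap]
  exact le_sSup (hA.map_equiv f)

theorem thompsonSubgroup_ne_bot [Finite G] [hp : Fact p.Prime] (hG : p ∣ Nat.card G) :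
    thompsonSubgroup p G ≠ ⊥ := by
  obtain ⟨x, hx⟩ := exists_prime_orderOf_dvd_card' p hG
  have hE : IsElementaryAbelian p (Subgroup.zpowers x) := by
    refine ⟨?_, ?_⟩
    · rintro _ ⟨k, rfl⟩ _ ⟨l, rfl⟩
      exact ((Commute.refl x).zpow_left k).zpow_right l
    · rintro _ ⟨k, rfl⟩
      change (x ^ k) ^ p = 1
      rw [← zpow_natCast, ← zpow_mul, mul_comm, zpow_mul, zpow_natCast, ← hx, pow_orderOf_eq_one,
        one_zpow]
  have hne : Nonempty {A : Subgroup G // IsElementaryAbelian p A} := ⟨⟨_, hE⟩⟩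
  obtain ⟨A, hA⟩ := Finite.exists_max
    fun A : {A : Subgroup G // IsElementaryAbelian p A} => Nat.card A.1
  intro hbot
  have h1 : A.1 ≤ thompsonSubgroup p G := le_sSup ⟨A.2, fun B hB => hA ⟨B, hB⟩⟩
  have h2 := hA ⟨_, hE⟩
  rw [hbot, le_bot_iff] at h1
  rw [h1, Subgroup.card_bot] at h2
  change Nat.card (Subgroup.zpowers x) ≤ 1 at h2
  rw [Nat.card_zpowers, hx] at h2
  exact absurd hp.out.one_lt (by omega)

theorem IsElementaryAbelian.card_mul_le [Finite G] {A B X P : Subgroup G}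
    (hA : IsElementaryAbelian p A)
    (hmax : ∀ C ≤ P, IsElementaryAbelian p C → Nat.card C ≤ Nat.card A) (hAP : A ≤ P)
    (hX : IsElementaryAbelian p X) (hXP : X ≤ P) (hB : B ≤ A)
    (hBX : ∀ b ∈ B, ∀ x ∈ X, Commute b x) :
    Nat.card B * Nat.card X ≤ Nat.card A * Nat.card (X ⊓ A : Subgroup G) := by
  obtain ⟨f, hf⟩ : ∃ f : B × X →* G, ∀ z, f z = z.1 * z.2 :=
    ⟨B.subtype.noncommCoprod X.subtype fun b x => hBX b b.2 x x.2, fun _ => rfl⟩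
  have h1 : Nat.card f.range ≤ Nat.card A := by
    refine hmax _ ?_ ⟨?_, ?_⟩
    · rintro _ ⟨z, rfl⟩
      exact hf z ▸ P.mul_mem (hAP (hB z.1.2)) (hXP z.2.2)
    · rintro _ ⟨z, rfl⟩ _ ⟨w, rfl⟩
      have hc : z * w = w * z := Prod.ext (Subtype.ext (hA.1 _ (hB z.1.2) _ (hB w.1.2)))
        (Subtype.ext (hX.1 _ z.2.2 _ w.2.2))
      exact (show Commute z w from hc).map f
    · rintro _ ⟨z, rfl⟩
      rw [hf, (hBX _ z.1.2 _ z.2.2).mul_pow, hA.2 _ (hB z.1.2), hX.2 _ z.2.2, one_mul]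
  have h2 : Nat.card f.ker ≤ Nat.card (X ⊓ A : Subgroup G) := by
    have hk : ∀ z : f.ker, ((z : B × X).1 : G) = ((z : B × X).2 : G)⁻¹ := fun z =>
      eq_inv_of_mul_eq_one_left ((hf z).symm.trans z.2)
    refine Nat.card_le_card_of_injective (fun z : f.ker => (⟨((z : B × X).1 : G),
      Subgroup.mem_inf.2 ⟨?_, hB (z : B × X).1.2⟩⟩ : (X ⊓ A : Subgroup G))) ?_
    · rw [hk]
      exact X.inv_mem (z : B × X).2.2
    · intro z w h
      have h3 : ((z : B × X).1 : G) = ((w : B × X).1 : G) := Subtype.mk.inj h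
      refine Subtype.ext (Prod.ext (Subtype.ext h3) (Subtype.ext ?_))
      rwa [hk, hk, inv_inj] at h3
  have h3 := Subgroup.card_mul_index f.ker
  rw [Subgroup.index_ker, Nat.card_prod] at h3
  rw [← h3, mul_comm]
  exact Nat.mul_le_mul h1 h2

end ElementaryAbelian

section Thompson

variable {G : Type*} [Group G] [Finite G] {p : ℕ} [hp : Fact p.Prime]

/-- The normalizers of the nontrivial characteristic subgroups of the Sylow `p`-subgroups have
normal `p`-complements. -/
def IsCharLocallyPNilpotent (p : ℕ) (G : Type*) [Group G] : Prop :=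
  ∀ (P : Sylow p G) (X : Subgroup P), X.Characteristic → X ≠ ⊥ →
    IsPNilpotent p (Subgroup.normalizer (X.map (P : Subgroup G).subtype : Set G))

theorem IsCharLocallyPNilpotent.normalizer_omegaCenter (h : IsCharLocallyPNilpotent p G)
    (P : Sylow p G) (hne : (P : Subgroup G).omegaCenter p ≠ ⊥) :
    IsPNilpotent p (Subgroup.normalizer ((P : Subgroup G).omegaCenter p : Set G)) := by
  have h1 := Subgroup.map_subgroupOf_eq_of_le
    (Subgroup.omegaCenter_le (p := p) (P : Subgroup G))
  have h2 := h P (((P : Subgroup G).omegaCenter p).subgroupOf P) ?_ ?_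
  · rwa [h1] at h2
  · refine Subgroup.characteristic_iff_map_le.2 fun f => ?_
    rintro _ ⟨x, hx, rfl⟩
    change ((x : (P : Subgroup G)) : G) ∈ (P : Subgroup G).omegaCenter p at hx
    refine ⟨(f x).2, fun u hu => ?_, ?_⟩
    · obtain ⟨v, hv⟩ := f.surjective ⟨u, hu⟩
      have h3 : Commute x v := Subtype.ext (hx.2.1 v v.2)
      have h4 := congrArg Subtype.val (h3.map f)
      rw [hv] at h4
      exact h4
    · have h3 : x ^ p = 1 := Subtype.ext hx.2.2
      have h4 := congrArg (fun z => ((f z : (P : Subgroup G)) : G)) h3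
      simp only [map_pow, map_one] at h4
      exact h4
  · intro hbot
    rw [hbot, Subgroup.map_bot] at h1
    exact hne h1.symm

/-- In a minimal counterexample, some elementary abelian subgroup of maximal order of `P` does not
centralize `V`. -/
theorem exists_isMaxElementaryAbelian_not_le {P : Sylow p G} (h : IsCharLocallyPNilpotent p G)
    (hG : ¬ IsPNilpotent p (⊤ : Subgroup G)) {U C : Subgroup G} [hUn : U.Normal]
    (hUP : U ≤ (P : Subgroup G)) (hUne : U ≠ ⊥)
    (hC : ∀ D : Subgroup G, IsPGroup p D → D ≤ C → D ≤ U) :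
    ∃ A : Subgroup P, IsMaxElementaryAbelian p A ∧
      ¬ A.map (P : Subgroup G).subtype ≤ C := by
  by_contra! hall
  have hdvd : p ∣ Nat.card (P : Subgroup G) := by
    have h1 : Nontrivial (P : Subgroup G) := (Subgroup.nontrivial_iff_ne_bot _).2 fun hb =>
      hUne (le_bot_iff.1 (hb ▸ hUP))
    obtain ⟨n, hn0, hn⟩ := P.isPGroup'.nontrivial_iff_card.1 h1
    exact hn ▸ dvd_pow_self p hn0.ne'
  have hN := h P _ thompsonSubgroup_characteristic (thompsonSubgroup_ne_bot hdvd)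
  obtain ⟨ι, hι⟩ : ∃ ι, ι = (P : Subgroup G).subtype := ⟨_, rfl⟩
  rw [← hι] at hN hall
  have hιinj : Function.Injective ι := hι ▸ Subtype.coe_injective
  have hnormal : ((thompsonSubgroup p P).map ι).Normal := by
    refine ⟨fun x hx g => ?_⟩
    suffices hle : thompsonSubgroup p P ≤
        (((thompsonSubgroup p P).map ι).comap (MulAut.conj g).toMonoidHom).comap ι by
      obtain ⟨y, hy, rfl⟩ := hx
      exact hle hy
    refine sSup_le fun A hA => ?_
    have hAU : A.map ι ≤ U := hC _ (hA.1.map ι).isPGroup (hall A hA)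
    have hgU : (A.map ι).map (MulAut.conj g).toMonoidHom ≤ U := by
      rintro _ ⟨x, hx, rfl⟩
      exact hUn.conj_mem x (hAU hx) g
    have hrange : ι.range = (P : Subgroup G) := hι ▸ Subgroup.range_subtype _
    have hmap : (((A.map ι).map (MulAut.conj g).toMonoidHom).comap ι).map ι =
        (A.map ι).map (MulAut.conj g).toMonoidHom := by
      rw [Subgroup.map_comap_eq, hrange, inf_eq_right]
      exact hgU.trans hUP
    have hmax : IsMaxElementaryAbelian p
        (((A.map ι).map (MulAut.conj g).toMonoidHom).comap ι) := by
      refine ⟨((hA.1.map ι).map _).comap hιinj, fun B hB => ?_⟩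
      have hc : Nat.card (((A.map ι).map (MulAut.conj g).toMonoidHom).comap ι) = Nat.card A := by
        rw [← Subgroup.card_map_of_injective (K := ((A.map ι).map _).comap ι) hιinj, hmap,
          Subgroup.card_map_of_injective (MulAut.conj g).injective,
          Subgroup.card_map_of_injective hιinj]
      rw [hc]
      exact hA.2 B hB
    intro a ha
    have h1 : (MulAut.conj g).toMonoidHom (ι a) ∈
        (((A.map ι).map (MulAut.conj g).toMonoidHom).comap ι).map ι := by
      rw [hmap]
      exact ⟨_, ⟨a, ha, rfl⟩, rfl⟩
    exact Subgroup.map_mono (le_sSup hmax) h1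
  rw [Subgroup.normalizer_eq_top_iff.2 hnormal] at hN
  exact hG hN

theorem isPNilpotent_top_of_isCharLocallyPNilpotent_aux (hp2 : p ≠ 2)
    (h : IsCharLocallyPNilpotent p G) {U : Subgroup G} [hUn : U.Normal] (hU : IsPGroup p U)
    (hUne : U ≠ ⊥) (hq : IsPNilpotent p (⊤ : Subgroup (G ⧸ U)))
    (hsub : ∀ (P : Sylow p G) (H : Subgroup G), (P : Subgroup G) ≤ H → H ≠ ⊤ →
      IsPNilpotent p H)
    (hmax : ∀ V : Subgroup G, IsPGroup p V → U < V →
      (∃ P : Sylow p G, (P : Subgroup G) ≤ Subgroup.normalizer (V : Set G)) →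
      IsPNilpotent p (Subgroup.normalizer (V : Set G))) :
    IsPNilpotent p (⊤ : Subgroup G) := by
  by_contra hG
  obtain ⟨E, hEn, ⟨P, hEP⟩, hEr, hEc⟩ := exists_normal_sup_sylow_eq_top hU hq hG hsub
  have hUP : U ≤ (P : Subgroup G) := hU.le_sylow_of_normal P
  have hle : ∀ E : Subgroup G, E.Normal → U ≤ E → IsPNilpotent p E →
      ∀ D : Subgroup G, IsPGroup p D → D ≤ E → D ≤ U := fun E hEn hUE hE D hD hDE =>
    le_of_isPGroup_of_normal_isPNilpotent hU hUE hE hq hG hmax hD hDE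
  have hCU : IsPNilpotent p (Subgroup.centralizer (U : Set G) ⊔ U : Subgroup G) := by
    refine IsPNilpotent.of_map (QuotientGroup.mk' U) (hq.mono le_top) fun x hx hxr u hu => ?_
    rw [QuotientGroup.ker_mk'] at hu
    refine conjNormal_eq_one_iff.1 (hxr.map_eq_one_of_mem_sup MulAut.conjNormal hUn
      (fun y hy _ => conjNormal_eq_one_iff.2 fun u hu =>
        (Subgroup.mem_centralizer_iff.1 hy u hu).symm)
      (fun y hy hyr => ?_) hx) u hu
    rw [hyr.eq_one_of_mem hU hy, map_one]
  obtain ⟨Z, hZ⟩ : ∃ Z, Z = (P : Subgroup G).omegaCenter p := ⟨_, rfl⟩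
  have hZP : Z ≤ (P : Subgroup G) := hZ ▸ Subgroup.omegaCenter_le _
  have hZU : Z ≤ U := by
    refine hle _ inferInstance le_sup_right hCU Z (P.isPGroup'.to_le hZP)
      (le_trans (fun z hz => ?_) le_sup_left)
    rw [hZ] at hz
    exact Subgroup.mem_centralizer_iff.2 fun u hu => (hz.2.1 u (hUP hu)).symm
  have hPne : (P : Subgroup G) ≠ ⊥ := fun hb => hUne (le_bot_iff.1 (hb ▸ hUP))
  have hZN : IsPNilpotent p (Subgroup.normalizer (Z : Set G)) := hZ ▸
    h.normalizer_omegaCenter P (Subgroup.omegaCenter_ne_bot_of_isPGroup P.isPGroup' hPne)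
  obtain ⟨V, hV⟩ : ∃ V, V = U.omegaCenter p := ⟨_, rfl⟩
  have hVn : V.Normal := hV ▸ inferInstance
  have hVe : IsElementaryAbelian p V := hV ▸ Subgroup.isElementaryAbelian_omegaCenter U
  have hVU : V ≤ U := hV ▸ Subgroup.omegaCenter_le _
  have hZV : Z ≤ V := fun z hz => by
    have hzU := hZU hz
    rw [hZ] at hz
    rw [hV]
    exact ⟨hzU, fun u hu => hz.2.1 u (hUP hu), hz.2.2⟩
  obtain ⟨C, hC⟩ : ∃ C, C = Subgroup.centralizer (V : Set G) := ⟨_, rfl⟩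
  have hCn : C.Normal := hC ▸ inferInstance
  have hCmem : ∀ g, g ∈ C ↔ ∀ v ∈ V, Commute g v := fun g => by
    rw [hC, Subgroup.mem_centralizer_iff]
    exact ⟨fun h v hv => (h v hv).symm, fun h v hv => (h v hv).symm⟩
  have hUC : U ≤ C := fun u hu => (hCmem u).2 fun v hv => by
    rw [hV] at hv
    exact (hv.2.1 u hu).symm
  have hCN : IsPNilpotent p C := by
    refine hZN.mono (le_trans ?_ (Subgroup.centralizer_le_normalizer _))
    rw [hC]
    exact Subgroup.centralizer_le hZV
  have hCD := hle C hCn hUC hCN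
  obtain ⟨A', hA', hAC⟩ := exists_isMaxElementaryAbelian_not_le h hG hUP hUne hCD
  obtain ⟨A, hAd⟩ : ∃ A, A = A'.map (P : Subgroup G).subtype := ⟨_, rfl⟩
  rw [← hAd] at hAC
  have hAe : IsElementaryAbelian p A := hAd ▸ hA'.1.map _
  have hAP : A ≤ (P : Subgroup G) := hAd ▸ Subgroup.map_subtype_le _
  have hAmax : ∀ B ≤ (P : Subgroup G), IsElementaryAbelian p B → Nat.card B ≤ Nat.card A := by
    intro B hBP hB
    rw [hAd, Subgroup.card_map_of_injective (Subgroup.subtype_injective _),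
      ← Subgroup.map_subgroupOf_eq_of_le hBP,
      Subgroup.card_map_of_injective (Subgroup.subtype_injective _)]
    exact hA'.2 _ (hB.comap (Subgroup.subtype_injective _))
  have hconj : ∀ g k : G, g * k⁻¹ ∈ C → ∀ v ∈ V, g * v * g⁻¹ = k * v * k⁻¹ := by
    intro g k hgk v hv
    have h1 := (hCmem _).1 hgk _ (hVn.conj_mem v hv k)
    have h2 : g * v * g⁻¹ = (g * k⁻¹) * (k * v * k⁻¹) * (g * k⁻¹)⁻¹ := by group
    rw [h2]
    exact mul_inv_eq_iff_eq_mul.2 h1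
  have hconj' : ∀ g k : G, (∀ v ∈ V, g * v * g⁻¹ = k * v * k⁻¹) → g * k⁻¹ ∈ C := by
    intro g k hgk
    refine (hCmem _).2 fun v hv => ?_
    have h1 := hgk _ (hVn.conj_mem v hv k⁻¹)
    refine mul_inv_eq_iff_eq_mul.1 ?_
    calc g * k⁻¹ * v * (g * k⁻¹)⁻¹ = g * (k⁻¹ * v * k⁻¹⁻¹) * g⁻¹ := by group
      _ = v := by rw [h1]; group
  have hcomm : ∀ a ∈ A, ∀ y ∈ E, a * y * (y * a)⁻¹ ∈ C := by
    intro a ha y hy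
    refine hconj' _ _ fun v hv => commute_commutator_of_card hp2 (E := E) hVe.1 hVe.2 hAe.1 hAe.2
      ?_ ?_ ?_ ha hy hv
    · intro x hx y hy
      refine hconj _ _ ?_
      obtain ⟨k, hk, hk'⟩ := hEc x hx y hy
      have h1 : (x * y * x⁻¹ * y⁻¹) ^ k / (x * y * x⁻¹ * y⁻¹) ∈ C :=
        hUC (QuotientGroup.eq_iff_div_mem.1 hk)
      have h2 : (x * y * x⁻¹ * y⁻¹) ^ k ∈ C := (hCmem _).2 fun v hv => hk' v (hVU hv)
      have h3 := C.mul_mem (C.inv_mem h1) h2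
      rw [inv_div, div_mul_cancel] at h3
      have h4 : x * y * (y * x)⁻¹ = x * y * x⁻¹ * y⁻¹ := by group
      rwa [h4]
    · intro y hy
      obtain ⟨k, hk, hk'⟩ := exists_isPRegular_pow_map_eq _ (hEr y hy)
      refine ⟨k, hk, hconj _ _ ?_⟩
      rw [← div_eq_mul_inv]
      exact hUC (QuotientGroup.eq_iff_div_mem.1 hk')
    · intro B hB
      refine (hAe.card_mul_le hAmax hAP (hVe.mono inf_le_left)
        (inf_le_left.trans (hVU.trans hUP)) hB fun b hb x hx => ?_).trans
        (Nat.mul_le_mul_left _ (Subgroup.card_le_of_le ?_))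
      · exact Subgroup.mem_centralizer_iff.1 hx.2 b hb
      · exact fun x hx => ⟨hx.1.1, Subgroup.mem_centralizer_iff.2 fun a ha => hAe.1 a ha x hx.2⟩
  obtain ⟨ψ, hψ⟩ : ∃ ψ, ψ = QuotientGroup.mk' C := ⟨_, rfl⟩
  have hψk : ψ.ker = C := hψ ▸ QuotientGroup.ker_mk' C
  have hψs : Function.Surjective ψ := hψ ▸ QuotientGroup.mk'_surjective C
  have hEψ : (E.map ψ).Normal := hEn.map ψ hψs
  obtain ⟨K, hK⟩ : ∃ K, K = (Subgroup.centralizer (E.map ψ : Set (G ⧸ C))).comap ψ := ⟨_, rfl⟩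
  have hKn : K.Normal := hK ▸ inferInstance
  have hAK : A ≤ K := fun a ha => by
    rw [hK]
    refine Subgroup.mem_centralizer_iff.2 ?_
    rintro _ ⟨y, hy, rfl⟩
    rw [← map_mul, ← map_mul]
    have h1 : ψ (a * y * (y * a)⁻¹) = 1 := by
      rw [← MonoidHom.mem_ker, hψk]
      exact hcomm a ha y hy
    rw [map_mul, map_inv, mul_inv_eq_one] at h1
    exact h1.symm
  obtain ⟨D, hD⟩ : ∃ D, D = (P : Subgroup G) ⊓ K := ⟨_, rfl⟩
  have hDP : IsPGroup p D := hD ▸ P.isPGroup'.to_le inf_le_left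
  have hPD : (P : Subgroup G) ≤ Subgroup.normalizer (D : Set G) := by
    rw [hD]
    refine le_trans (le_inf Subgroup.le_normalizer ?_) (Subgroup.inf_normalizer_le_normalizer_inf)
    rw [Subgroup.normalizer_eq_top]
    exact le_top
  have hDn : (D.map ψ).Normal := by
    rw [← Subgroup.normalizer_eq_top_iff, ← top_le_iff, ← Subgroup.map_top_of_surjective ψ hψs,
      ← hEP, Subgroup.map_sup]
    refine sup_le ?_ ?_
    · refine le_trans ?_ (Subgroup.centralizer_le_normalizer _)
      rw [Subgroup.le_centralizer_iff]
      rintro _ ⟨d, hd, rfl⟩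
      rw [hD, hK] at hd
      exact hd.2
    · exact (Subgroup.map_mono hPD).trans (Subgroup.le_normalizer_map ψ)
  have hDle : D ≤ U := by
    refine hle ((D.map ψ).comap ψ) (hDn.comap ψ)
      (hUC.trans (hψk.ge.trans (Subgroup.ker_le_comap ψ _))) ?_ D hDP (Subgroup.le_comap_map ψ D)
    intro x hx y hy hxr hyr
    have hmem : ∀ z ∈ (D.map ψ).comap ψ, IsPRegular p z → z ∈ C := fun z hz hzr => by
      rw [← hψk]
      exact (hzr.map ψ).eq_one_of_mem (hDP.map ψ) hz
    exact hCN x (hmem x hx hxr) y (hmem y hy hyr) hxr hyr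
  exact hAC (((le_inf hAP hAK).trans hD.ge).trans (hDle.trans hUC))

end Thompson

section GlaubermanThompson

variable {G : Type*} [Group G] {p : ℕ}

theorem Subgroup.Characteristic.map_equiv {T : Type*} [Group T] {X : Subgroup G}
    (h : X.Characteristic) (e : G ≃* T) : (X.map e.toMonoidHom).Characteristic := by
  refine Subgroup.characteristic_iff_map_le.2 fun f => ?_
  rintro _ ⟨_, ⟨x, hx, rfl⟩, rfl⟩
  refine ⟨e.symm (f (e x)), ?_, e.apply_symm_apply _⟩
  exact Subgroup.characteristic_iff_map_le.1 h ((e.trans f).trans e.symm) ⟨x, hx, rfl⟩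

theorem Subgroup.Characteristic.normalizer_le {S : Subgroup G} {X : Subgroup S}
    (h : X.Characteristic) :
    Subgroup.normalizer (S : Set G) ≤ Subgroup.normalizer (X.map S.subtype : Set G) := by
  have key : ∀ g ∈ Subgroup.normalizer (S : Set G), ∀ y ∈ X.map S.subtype,
      g * y * g⁻¹ ∈ X.map S.subtype := by
    rintro g hg _ ⟨x, hx, rfl⟩
    exact ⟨_, Subgroup.characteristic_iff_map_le.1 h (S.normalizerMonoidHom ⟨g, hg⟩)
      ⟨x, hx, rfl⟩, rfl⟩
  intro g hg
  refine Subgroup.mem_normalizer_iff.2 fun y => ⟨key g hg y, fun hy => ?_⟩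
  have h1 := key g⁻¹ (Subgroup.inv_mem _ hg) _ hy
  have h2 : g⁻¹ * (g * y * g⁻¹) * g⁻¹⁻¹ = y := by group
  rwa [h2] at h1

/-- A characteristic subgroup of a subgroup of `M` remains one after embedding into `G`. -/
theorem exists_characteristic_map_subtype_eq {M : Subgroup G} {S : Subgroup M} {T : Subgroup G}
    (hT : T = S.map M.subtype) {X : Subgroup S} (hX : X.Characteristic) (hne : X ≠ ⊥) :
    ∃ Y : Subgroup T, Y.Characteristic ∧ Y ≠ ⊥ ∧
      Y.map T.subtype = (X.map S.subtype).map M.subtype := by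
  subst hT
  refine ⟨_, hX.map_equiv (S.equivMapOfInjective M.subtype M.subtype_injective), ?_, ?_⟩
  · rwa [ne_eq, Subgroup.map_eq_bot_iff_of_injective _ (MulEquiv.injective _)]
  · rw [Subgroup.map_map, Subgroup.map_map]
    rfl

theorem IsPNilpotent.normalizer_of_map {M : Subgroup G} {Y : Subgroup M}
    (h : IsPNilpotent p (Subgroup.normalizer (Y.map M.subtype : Set G))) :
    IsPNilpotent p (Subgroup.normalizer (Y : Set M)) :=
  IsPNilpotent.of_map_injective M.subtype_injective (h.mono (Subgroup.le_normalizer_map _))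

variable [Finite G] [hp : Fact p.Prime]

theorem exists_sylow_coe_eq_map_subtype {M : Subgroup G} (hM : ¬ p ∣ M.index) (S : Sylow p M) :
    ∃ P : Sylow p G, (P : Subgroup G) = (S : Subgroup M).map M.subtype := by
  have h1 : ¬ p ∣ ((S : Subgroup M).map M.subtype).index := by
    rw [Subgroup.index_map_subtype, hp.out.dvd_mul]
    exact not_or.2 ⟨S.not_dvd_index, hM⟩
  exact ⟨(S.isPGroup'.map M.subtype).toSylow h1, rfl⟩

theorem IsCharLocallyPNilpotent.of_not_dvd_index (h : IsCharLocallyPNilpotent p G)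
    {M : Subgroup G} (hM : ¬ p ∣ M.index) : IsCharLocallyPNilpotent p M := by
  intro S X hX hne
  obtain ⟨P, hP⟩ := exists_sylow_coe_eq_map_subtype hM S
  obtain ⟨Y, hY, hYne, hYX⟩ := exists_characteristic_map_subtype_eq hP hX hne
  have h1 := h P Y hY hYne
  rw [hYX] at h1
  exact h1.normalizer_of_map

theorem factorization_card_le_of_isPGroup {D M : Subgroup G} (hD : IsPGroup p D) (h : D ≤ M) :
    (Nat.card D).factorization p ≤ (Nat.card M).factorization p ∧
      Nat.card D = p ^ (Nat.card D).factorization p := by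
  refine ⟨(Nat.factorization_le_iff_dvd Nat.card_pos.ne' Nat.card_pos.ne').2
    (Subgroup.card_dvd_of_le h) p, ?_⟩
  obtain ⟨k, hk⟩ := hD.exists_card_eq
  rw [hk, hp.out.factorization_pow, Finsupp.single_eq_same]

/-- The `p`-local subgroup of a normalizer in maximal position inherits the hypothesis. -/
theorem IsCharLocallyPNilpotent.of_forall_lt (h : IsCharLocallyPNilpotent p G) {M : Subgroup G}
    (hmax : ∀ U : Subgroup G, U ≠ ⊥ → IsPGroup p U →
      (Nat.card M).factorization p <
        (Nat.card (Subgroup.normalizer (U : Set G))).factorization p →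
      IsPNilpotent p (Subgroup.normalizer (U : Set G))) : IsCharLocallyPNilpotent p M := by
  intro S X hX hne
  obtain ⟨T, hT⟩ : ∃ T, T = (S : Subgroup M).map M.subtype := ⟨_, rfl⟩
  obtain ⟨Y, hY, hYne, hYX⟩ := exists_characteristic_map_subtype_eq hT hX hne
  have hTp : IsPGroup p T := hT ▸ S.isPGroup'.map M.subtype
  refine IsPNilpotent.normalizer_of_map ?_
  rw [← hYX]
  obtain ⟨R, hR⟩ := hTp.exists_le_sylow
  rcases hR.eq_or_lt with heq | hlt
  · subst heq
    exact h R Y hY hYne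
  · refine hmax _ ?_ (hTp.to_le (Subgroup.map_subtype_le Y)) ?_
    · rwa [ne_eq, Subgroup.map_eq_bot_iff_of_injective _ T.subtype_injective]
    · have h1 := R.isPGroup'.lt_inf_normalizer hlt
      have h2 : IsPGroup p ((R : Subgroup G) ⊓ Subgroup.normalizer (T : Set G) : Subgroup G) :=
        R.isPGroup'.to_le inf_le_left
      obtain ⟨h3, h4⟩ := factorization_card_le_of_isPGroup h2 (inf_le_right.trans hY.normalizer_le)
      refine lt_of_lt_of_le ?_ h3
      have h5 : Nat.card T < Nat.card ((R : Subgroup G) ⊓ Subgroup.normalizer (T : Set G) :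
          Subgroup G) := by
        by_contra! hle
        exact h1.ne (Subgroup.eq_of_le_of_card_ge h1.le hle)
      have h6 : Nat.card T = p ^ (Nat.card M).factorization p := by
        rw [hT, Subgroup.card_map_of_injective M.subtype_injective, S.card_eq_multiplicity]
      rw [h6, h4] at h5
      exact (Nat.pow_lt_pow_iff_right hp.out.one_lt).1 h5

theorem isCharLocallyPNilpotent_quotient {U : Subgroup G} [U.Normal] (hU : IsPGroup p U)
    (hmax : ∀ V : Subgroup G, IsPGroup p V → U < V →
      (∃ P : Sylow p G, (P : Subgroup G) ≤ Subgroup.normalizer (V : Set G)) →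
      IsPNilpotent p (Subgroup.normalizer (V : Set G))) :
    IsCharLocallyPNilpotent p (G ⧸ U) := by
  intro P X hX hne
  obtain ⟨Y, hY⟩ : ∃ Y, Y = X.map (P : Subgroup (G ⧸ U)).subtype := ⟨_, rfl⟩
  have hYne : Y ≠ ⊥ := by
    rwa [hY, ne_eq, Subgroup.map_eq_bot_iff_of_injective _ (Subgroup.subtype_injective _)]
  have hYP : Y ≤ (P : Subgroup (G ⧸ U)) := hY ▸ Subgroup.map_subtype_le X
  have hPY : (P : Subgroup (G ⧸ U)) ≤ Subgroup.normalizer (Y : Set (G ⧸ U)) :=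
    hY ▸ Subgroup.le_normalizer.trans hX.normalizer_le
  rw [← hY]
  have hsurj := QuotientGroup.mk'_surjective U
  have hker : IsPGroup p (QuotientGroup.mk' U).ker := by rwa [QuotientGroup.ker_mk']
  have hcomap : (Subgroup.normalizer (Y : Set (G ⧸ U))).comap (QuotientGroup.mk' U) =
      Subgroup.normalizer (Y.comap (QuotientGroup.mk' U) : Set G) :=
    Subgroup.comap_normalizer_eq_of_surjective Y hsurj
  have h1 := hmax (Y.comap (QuotientGroup.mk' U))
    ((P.isPGroup'.to_le hYP).comap_of_ker_isPGroup _ hker) ?_ ?_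
  · have h2 := h1.map (QuotientGroup.mk' U)
    rwa [← hcomap, Subgroup.map_comap_eq_self_of_surjective hsurj] at h2
  · refine lt_of_le_of_ne ((QuotientGroup.ker_mk' U).ge.trans (Subgroup.ker_le_comap _ _)) ?_
    intro heq
    refine hYne ?_
    rw [← Subgroup.map_comap_eq_self_of_surjective hsurj Y, ← heq, QuotientGroup.map_mk'_self]
  · refine ⟨P.comapOfKerIsPGroup _ hker ?_, ?_⟩
    · rw [MonoidHom.range_eq_top.2 hsurj]
      exact le_top
    · rw [← hcomap]
      exact Subgroup.comap_mono hPY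

/-- A `p`-nilpotency criterion for odd `p`: it suffices that the normalizers of the nontrivial
characteristic subgroups of the Sylow `p`-subgroups are `p`-nilpotent. -/
theorem isPNilpotent_top_of_isCharLocallyPNilpotent (hp2 : p ≠ 2) {G : Type} [Group G] [Finite G]
    (h : IsCharLocallyPNilpotent p G) : IsPNilpotent p (⊤ : Subgroup G) := by
  induction hc : Nat.card G using Nat.strong_induction_on generalizing G with | _ n ih =>
  by_contra hG
  have hex : ∃ U : Subgroup G, U ≠ ⊥ ∧ IsPGroup p U ∧
      ¬ IsPNilpotent p (Subgroup.normalizer (U : Set G)) := by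
    by_contra! hall
    exact hG (isPNilpotent_of_local hall)
  obtain ⟨v, hv⟩ : ∃ v : Subgroup G → ℕ, ∀ U, v U =
    (Nat.card (Subgroup.normalizer (U : Set G))).factorization p := ⟨_, fun _ => rfl⟩
  obtain ⟨⟨U, hUne, hU, hUN⟩, hUmax⟩ : ∃ U : {U : Subgroup G // U ≠ ⊥ ∧ IsPGroup p U ∧
      ¬ IsPNilpotent p (Subgroup.normalizer (U : Set G))}, ∀ V : {U : Subgroup G // U ≠ ⊥ ∧
      IsPGroup p U ∧ ¬ IsPNilpotent p (Subgroup.normalizer (U : Set G))},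
      toLex (v V.1, Nat.card V.1) ≤ toLex (v U.1, Nat.card U.1) := by
    have : Nonempty {U : Subgroup G // U ≠ ⊥ ∧ IsPGroup p U ∧
      ¬ IsPNilpotent p (Subgroup.normalizer (U : Set G))} := ⟨⟨_, hex.choose_spec⟩⟩
    exact Finite.exists_max fun V : {U : Subgroup G // U ≠ ⊥ ∧ IsPGroup p U ∧
      ¬ IsPNilpotent p (Subgroup.normalizer (U : Set G))} => toLex (v V.1, Nat.card V.1)
  have hmax : ∀ V : Subgroup G, V ≠ ⊥ → IsPGroup p V →
      v U < v V ∨ v U = v V ∧ Nat.card U < Nat.card V →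
      IsPNilpotent p (Subgroup.normalizer (V : Set G)) := by
    intro V hVne hV hlt
    by_contra hVN
    exact (Prod.Lex.toLex_lt_toLex.2 hlt).not_ge (hUmax ⟨V, hVne, hV, hVN⟩)
  have hlt : ∀ H : Subgroup G, H ≠ ⊤ → Nat.card H < n := fun H hH => by
    rw [← hc]
    exact lt_of_le_of_ne (Subgroup.card_le_card_group H) fun he => hH (Subgroup.eq_top_of_card_eq H he)
  have hUt : Subgroup.normalizer (U : Set G) = ⊤ := by
    by_contra hne
    refine hUN (IsPNilpotent.of_subtype (ih _ (hlt _ hne) (h.of_forall_lt fun V hVne hV hlt => ?_)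
      rfl))
    exact hmax V hVne hV (Or.inl (by rw [hv, hv]; exact hlt))
  have hUn : U.Normal := Subgroup.normalizer_eq_top_iff.1 hUt
  have hmax' : ∀ V : Subgroup G, IsPGroup p V → U < V →
      (∃ P : Sylow p G, (P : Subgroup G) ≤ Subgroup.normalizer (V : Set G)) →
      IsPNilpotent p (Subgroup.normalizer (V : Set G)) := by
    rintro V hV hUV ⟨P, hP⟩
    refine hmax V (ne_bot_of_gt hUV) hV ?_
    have h1 : v U ≤ v V := by
      rw [hv, hv, hUt, Subgroup.card_top]
      have h2 := (factorization_card_le_of_isPGroup P.isPGroup' hP).1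
      rwa [P.card_eq_multiplicity, hp.out.factorization_pow, Finsupp.single_eq_same] at h2
    refine (lt_or_eq_of_le h1).imp_right fun h2 => ⟨h2, ?_⟩
    by_contra! hle
    exact hUV.ne (Subgroup.eq_of_le_of_card_ge hUV.le hle)
  refine hG (isPNilpotent_top_of_isCharLocallyPNilpotent_aux hp2 h hU hUne ?_ ?_ hmax')
  · exact ih _ (hc ▸ Subgroup.card_quotient_lt hUne) (isCharLocallyPNilpotent_quotient hU hmax') rfl
  · intro P H hPH hH
    refine IsPNilpotent.of_subtype (ih _ (hlt _ hH) (h.of_not_dvd_index fun hd => ?_) rfl)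
    exact P.not_dvd_index (hd.trans (Subgroup.index_dvd_of_le hPH))

end GlaubermanThompson

section FixedPointFree

variable {K : Type*} [Group K] {r : ℕ} {φ : K →* K}

/-- `φ` satisfies `φ ^ r = 1` and fixes only the identity. -/
def IsFixedPointFree (r : ℕ) (φ : K →* K) : Prop :=
  (∀ x, φ^[r] x = x) ∧ ∀ x, φ x = x → x = 1

theorem MonoidHom.iterate_apply_of_semiconj {S : Type*} [Group S] {f : S →* K} {ψ : S →* S}
    (h : ∀ s, f (ψ s) = φ (f s)) (i : ℕ) (s : S) : f (ψ^[i] s) = φ^[i] (f s) := by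
  induction i generalizing s with
  | zero => rfl
  | succ i ih => rw [Function.iterate_succ_apply, Function.iterate_succ_apply, ih, h]

namespace IsFixedPointFree

theorem of_semiconj {S : Type*} [Group S] {f : S →* K} (hf : Function.Injective f) {ψ : S →* S}
    (h : ∀ s, f (ψ s) = φ (f s)) (hφ : IsFixedPointFree r φ) : IsFixedPointFree r ψ :=
  ⟨fun s => hf (by rw [MonoidHom.iterate_apply_of_semiconj h, hφ.1]),
    fun s hs => hf (by rw [map_one]; exact hφ.2 _ (by rw [← h, hs]))⟩

theorem eq_one_of_iterate_eq (hφ : IsFixedPointFree r φ) (hr : r.Prime) {i : ℕ} (hi : 0 < i)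
    (hir : i < r) {x : K} (hx : φ^[i] x = x) : x = 1 := by
  have h1 : Function.IsPeriodicPt φ (Nat.gcd i r) x := Function.IsPeriodicPt.gcd hx (hφ.1 x)
  rw [Nat.gcd_comm, (Nat.coprime_of_lt_prime hi.ne' hir hr).gcd_eq_one] at h1
  exact hφ.2 x h1

theorem injective (hφ : IsFixedPointFree r φ) (hr : r ≠ 0) : Function.Injective φ := by
  obtain ⟨n, rfl⟩ := Nat.exists_eq_succ_of_ne_zero hr
  refine Function.LeftInverse.injective (g := φ^[n]) fun x => ?_
  rw [← Function.iterate_succ_apply]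
  exact hφ.1 x

/-- An invariant subgroup is mapped onto itself. -/
theorem exists_mem_apply_eq (hφ : IsFixedPointFree r φ) (hr : r ≠ 0) {S : Subgroup K}
    (hS : ∀ x ∈ S, φ x ∈ S) {x : K} (hx : x ∈ S) : ∃ y ∈ S, φ y = x := by
  obtain ⟨n, rfl⟩ := Nat.exists_eq_succ_of_ne_zero hr
  refine ⟨φ^[n] x, Set.MapsTo.iterate (s := (S : Set K)) (fun y hy => hS y hy) n hx, ?_⟩
  exact (Function.iterate_succ_apply' φ n x).symm.trans (hφ.1 x)

theorem bijective_inv_mul_iterate [Finite K] (hφ : IsFixedPointFree r φ) (hr : r.Prime) {i : ℕ}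
    (hi : 0 < i) (hir : i < r) : Function.Bijective fun x => x⁻¹ * φ^[i] x := by
  rw [← Finite.injective_iff_bijective]
  intro x y hxy
  have hxy : x⁻¹ * φ^[i] x = y⁻¹ * φ^[i] y := hxy
  refine (mul_inv_eq_one.1 (hφ.eq_one_of_iterate_eq hr hi hir (x := y * x⁻¹) ?_)).symm
  rw [iterate_map_mul, iterate_map_inv, mul_inv_eq_iff_eq_mul, mul_assoc, hxy,
    mul_inv_cancel_left]

theorem exists_inv_mul_eq [Finite K] (hφ : IsFixedPointFree r φ) (hr : r.Prime) (x : K) :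
    ∃ y, y⁻¹ * φ y = x :=
  (hφ.bijective_inv_mul_iterate hr one_pos hr.one_lt).2 x

/-- The restriction of an endomorphism to an invariant subgroup. -/
def restrict (φ : K →* K) (S : Subgroup K) (hS : ∀ x ∈ S, φ x ∈ S) : S →* S :=
  (φ.comp S.subtype).codRestrict S fun x => hS x x.2

theorem subgroup (hφ : IsFixedPointFree r φ) {S : Subgroup K} (hS : ∀ x ∈ S, φ x ∈ S) :
    IsFixedPointFree r (restrict φ S hS) :=
  hφ.of_semiconj S.subtype_injective fun _ => rfl

theorem quotient [Finite K] (hφ : IsFixedPointFree r φ) (hr : r.Prime) {N : Subgroup K} [N.Normal]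
    (hN : ∀ x ∈ N, φ x ∈ N) :
    IsFixedPointFree r (QuotientGroup.map N N φ hN) := by
  refine ⟨fun x => ?_, fun x hx => ?_⟩ <;> obtain ⟨x, rfl⟩ := QuotientGroup.mk'_surjective N x
  · have : Function.Semiconj (QuotientGroup.mk' N) φ (QuotientGroup.map N N φ hN) := fun _ => rfl
    rw [← (this.iterate_right r).eq, hφ.1]
  · obtain ⟨⟨y, hy⟩, hxy⟩ := (hφ.subgroup hN).exists_inv_mul_eq hr
      ⟨x⁻¹ * φ x, QuotientGroup.eq.1 hx.symm⟩
    have h1 : y⁻¹ * φ y = x⁻¹ * φ x := congrArg Subtype.val hxy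
    have h2 := (hφ.bijective_inv_mul_iterate hr one_pos hr.one_lt).1 h1
    exact (QuotientGroup.eq_one_iff x).2 (h2 ▸ hy)

theorem conj [Finite K] (hφ : IsFixedPointFree r φ) (hr : r.Prime) (z : K) :
    IsFixedPointFree r ((MulAut.conj z).toMonoidHom.comp φ) := by
  obtain ⟨y, rfl⟩ := hφ.exists_inv_mul_eq hr z
  refine hφ.of_semiconj (f := (MulAut.conj y).toMonoidHom) (MulAut.conj y).injective fun s => ?_
  change y * ((y⁻¹ * φ y) * φ s * (y⁻¹ * φ y)⁻¹) * y⁻¹ = φ (y * s * y⁻¹)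
  rw [map_mul, map_mul, map_inv]
  group

theorem exists_conj_sylow [Finite K] (hφ : IsFixedPointFree r φ) (hr : r.Prime) {q : ℕ}
    [Fact q.Prime] (Q : Sylow q K) : ∃ z : K, ∀ x ∈ Q, z * φ x * z⁻¹ ∈ Q := by
  have hs : Function.Surjective φ := Finite.surjective_of_injective (hφ.injective hr.ne_zero)
  obtain ⟨z, hz⟩ := MulAction.exists_smul_eq K (Q.mapSurjective hs) Q
  refine ⟨z, fun x hx => ?_⟩
  rw [← hz]
  exact ⟨φ x, ⟨x, hx, rfl⟩, rfl⟩

theorem prod_iterate_eq_one {V : Type*} [CommGroup V] {α : V →* V} (hα : IsFixedPointFree r α)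
    (v : V) : ∏ i ∈ Finset.range r, α^[i] v = 1 := by
  refine hα.2 _ ?_
  rw [map_prod]
  have h1 := (Finset.prod_range_succ (fun i => α^[i] v) r).symm.trans
    (Finset.prod_range_succ' (fun i => α^[i] v) r)
  rw [hα.1, Function.iterate_zero, id_eq, mul_left_inj] at h1
  rw [h1]
  exact Finset.prod_congr rfl fun i _ => (Function.iterate_succ_apply' _ _ _).symm

/-- Compatible fixed-point-free actions on `Q` and on an abelian group `V` acted on by `Q` force
`Q` to fix the `|Q|`-th powers in `V`. -/
theorem apply_pow_card_eq {Q V : Type*} [Group Q] [Finite Q] [CommGroup V] {ψ : Q →* Q}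
    {α : V →* V} (hψ : IsFixedPointFree r ψ) (hα : IsFixedPointFree r α) (hr : r.Prime)
    (ρ : Q →* MulAut V) (h : ∀ q v, α (ρ q v) = ρ (ψ q) (α v)) (q : Q) (v : V) :
    ρ q (v ^ Nat.card Q) = v ^ Nat.card Q := by
  have := Fintype.ofFinite Q
  have hit : ∀ (i : ℕ) (q : Q) (v : V), α^[i] (ρ q v) = ρ (ψ^[i] q) (α^[i] v) := by
    intro i
    induction i with
    | zero => exact fun _ _ => rfl
    | succ i ih =>
      intro q v
      simp only [Function.iterate_succ_apply, h, ih]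
  obtain ⟨T, hT⟩ : ∃ T : V → V, ∀ w, T w = ∏ x : Q, ρ x w := ⟨_, fun _ => rfl⟩
  have hTfix : ∀ w, ρ q (T w) = T w := by
    intro w
    rw [hT, map_prod]
    exact Fintype.prod_equiv (Equiv.mulLeft q) _ _ fun x => by
      rw [Equiv.coe_mulLeft, map_mul, MulAut.mul_apply]
  have h1 : ∀ x : Q, ∏ i ∈ Finset.range r, ρ (x⁻¹ * ψ^[i] x) (α^[i] v) = 1 := by
    intro x
    rw [← map_one (ρ x⁻¹), ← hα.prod_iterate_eq_one (ρ x v), map_prod]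
    refine Finset.prod_congr rfl fun i _ => ?_
    rw [hit, map_mul, MulAut.mul_apply]
  have h2 : ∏ i ∈ Finset.range r, ∏ x : Q, ρ (x⁻¹ * ψ^[i] x) (α^[i] v) = 1 := by
    rw [Finset.prod_comm]
    exact Finset.prod_eq_one fun x _ => h1 x
  obtain ⟨n, rfl⟩ := Nat.exists_eq_succ_of_ne_zero hr.ne_zero
  rw [Finset.prod_range_succ'] at h2
  have h3 : ∏ x : Q, ρ (x⁻¹ * ψ^[0] x) (α^[0] v) = v ^ Nat.card Q := by
    simp [Nat.card_eq_fintype_card]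
  have h4 : ∏ i ∈ Finset.range n, ∏ x : Q, ρ (x⁻¹ * ψ^[i + 1] x) (α^[i + 1] v) =
      ∏ i ∈ Finset.range n, T (α^[i + 1] v) := by
    refine Finset.prod_congr rfl fun i hi => ?_
    rw [hT]
    exact Fintype.prod_bijective _ (hψ.bijective_inv_mul_iterate hr i.succ_pos
      (Nat.succ_lt_succ (Finset.mem_range.1 hi))) _ _ fun _ => rfl
  rw [h3, h4] at h2
  rw [eq_inv_of_mul_eq_one_right h2, map_inv, map_prod]
  exact congrArg _ (Finset.prod_congr rfl fun i _ => hTfix _)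

/-- Sylow `q`-subgroups centralize an invariant normal elementary abelian `ℓ`-subgroup, `q ≠ ℓ`. -/
theorem commute_of_isElementaryAbelian [Finite K] (hφ : IsFixedPointFree r φ) (hr : r.Prime)
    {l q : ℕ} [hl : Fact l.Prime] [hq : Fact q.Prime] (hql : q ≠ l) {V : Subgroup K}
    [hVn : V.Normal] (hV : IsElementaryAbelian l V) (hVφ : ∀ x ∈ V, φ x ∈ V) (Q : Sylow q K) :
    ∀ x ∈ Q, ∀ v ∈ V, Commute x v := by
  obtain ⟨z, hz⟩ := hφ.exists_conj_sylow hr Q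
  have hφ' := hφ.conj hr z
  have hVφ' : ∀ x ∈ V, ((MulAut.conj z).toMonoidHom.comp φ) x ∈ V := fun x hx =>
    hVn.conj_mem _ (hVφ x hx) z
  have hQφ' : ∀ x ∈ (Q : Subgroup K), ((MulAut.conj z).toMonoidHom.comp φ) x ∈ (Q : Subgroup K) :=
    hz
  let _ : CommGroup V := { (inferInstance : Group V) with
    mul_comm := fun a b => Subtype.ext (hV.1 a a.2 b b.2) }
  intro x hx v hv
  have h1 := apply_pow_card_eq (hφ'.subgroup hQφ') (hφ'.subgroup hVφ') hr
    ((MulAut.conjNormal (H := V)).comp (Q : Subgroup K).subtype)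
    (fun q v => Subtype.ext (by
      change (MulAut.conj z).toMonoidHom.comp φ (q * v * (q : K)⁻¹) = _
      rw [map_mul, map_mul, map_inv]
      rfl)) ⟨x, hx⟩ ⟨v, hv⟩
  have h2 : x * v ^ Nat.card Q * x⁻¹ = v ^ Nat.card Q := congrArg Subtype.val h1
  have h3 : Commute x (v ^ Nat.card Q) := mul_inv_eq_iff_eq_mul.1 h2
  have hcop : (Nat.card Q).Coprime l := by
    obtain ⟨k, hk⟩ := Q.isPGroup'.exists_card_eq
    rw [hk]
    exact Nat.Coprime.pow_left k ((Nat.coprime_primes hq.out hl.out).2 hql)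
  obtain ⟨m, hm⟩ := exists_pow_eq_self_of_coprime
    (hcop.coprime_dvd_right (orderOf_dvd_of_pow_eq_one (hV.2 v hv)))
  rw [← hm]
  exact h3.pow_right m

end IsFixedPointFree

theorem Subgroup.mem_normalizer_of_forall [Finite K] {S : Subgroup K} {g : K}
    (h : ∀ x ∈ S, g * x * g⁻¹ ∈ S) : g ∈ Subgroup.normalizer (S : Set K) := by
  have h1 : S.map (MulAut.conj g).toMonoidHom = S := by
    refine Subgroup.eq_of_le_of_card_ge ?_ ?_
    · rintro _ ⟨x, hx, rfl⟩
      exact h x hx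
    · rw [Subgroup.card_map_of_injective (MulAut.conj g).injective]
  refine Subgroup.mem_normalizer_iff.2 fun x => ⟨h x, fun hx => ?_⟩
  rw [← h1] at hx
  obtain ⟨y, hy, hyx⟩ := hx
  rwa [← (MulAut.conj g).injective hyx]

end FixedPointFree

section Thompson

variable {K : Type} [Group K] [Finite K] {r : ℕ} {φ : K →* K}

/-- Either `K` is a group of prime power order or a conjugate of `φ` leaves invariant some
nontrivial proper normal subgroup. -/
theorem IsFixedPointFree.exists_normal_or_isPGroup (hφ : IsFixedPointFree r φ) (hr : r.Prime)
    (ih : ∀ (H : Subgroup K) (ψ : H →* H), H ≠ ⊤ → IsFixedPointFree r ψ → Group.IsNilpotent H) :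
    Group.IsNilpotent K ∨ ∃ (L : Subgroup K) (ψ : K →* K), IsFixedPointFree r ψ ∧ L.Normal ∧
      L ≠ ⊥ ∧ L ≠ ⊤ ∧ ∀ x ∈ L, ψ x ∈ L := by
  refine or_iff_not_imp_left.2 fun hK => ?_
  have hKp : ∀ p, p.Prime → ¬ IsPGroup p K := fun p hp h =>
    hK (have : Fact p.Prime := ⟨hp⟩; h.isNilpotent)
  obtain ⟨p, hp, hpK, hp2⟩ : ∃ p, p.Prime ∧ p ∣ Nat.card K ∧ p ≠ 2 := by
    by_contra! hall
    exact hKp 2 Nat.prime_two (IsPGroup.of_card (Nat.eq_prime_pow_of_unique_prime_dvd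
      Nat.card_pos.ne' fun {d} hd hdK => hall d hd hdK))
  have : Fact p.Prime := ⟨hp⟩
  by_cases h : IsCharLocallyPNilpotent p K
  · have hN := isPNilpotent_top_of_isCharLocallyPNilpotent hp2 h
    refine ⟨hN.complement, φ, hφ, hN.complement_normal, fun hbot => hKp p hp fun x => ?_,
      fun htop => ?_, fun x hx => ⟨Subgroup.mem_top _, hx.2.map φ⟩⟩
    · obtain ⟨a, ha⟩ := exists_isPRegular_pow_prime_pow (p := p) x
      have h1 : x ^ p ^ a ∈ hN.complement := ⟨Subgroup.mem_top _, ha⟩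
      rw [hbot] at h1
      exact ⟨a, Subgroup.mem_bot.1 h1⟩
    · refine not_dvd_card_of_forall_isPRegular (p := p) (M := hN.complement) (fun x hx => hx.2) ?_
      rwa [htop, Subgroup.card_top]
  · simp only [IsCharLocallyPNilpotent, not_forall] at h
    obtain ⟨P, X, hX, hXne, hXN⟩ := h
    obtain ⟨z, hz⟩ := hφ.exists_conj_sylow hr P
    obtain ⟨ψ, hψd⟩ : ∃ ψ, ψ = (MulAut.conj z).toMonoidHom.comp φ := ⟨_, rfl⟩
    have hψ : IsFixedPointFree r ψ := hψd ▸ hφ.conj hr z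
    have hPψ : ∀ x ∈ (P : Subgroup K), ψ x ∈ (P : Subgroup K) := hψd ▸ hz
    obtain ⟨Y, hY⟩ : ∃ Y, Y = X.map (P : Subgroup K).subtype := ⟨_, rfl⟩
    rw [← hY] at hXN
    have hYne : Y ≠ ⊥ := by
      rwa [hY, ne_eq, Subgroup.map_eq_bot_iff_of_injective _ (Subgroup.subtype_injective _)]
    have hYp : IsPGroup p Y := P.isPGroup'.to_le (hY ▸ Subgroup.map_subtype_le X)
    have hYψ : ∀ x ∈ Y, ψ x ∈ Y := by
      have hb : Function.Bijective (restrict ψ (P : Subgroup K) hPψ) :=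
        Finite.injective_iff_bijective.1 ((hψ.subgroup hPψ).injective hr.ne_zero)
      rw [hY]
      rintro _ ⟨x, hx, rfl⟩
      exact ⟨_, Subgroup.characteristic_iff_map_le.1 hX (MulEquiv.ofBijective _ hb) ⟨x, hx, rfl⟩,
        rfl⟩
    have hNψ : ∀ g ∈ Subgroup.normalizer (Y : Set K), ψ g ∈ Subgroup.normalizer (Y : Set K) := by
      intro g hg
      refine Subgroup.mem_normalizer_of_forall fun x hx => ?_
      obtain ⟨w, hw, rfl⟩ := hψ.exists_mem_apply_eq hr.ne_zero hYψ hx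
      rw [← map_inv, ← map_mul, ← map_mul]
      exact hYψ _ ((Subgroup.mem_normalizer_iff.1 hg w).1 hw)
    have hYn : Y.Normal := by
      by_contra hYn
      exact hXN (isPNilpotent_of_isNilpotent (ih _ _
        (fun h => hYn (Subgroup.normalizer_eq_top_iff.1 h)) (hψ.subgroup hNψ)))
    exact ⟨Y, ψ, hψ, hYn, hYne, fun htop => hKp p hp
      (by rw [htop] at hYp; exact hYp.of_equiv Subgroup.topEquiv), hYψ⟩

/-- An invariant nilpotent normal subgroup `L ≠ 1` forces a nontrivial center. -/
theorem IsFixedPointFree.center_ne_bot (hφ : IsFixedPointFree r φ) (hr : r.Prime)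
    {L : Subgroup K} [L.Normal] (hL : Group.IsNilpotent L) (hLne : L ≠ ⊥)
    (hLφ : ∀ x ∈ L, φ x ∈ L) : Subgroup.center K ≠ ⊥ := by
  have hLnt : Nontrivial L := (Subgroup.nontrivial_iff_ne_bot L).2 hLne
  have hZ : Nat.card (Subgroup.center L) ≠ 1 := fun h1 =>
    Group.IsNilpotent.center_ne_bot (G := L) (Subgroup.card_eq_one.1 h1)
  obtain ⟨l, hl, hlZ⟩ := Nat.exists_prime_and_dvd hZ
  have : Fact l.Prime := ⟨hl⟩
  obtain ⟨V, hVd⟩ : ∃ V, V = L.omegaCenter l := ⟨_, rfl⟩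
  have hVn : V.Normal := hVd ▸ inferInstance
  have hV : IsElementaryAbelian l V := hVd ▸ L.isElementaryAbelian_omegaCenter
  have hVne : V ≠ ⊥ := hVd ▸ Subgroup.omegaCenter_ne_bot hlZ
  have hVφ : ∀ x ∈ V, φ x ∈ V := by
    intro x hx
    rw [hVd] at hx ⊢
    refine ⟨hLφ x hx.1, fun u hu => ?_, by rw [← map_pow, hx.2.2, map_one]⟩
    obtain ⟨w, hw, rfl⟩ := hφ.exists_mem_apply_eq hr.ne_zero hLφ hu
    exact (hx.2.1 w hw).map φ
  obtain ⟨P⟩ : Nonempty (Sylow l K) := inferInstance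
  obtain ⟨v, hvV, hv1, hvP⟩ : ∃ v ∈ V, v ≠ 1 ∧ ∀ x ∈ P, Commute x v := by
    have hVP : V ≤ (P : Subgroup K) := hV.isPGroup.le_sylow_of_normal P
    let _ : MulAction P V := MulAction.compHom V
      ((MulAut.conjNormal (H := V)).comp (P : Subgroup K).subtype)
    have hVnt : Nontrivial V := (Subgroup.nontrivial_iff_ne_bot V).2 hVne
    have hdvd : l ∣ Nat.card V := by
      obtain ⟨n, hn0, hn⟩ := hV.isPGroup.nontrivial_iff_card.1 hVnt
      exact hn ▸ dvd_pow_self l hn0.ne'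
    obtain ⟨v, hv, hv1⟩ := P.isPGroup'.exists_fixed_point_of_prime_dvd_card_of_fixed_point V hdvd
      (a := 1) fun x => map_one (MulAut.conjNormal (H := V) (x : K))
    refine ⟨v, v.2, fun h => hv1 (Subtype.ext h.symm), fun x hx => ?_⟩
    have h1 : x * v * x⁻¹ = v := congrArg Subtype.val (hv ⟨x, hx⟩)
    exact mul_inv_eq_iff_eq_mul.1 h1
  have htop : Subgroup.centralizer {v} = ⊤ := by
    by_contra hne
    obtain ⟨q, hq, hQ⟩ := exists_sylow_not_le hne
    by_cases hql : q = l
    · subst hql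
      exact hQ P fun x hx => Subgroup.mem_centralizer_singleton_iff.2 (hvP x hx)
    · exact hQ default fun x hx => Subgroup.mem_centralizer_singleton_iff.2
        (hφ.commute_of_isElementaryAbelian hr hql hV hVφ default x hx v hvV)
  intro hbot
  refine hv1 (Subgroup.mem_bot.1 (hbot ▸ Subgroup.mem_center_iff.2 fun g => ?_))
  exact Subgroup.mem_centralizer_singleton_iff.1 (htop ▸ Subgroup.mem_top g)

/-- Thompson's theorem: a finite group with a fixed-point-free automorphism of prime order is
nilpotent. -/
theorem isNilpotent_of_isFixedPointFree (hr : r.Prime) {K : Type} [Group K] [Finite K]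
    {φ : K →* K} (hφ : IsFixedPointFree r φ) : Group.IsNilpotent K := by
  induction hc : Nat.card K using Nat.strong_induction_on generalizing K with | _ n ih =>
  have ihs : ∀ (H : Subgroup K) (ψ : H →* H), H ≠ ⊤ → IsFixedPointFree r ψ →
      Group.IsNilpotent H := fun H ψ hH hψ => by
    refine ih _ ?_ hψ rfl
    rw [← hc]
    exact lt_of_le_of_ne (Subgroup.card_le_card_group H) fun he =>
      hH (Subgroup.eq_top_of_card_eq H he)
  rcases hφ.exists_normal_or_isPGroup hr ihs with h | ⟨L, ψ, hψ, hL, hLne, hLt, hLψ⟩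
  · exact h
  have hZ := hψ.center_ne_bot hr (ihs L _ hLt (hψ.subgroup hLψ)) hLne hLψ
  have hZψ : ∀ x ∈ Subgroup.center K, ψ x ∈ Subgroup.center K := by
    intro x hx
    refine Subgroup.mem_center_iff.2 fun g => ?_
    obtain ⟨w, -, rfl⟩ := hψ.exists_mem_apply_eq hr.ne_zero (S := ⊤)
      (fun _ _ => Subgroup.mem_top _) (Subgroup.mem_top g)
    rw [← map_mul, ← map_mul, Subgroup.mem_center_iff.1 hx w]
  have := ih _ (hc ▸ Subgroup.card_quotient_lt hZ) (hψ.quotient hr hZψ) rfl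
  exact Subgroup.isNilpotent_of_ker_le_center (QuotientGroup.mk' (Subgroup.center K))
    (QuotientGroup.ker_mk' _).le

end Thompson

section Frobenius

theorem IsFrobenius.isNilpotent_kernel {X : Type} [Group X] [Finite X] {M C : Subgroup X}
    (h : IsFrobenius M C) : Group.IsNilpotent M := by
  obtain ⟨⟨-, hM, hMn, hc⟩, htop, hbot⟩ := h
  have hC : C ≠ ⊥ := by
    rintro rfl
    exact hM (by rwa [sup_bot_eq] at htop)
  obtain ⟨r, hr, hrC⟩ := Nat.exists_prime_and_dvd fun h1 => hC (Subgroup.card_eq_one.1 h1)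
  have : Fact r.Prime := ⟨hr⟩
  obtain ⟨k, hk⟩ := exists_prime_orderOf_dvd_card' r hrC
  have hit : ∀ (i : ℕ) (x : M), ((MulAut.conjNormal (k : X)).toMonoidHom : M →* M)^[i] x =
      MulAut.conjNormal ((k : X) ^ i) x := by
    intro i
    induction i with
    | zero => exact fun x => by rw [pow_zero, map_one]; rfl
    | succ i ih =>
      intro x
      rw [Function.iterate_succ_apply', ih, pow_succ', map_mul]
      rfl
  have hk1 : (k : X) ^ r = 1 := by rw [← hk, ← Subgroup.orderOf_coe, pow_orderOf_eq_one]
  refine isNilpotent_of_isFixedPointFree (φ := (MulAut.conjNormal (k : X)).toMonoidHom) hr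
    ⟨fun x => by rw [hit, hk1, map_one]; rfl, fun x hx => ?_⟩
  by_contra hx1
  have h1 : (k : X) * x * (k : X)⁻¹ = x := congrArg Subtype.val hx
  have h2 : (k : X) ∈ M := hc x x.2 (fun h => hx1 (Subtype.ext h))
    (Subgroup.mem_centralizer_singleton_iff.2 (mul_inv_eq_iff_eq_mul.1 h1))
  have h3 : (k : X) = 1 := Subgroup.mem_bot.1 (hbot ▸ Subgroup.mem_inf.2 ⟨h2, k.2⟩)
  rw [← Subgroup.orderOf_coe, h3, orderOf_one] at hk
  exact hr.ne_one hk.symm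

theorem Subgroup.isNilpotent_of_map_center {G : Type*} [Group G] {N : Subgroup G}
    (h : Group.IsNilpotent (N.map (QuotientGroup.mk' (Subgroup.center G)))) :
    Group.IsNilpotent N := by
  refine Subgroup.isNilpotent_of_ker_le_center ((QuotientGroup.mk' (Subgroup.center G)).subgroupMap N)
    fun x hx => Subgroup.mem_center_iff.2 fun y => Subtype.ext ?_
  have h1 : QuotientGroup.mk' (Subgroup.center G) (x : G) = 1 := congrArg Subtype.val hx
  rw [← MonoidHom.mem_ker, QuotientGroup.ker_mk'] at h1
  exact Subgroup.mem_center_iff.1 h1 y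

end Frobenius

/-- Theorem 3.3: `vcs(G) = {s}` and `G` has a nilpotent Hall `π(s)`-subgroup
iff `G = NH` with `N` a normal Hall `π(s)`-subgroup, `H` an abelian
`π(s)`-complement, and (a) or (b) holds. -/
theorem statement11 (G : Type) [Group G] [Finite G] (s : ℕ) (hs : 0 < s) :
    (vcs G = {s} ∧
      ∃ K : Subgroup G, IsHallSubgroup (primesOf s) K ∧ Group.IsNilpotent ↥K) ↔
      ∃ N H : Subgroup G, N.Normal ∧ IsHallSubgroup (primesOf s) N ∧
        IsHallSubgroup (primesOf s)ᶜ H ∧ IsAbelianSubgroup H ∧ N ⊔ H = ⊤ ∧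
        ((IsPrimePow s ∧ (∀ h ∈ H, ∀ n ∈ N, Commute h n) ∧ cs ↥N = {1, s}) ∨
         (IsFrobenius (N.map (QuotientGroup.mk' (Subgroup.center G)))
            (H.map (QuotientGroup.mk' (Subgroup.center G))) ∧
          Nat.card (N.map (QuotientGroup.mk' (Subgroup.center G))) = s ∧
          ∀ x ∈ N, ¬ IsVanishing G x)) := by
  constructor
  · rintro ⟨hvcs, N, hN, hnil⟩
    have hv : ∀ g : G, IsVanishing G g → ∀ p : ℕ, p.Prime → p ∣ classSize g →
        p ∈ primesOf s := fun g hg p hp hd => by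
      have h1 : classSize g ∈ vcs G := ⟨g, hg, rfl⟩
      rw [hvcs, Set.mem_singleton_iff] at h1
      exact ⟨hp, h1 ▸ hd⟩
    have hNn := hN.normal_of_isNilpotent hnil hv
    obtain ⟨H, hH, hab, htop, -, hcomm⟩ := exists_abelian_complement hN hv
    refine ⟨N, H, hNn, hN, hH, hab, htop, ?_⟩
    by_cases hHN : ∀ h ∈ H, ∀ n ∈ N, Commute h n
    · obtain ⟨h1, h2⟩ := isPrimePow_and_cs_of_centralizing_complement hvcs hnil hab htop hHN
      exact Or.inl ⟨h1, hHN, h2⟩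
    · push Not at hHN
      exact Or.inr (isFrobenius_of_vcs hvcs hN hH hnil hcomm htop hab hHN)
  · rintro ⟨N, H, hNn, hN, -, hab, htop, ⟨hpp, hHN, hcs⟩ | ⟨hF, hcard, hv⟩⟩
    · obtain ⟨h1, h2⟩ := isNilpotent_and_vcs_of_centralizing_complement hN hab htop hpp hHN hcs
      exact ⟨h2, N, hN, h1⟩
    · exact ⟨vcs_of_isFrobenius hab htop hF hcard hv, N, hN,
        Subgroup.isNilpotent_of_map_center hF.isNilpotent_kernel⟩
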